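/- arXiv:1202.6048 — 7 statements merged into one kernel-verified Lean document; each statement's English description precedes it below -/
import Mathlib

section
/- Let q : ℝ → ℂ be 1-periodic and integrable on [0,1] with Fourier coefficients q_m = 0 for all integers m ≤ 0, let t ∈ (−π, π] with t ≠ 0 and t ≠ π, and let n be an integer. For each integer p ≥ 1 define d_p = ((2πn + t)² − (2π(n + p) + t)²)^{−1} and c_p = d_p·( q_p + Σ_{k=1}^{p−1} Σ q_{n_1}·q_{n_2}⋯q_{n_k}·q_{p − n_1 − ⋯ − n_k} / ∏_{s=1}^{k} ((2πn + t)² − (2π(n + p − n_1 − ⋯ − n_s) + t)²) ), where the inner sum is over all tuples of positive integers (n_1, …, n_k) such that p − (n_1 + ⋯ + n_s) ≥ 1 for every s = 1, …, k. Then there exists an eigenfunction Ψ of L_t(q) corresponding to the eigenvalue (2πn + t)² such that ∫₀¹ Ψ(x)·exp(−i(2πn + t)x) dx = 1, ∫₀¹ Ψ(x)·exp(−i(2π(n + p) + t)x) dx = c_p for every integer p ≥ 1, and ∫₀¹ Ψ(x)·exp(−i(2π(n + p) + t)x) dx = 0 for every integer p ≤ −1. -/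
open Real Complex Set MeasureTheory

/-- The `m`-th Fourier coefficient of `q` on `[0,1]`. -/
noncomputable def fourierCoeff01 (q : ℝ → ℂ) (m : ℤ) : ℂ :=
  ∫ x in (0:ℝ)..1, q x * Complex.exp (-(2 * Real.pi * Complex.I * m) * (x : ℂ))

/-- `y` is an eigenfunction of `L_t(q)` corresponding to `λ`, in the integrated
(Carathéodory) sense: `y` is continuously differentiable with derivative `g`
satisfying `g x = g 0 + ∫₀ˣ (q − λ) y`, `y` is not identically zero on `[0,1]`,
and `y` satisfies the `t`-quasiperiodic boundary conditions. -/
def IsEigenfunL (q : ℝ → ℂ) (t : ℝ) (lam : ℂ) (y : ℝ → ℂ) : Prop :=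
  ∃ g : ℝ → ℂ, ContinuousOn y (Set.Icc (0:ℝ) 1) ∧ ContinuousOn g (Set.Icc (0:ℝ) 1) ∧
    (∀ x ∈ Set.Icc (0:ℝ) 1, y x = y 0 + ∫ s in (0:ℝ)..x, g s) ∧
    (∀ x ∈ Set.Icc (0:ℝ) 1, g x = g 0 + ∫ s in (0:ℝ)..x, (q s - lam) * y s) ∧
    (¬ ∀ x ∈ Set.Icc (0:ℝ) 1, y x = 0) ∧
    y 1 = Complex.exp (Complex.I * t) * y 0 ∧
    g 1 = Complex.exp (Complex.I * t) * g 0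

/-- `λ` is an eigenvalue of `L_t(q)`. -/
def IsEigenvalueL (q : ℝ → ℂ) (t : ℝ) (lam : ℂ) : Prop :=
  ∃ y : ℝ → ℂ, IsEigenfunL q t lam y

/-- Partial sum `n_1 + ⋯ + n_s` of the first `s` entries of a tuple. -/
def psum {k : ℕ} (v : Fin k → ℕ) (s : ℕ) : ℕ :=
  ∑ i ∈ Finset.univ.filter (fun i : Fin k => (i : ℕ) < s), v i

/-- Tuples `(n_1,…,n_k)` of positive integers with `p − (n_1+⋯+n_s) ≥ 1`
for every `s = 1,…,k`. -/
noncomputable def gasymovTuples (k p : ℕ) : Finset (Fin k → ℕ) :=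
  open scoped Classical in
  (Fintype.piFinset fun _ : Fin k => Finset.Icc 1 p).filter
    fun v => ∀ s ∈ Finset.Icc 1 k, psum v s < p

/-- `d_p = ((2πn+t)² − (2π(n+p)+t)²)⁻¹`. -/
noncomputable def dCoef (n : ℤ) (t : ℝ) (p : ℤ) : ℂ :=
  ((((2 * Real.pi * n + t : ℝ)) : ℂ)^2 - (((2 * Real.pi * (n + p) + t : ℝ)) : ℂ)^2)⁻¹

/-- The coefficient `c_p` from Gasymov-type expansion of the eigenfunction. -/
noncomputable def cCoef (q : ℝ → ℂ) (n : ℤ) (t : ℝ) (p : ℕ) : ℂ :=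
  dCoef n t p *
    (fourierCoeff01 q p +
      ∑ k ∈ Finset.Icc 1 (p - 1),
        ∑ v ∈ gasymovTuples k p,
          ((∏ i, fourierCoeff01 q (v i)) *
              fourierCoeff01 q ((p : ℤ) - ∑ i, (v i : ℤ))) /
            ∏ s ∈ Finset.Icc 1 k,
              ((((2 * Real.pi * n + t : ℝ)) : ℂ)^2 -
                (((2 * Real.pi * (n + (p : ℤ) - (psum v s : ℤ)) + t : ℝ)) : ℂ)^2))

/-- Integration by parts of an exponential against the primitive of an integrable function. -/
theorem integral_primitive_mul_exp {F : ℝ → ℂ} (hF : IntervalIntegrable F volume 0 1) (a : ℂ) :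
    ∫ x in (0:ℝ)..1, (∫ s in (0:ℝ)..x, F s) * (a * Complex.exp (a * x)) =
      Complex.exp a * (∫ s in (0:ℝ)..1, F s) - ∫ s in (0:ℝ)..1, F s * Complex.exp (a * s) := by
  set u : ℝ → ℂ := fun x => a * Complex.exp (a * x) with hu
  have huc : Continuous u := by fun_prop
  have hui : ∀ s : ℝ, ∫ x in s..1, u x = Complex.exp a - Complex.exp (a * s) := by
    intro s
    have h : ∀ x ∈ uIcc s 1, HasDerivAt (fun x : ℝ => Complex.exp (a * x)) (u x) x := by
      intro x _
      have h1 : HasDerivAt (fun x : ℝ => a * (x : ℂ)) a x := by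
        simpa using (Complex.ofRealCLM.hasDerivAt (x := x)).const_mul a
      simpa [hu, mul_comm] using h1.cexp
    rw [intervalIntegral.integral_eq_sub_of_hasDerivAt h (huc.intervalIntegrable _ _)]
    simp
  have hF' : Integrable F (volume.restrict (Ioc 0 1)) := by
    rwa [intervalIntegrable_iff_integrableOn_Ioc_of_le zero_le_one] at hF
  have hu' : Integrable u (volume.restrict (Ioc 0 1)) :=
    (huc.integrableOn_Icc (a := 0) (b := 1)).mono_set Ioc_subset_Icc_self
  have hmeas : MeasurableSet {z : ℝ × ℝ | z.2 ≤ z.1} :=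
    measurableSet_le measurable_snd measurable_fst
  have hprod : Integrable (Function.uncurry fun x s : ℝ =>
      {z : ℝ × ℝ | z.2 ≤ z.1}.indicator (fun z => u z.1 * F z.2) (x, s))
      ((volume.restrict (Ioc 0 1)).prod (volume.restrict (Ioc (0:ℝ) 1))) := by
    have := (hu'.mul_prod hF').indicator hmeas
    exact this
  have hswap := integral_integral_swap hprod
  have hleft : ∀ x ∈ Ioc (0:ℝ) 1, (∫ s in Ioc (0:ℝ) 1,
      {z : ℝ × ℝ | z.2 ≤ z.1}.indicator (fun z => u z.1 * F z.2) (x, s)) =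
      (∫ s in (0:ℝ)..x, F s) * u x := by
    intro x hx
    have : (fun s => {z : ℝ × ℝ | z.2 ≤ z.1}.indicator (fun z => u z.1 * F z.2) (x, s)) =
        (Iic x).indicator fun s => u x * F s := by
      ext s; simp [indicator]
    rw [this, setIntegral_indicator measurableSet_Iic, Ioc_inter_Iic, min_eq_right hx.2,
      integral_const_mul, intervalIntegral.integral_of_le hx.1.le, mul_comm]
  have hright : ∀ s ∈ Ioc (0:ℝ) 1, (∫ x in Ioc (0:ℝ) 1,
      {z : ℝ × ℝ | z.2 ≤ z.1}.indicator (fun z => u z.1 * F z.2) (x, s)) =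
      Complex.exp a * F s - F s * Complex.exp (a * s) := by
    intro s hs
    have : (fun x => {z : ℝ × ℝ | z.2 ≤ z.1}.indicator (fun z => u z.1 * F z.2) (x, s)) =
        (Ici s).indicator fun x => u x * F s := by
      ext x; simp [indicator]
    have hset : Ioc (0:ℝ) 1 ∩ Ici s = Icc s 1 := by
      ext x; simp only [mem_inter_iff, mem_Ioc, mem_Ici, mem_Icc]
      constructor
      · rintro ⟨⟨_, h⟩, h'⟩; exact ⟨h', h⟩
      · rintro ⟨h, h'⟩; exact ⟨⟨hs.1.trans_le h, h'⟩, h⟩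
    rw [this, setIntegral_indicator measurableSet_Ici, hset, integral_Icc_eq_integral_Ioc,
      integral_mul_const, ← intervalIntegral.integral_of_le hs.2, hui]
    ring
  rw [setIntegral_congr_fun measurableSet_Ioc hleft,
    setIntegral_congr_fun measurableSet_Ioc hright] at hswap
  rw [intervalIntegral.integral_of_le zero_le_one, hswap, integral_sub, integral_const_mul,
    intervalIntegral.integral_of_le zero_le_one, intervalIntegral.integral_of_le zero_le_one]
  · exact hF'.const_mul _
  · have : IntervalIntegrable (fun s : ℝ => F s * Complex.exp (a * s)) volume 0 1 :=
      hF.mul_continuousOn (by fun_prop)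
    rwa [intervalIntegrable_iff_integrableOn_Ioc_of_le zero_le_one] at this

/-- An integrable function has a `t`-quasiperiodic primitive whenever `exp (i t) ≠ 1`, and its
quasi-Fourier coefficients are obtained by dividing by the frequency. -/
theorem exists_quasiperiodic_primitive {F : ℝ → ℂ} (hF : IntervalIntegrable F volume 0 1)
    {w : ℂ} (hw : w ≠ 1) :
    ∃ Y : ℝ → ℂ, ContinuousOn Y (Icc 0 1) ∧
      (∀ x, Y x = Y 0 + ∫ s in (0:ℝ)..x, F s) ∧ Y 1 = w * Y 0 ∧
      ∀ a : ℂ, Complex.exp a * w = 1 →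
        a * (∫ x in (0:ℝ)..1, Y x * Complex.exp (a * x)) =
          -∫ x in (0:ℝ)..1, F x * Complex.exp (a * x) := by
  set C : ℂ := (∫ s in (0:ℝ)..1, F s) / (w - 1) with hC
  have hw' : w - 1 ≠ 0 := sub_ne_zero.mpr hw
  have hCe : (∫ s in (0:ℝ)..1, F s) = C * (w - 1) := by rw [hC]; field_simp
  have hP : ContinuousOn (fun x : ℝ => ∫ s in (0:ℝ)..x, F s) (Icc 0 1) := by
    have := intervalIntegral.continuousOn_primitive_interval (a := 0) (b := 1) (f := F)
      (μ := volume) (by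
        rw [uIcc_of_le zero_le_one]
        exact (intervalIntegrable_iff_integrableOn_Icc_of_le zero_le_one).mp hF)
    rwa [uIcc_of_le zero_le_one] at this
  refine ⟨fun x => C + ∫ s in (0:ℝ)..x, F s, continuousOn_const.add hP, by simp, ?_, ?_⟩
  · simp only [intervalIntegral.integral_same, add_zero, hCe]; ring
  · intro a ha
    have h1 := integral_primitive_mul_exp hF a
    have h2 : ∫ x in (0:ℝ)..1, a * Complex.exp (a * x) = Complex.exp a - 1 := by
      have h : ∀ x ∈ uIcc (0:ℝ) 1, HasDerivAt (fun x : ℝ => Complex.exp (a * x))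
          (a * Complex.exp (a * x)) x := by
        intro x _
        have h1 : HasDerivAt (fun x : ℝ => a * (x : ℂ)) a x := by
          simpa using (Complex.ofRealCLM.hasDerivAt (x := x)).const_mul a
        simpa [mul_comm] using h1.cexp
      rw [intervalIntegral.integral_eq_sub_of_hasDerivAt h
        (Continuous.intervalIntegrable (by fun_prop) _ _)]
      simp
    rw [← intervalIntegral.integral_const_mul]
    have h3 : ∀ x : ℝ, a * ((C + ∫ s in (0:ℝ)..x, F s) * Complex.exp (a * x)) =
        C * (a * Complex.exp (a * x)) +
          (∫ s in (0:ℝ)..x, F s) * (a * Complex.exp (a * x)) := by intro x; ring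
    simp only [h3]
    rw [intervalIntegral.integral_add, intervalIntegral.integral_const_mul, h1, h2, hCe]
    · linear_combination C * ha
    · exact Continuous.intervalIntegrable (by fun_prop) _ _
    · apply ContinuousOn.intervalIntegrable
      rw [uIcc_of_le zero_le_one]
      exact hP.mul (by fun_prop)

/-- A continuous function on `[0,1]` with equal endpoint values and vanishing Fourier coefficients
is zero. -/
theorem eqOn_zero_of_fourierCoeff_eq_zero {f : ℝ → ℂ} (hf : ContinuousOn f (Icc 0 1))
    (h01 : f 0 = f 1)
    (hc : ∀ p : ℤ, ∫ x in (0:ℝ)..1, f x * Complex.exp (-(2 * Real.pi * Complex.I * p) * x) = 0) :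
    ∀ x ∈ Icc (0:ℝ) 1, f x = 0 := by
  have : Fact ((0:ℝ) < 1) := ⟨zero_lt_one⟩
  let g : C(AddCircle (1:ℝ), ℂ) :=
    ⟨AddCircle.liftIco 1 0 f, AddCircle.liftIco_zero_continuous h01 hf⟩
  have hg : ∀ p, fourierCoeff g p = 0 := by
    intro p
    change fourierCoeff (AddCircle.liftIco 1 0 f) p = 0
    rw [fourierCoeff_liftIco_eq, fourierCoeffOn_eq_integral]
    simp only [zero_add, sub_zero, fourier_coe_apply, smul_eq_mul]
    refine (congrArg ((1 / (1:ℝ)) • ·) (Eq.trans ?_ (hc p))).trans (smul_zero _)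
    apply intervalIntegral.integral_congr
    intro x _
    dsimp only
    rw [mul_comm]
    congr 2
    push_cast
    ring
  have hIco : ∀ x ∈ Ico (0:ℝ) 1, f x = 0 := by
    intro x hx
    have h1 := has_pointwise_sum_fourier_series_of_summable (f := g)
      (by rw [funext hg]; exact summable_zero) (x : AddCircle (1:ℝ))
    simp only [hg, zero_smul] at h1
    have h2 : g (x : AddCircle (1:ℝ)) = f x :=
      AddCircle.liftIco_coe_apply (by simpa using hx)
    rw [← h2]
    exact h1.unique hasSum_zero
  intro x hx
  rcases hx.2.lt_or_eq with h | h
  · exact hIco x ⟨hx.1, h⟩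
  · rw [h, ← h01]; exact hIco 0 ⟨le_rfl, zero_lt_one⟩

theorem psum_cons_succ {k : ℕ} (j : ℕ) (w : Fin k → ℕ) (s : ℕ) :
    psum (Fin.cons j w : Fin (k + 1) → ℕ) (s + 1) = j + psum w s := by
  simp [psum, Finset.sum_filter, Fin.sum_univ_succ]

theorem mem_gasymovTuples {k p : ℕ} {v : Fin k → ℕ} :
    v ∈ gasymovTuples k p ↔ (∀ i, 1 ≤ v i) ∧ ∀ s ∈ Finset.Icc 1 k, psum v s < p := by
  simp only [gasymovTuples, Finset.mem_filter, Fintype.mem_piFinset, Finset.mem_Icc]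
  constructor
  · rintro ⟨h1, h2⟩
    exact ⟨fun i => (h1 i).1, h2⟩
  · rintro ⟨h1, h2⟩
    refine ⟨fun i => ⟨h1 i, ?_⟩, h2⟩
    have h3 := h2 k ⟨i.pos, le_rfl⟩
    have h4 : v i ≤ psum v k :=
      Finset.single_le_sum (f := v) (fun _ _ => Nat.zero_le _) (by simp)
    omega

theorem cons_mem_gasymovTuples {k p j : ℕ} {w : Fin k → ℕ} :
    (Fin.cons j w : Fin (k + 1) → ℕ) ∈ gasymovTuples (k + 1) p ↔
      j ∈ Finset.Ico 1 p ∧ w ∈ gasymovTuples k (p - j) := by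
  simp only [mem_gasymovTuples, Finset.mem_Ico, Finset.mem_Icc, Fin.forall_fin_succ, Fin.cons_zero,
    Fin.cons_succ]
  constructor
  · rintro ⟨⟨h1, h2⟩, h3⟩
    have h4 := h3 1 (by omega)
    rw [psum_cons_succ] at h4
    refine ⟨⟨h1, by omega⟩, h2, fun s hs => ?_⟩
    have := h3 (s + 1) (by omega)
    rw [psum_cons_succ] at this
    omega
  · rintro ⟨⟨h1, h2⟩, h3, h4⟩
    refine ⟨⟨h1, h3⟩, fun s hs => ?_⟩
    obtain ⟨s, rfl⟩ : ∃ r, s = r + 1 := ⟨s - 1, by omega⟩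
    rw [psum_cons_succ]
    rcases Nat.eq_zero_or_pos s with rfl | hs'
    · simpa [psum] using h2
    · have := h4 s (by omega)
      omega

theorem sum_gasymovTuples_succ (k p : ℕ) (f : (Fin (k + 1) → ℕ) → ℂ) :
    ∑ v ∈ gasymovTuples (k + 1) p, f v =
      ∑ j ∈ Finset.Ico 1 p, ∑ w ∈ gasymovTuples k (p - j), f (Fin.cons j w) := by
  rw [Finset.sum_sigma']
  refine Finset.sum_bij' (fun v _ => ⟨v 0, Fin.tail v⟩) (fun x _ => Fin.cons x.1 x.2)
    (fun v hv => ?_) (fun x hx => ?_) (fun v _ => by simp) (fun x _ => by simp)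
    (fun v _ => by simp)
  · rw [Finset.mem_sigma]
    exact cons_mem_gasymovTuples.mp (by simpa using hv)
  · exact cons_mem_gasymovTuples.mpr (Finset.mem_sigma.mp hx)

/-- The contribution of the tuples of length `k` to `c_p / d_p`. -/
noncomputable def gasymovTerm (q : ℝ → ℂ) (n : ℤ) (t : ℝ) (k p : ℕ) : ℂ :=
  ∑ v ∈ gasymovTuples k p,
    ((∏ i, fourierCoeff01 q (v i)) * fourierCoeff01 q ((p : ℤ) - ∑ i, (v i : ℤ))) /
      ∏ s ∈ Finset.Icc 1 k,
        ((((2 * Real.pi * n + t : ℝ)) : ℂ)^2 -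
          (((2 * Real.pi * (n + (p : ℤ) - (psum v s : ℤ)) + t : ℝ)) : ℂ)^2)

theorem gasymovTerm_zero (q : ℝ → ℂ) (n : ℤ) (t : ℝ) (p : ℕ) :
    gasymovTerm q n t 0 p = fourierCoeff01 q p := by
  have : gasymovTuples 0 p = Finset.univ :=
    Finset.eq_univ_of_forall fun v => mem_gasymovTuples.mpr ⟨fun i => i.elim0, by simp⟩
  simp [gasymovTerm, this]

theorem gasymovTerm_succ (q : ℝ → ℂ) (n : ℤ) (t : ℝ) (k p : ℕ) :
    gasymovTerm q n t (k + 1) p =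
      ∑ j ∈ Finset.Ico 1 p, fourierCoeff01 q j *
        (dCoef n t ((p - j : ℕ) : ℤ) * gasymovTerm q n t k (p - j)) := by
  rw [gasymovTerm, sum_gasymovTuples_succ]
  refine Finset.sum_congr rfl fun j hj => ?_
  rw [gasymovTerm, Finset.mul_sum, Finset.mul_sum]
  refine Finset.sum_congr rfl fun w _ => ?_
  have hjp : j ≤ p := (Finset.mem_Ico.mp hj).2.le
  have h0 : psum (Fin.cons j w : Fin (k + 1) → ℕ) 1 = j := by
    rw [psum_cons_succ]; simp [psum]
  have hprod : ∀ f : ℕ → ℂ, ∏ s ∈ Finset.Icc 1 (k + 1), f s =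
      f 1 * ∏ s ∈ Finset.Icc 1 k, f (s + 1) := by
    intro f
    rw [← Finset.mul_prod_Ioc_eq_prod_Icc (by omega)]
    congr 1
    rw [← Finset.Ico_add_one_add_one_eq_Ioc, ← Finset.Ico_add_one_right_eq_Icc, Finset.prod_Ico_add']
  rw [hprod, h0]
  simp only [psum_cons_succ, Fin.prod_univ_succ, Fin.sum_univ_succ, Fin.cons_zero, Fin.cons_succ,
    dCoef]
  have e1 : ((p - j : ℕ) : ℤ) = (p : ℤ) - j := by omega
  have e2 : (p : ℤ) - (j + ∑ i, (w i : ℤ)) = (p : ℤ) - j - ∑ i, (w i : ℤ) := by ring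
  have e3 : ∀ s, (n : ℝ) + ((p : ℤ) : ℝ) - (((j + psum w s : ℕ) : ℤ) : ℝ) =
      n + (((p : ℤ) - j : ℤ) : ℝ) - ((psum w s : ℤ) : ℝ) := by intro s; push_cast; ring
  have e4 : (n : ℝ) + ((p : ℤ) : ℝ) - ((j : ℤ) : ℝ) = n + (((p : ℤ) - j : ℤ) : ℝ) := by
    push_cast; ring
  rw [e1, e2, e4]
  simp only [e3, div_eq_mul_inv, mul_inv]
  ring

theorem gasymovTerm_eq_zero (q : ℝ → ℂ) (n : ℤ) (t : ℝ) {k p : ℕ} (hp : 1 ≤ p) (hk : p ≤ k) :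
    gasymovTerm q n t k p = 0 := by
  induction k generalizing p with
  | zero => omega
  | succ k ih =>
    rw [gasymovTerm_succ]
    refine Finset.sum_eq_zero fun j hj => ?_
    rw [Finset.mem_Ico] at hj
    rw [ih (by omega) (by omega)]
    simp

theorem cCoef_eq_dCoef_mul_sum (q : ℝ → ℂ) (n : ℤ) (t : ℝ) {p N : ℕ} (hp : 1 ≤ p) (hN : p ≤ N) :
    cCoef q n t p = dCoef n t p * ∑ k ∈ Finset.range N, gasymovTerm q n t k p := by
  have h1 : ∑ k ∈ Finset.range N, gasymovTerm q n t k p =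
      ∑ k ∈ Finset.range p, gasymovTerm q n t k p := by
    symm
    apply Finset.sum_subset (Finset.range_mono hN)
    intro k _ hk
    exact gasymovTerm_eq_zero q n t hp (by simpa using hk)
  rw [h1, Finset.range_eq_Ico, Finset.sum_eq_sum_Ico_succ_bot hp, gasymovTerm_zero, cCoef]
  have : Finset.Icc 1 (p - 1) = Finset.Ico (0 + 1) p := by
    ext; simp only [Finset.mem_Icc, Finset.mem_Ico]; omega
  rw [this]
  rfl

theorem cCoef_recurrence (q : ℝ → ℂ) (n : ℤ) (t : ℝ) {p : ℕ} (hp : 1 ≤ p) :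
    cCoef q n t p = dCoef n t p * (fourierCoeff01 q p +
      ∑ j ∈ Finset.Ico 1 p, fourierCoeff01 q j * cCoef q n t (p - j)) := by
  obtain ⟨p, rfl⟩ : ∃ r, p = r + 1 := ⟨p - 1, by omega⟩
  rw [cCoef_eq_dCoef_mul_sum q n t hp le_rfl, Finset.sum_range_succ', gasymovTerm_zero, add_comm (Finset.sum _ _)]
  congr 2
  simp only [gasymovTerm_succ]
  rw [Finset.sum_comm]
  refine Finset.sum_congr rfl fun j hj => ?_
  rw [Finset.mem_Ico] at hj
  rw [← Finset.mul_sum, ← Finset.mul_sum,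
    cCoef_eq_dCoef_mul_sum q n t (p := p + 1 - j) (N := p) (by omega) (by omega)]

theorem cCoef_eq_dCoef_mul_convolution (q : ℝ → ℂ) (n : ℤ) (t : ℝ) {p : ℕ} (hp : 1 ≤ p) :
    cCoef q n t p = dCoef n t p * ∑ k ∈ Finset.range p,
      (if k = 0 then 1 else cCoef q n t k) * fourierCoeff01 q ((p : ℤ) - k) := by
  rw [cCoef_recurrence q n t hp, Finset.range_eq_Ico, Finset.sum_eq_sum_Ico_succ_bot hp]
  congr 2
  · simp
  · refine Finset.sum_nbij' (fun j => p - j) (fun j => p - j) ?_ ?_ ?_ ?_ ?_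
    · intro j hj; simp only [Finset.mem_Ico] at hj ⊢; omega
    · intro j hj; simp only [Finset.mem_Ico] at hj ⊢; omega
    · intro j hj; simp only [Finset.mem_Ico] at hj; omega
    · intro j hj; simp only [Finset.mem_Ico] at hj; omega
    · intro j hj
      simp only [Finset.mem_Ico] at hj
      rw [if_neg (by omega), mul_comm]
      congr 2
      omega

/-- A discrete Grönwall inequality giving summability. -/
theorem summable_of_le_mul_sum_range {a d : ℕ → ℝ} (ha : ∀ p, 0 ≤ a p) (hd0 : ∀ p, 0 ≤ d p)
    (hd : Summable d) (h : ∀ p, 1 ≤ p → a p ≤ d p * ∑ k ∈ Finset.range p, a k) :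
    Summable a := by
  have key : ∀ p, ∑ k ∈ Finset.range (p + 1), a k ≤
      a 0 * Real.exp (∑ k ∈ Finset.range (p + 1), d k) := by
    intro p
    induction p with
    | zero =>
      simpa using le_mul_of_one_le_right (ha 0) (Real.one_le_exp (hd0 0))
    | succ p ih =>
      rw [Finset.sum_range_succ, Finset.sum_range_succ d, Real.exp_add, ← mul_assoc]
      have h1 := h (p + 1) (by omega)
      have h2 := Real.add_one_le_exp (d (p + 1))
      have h3 : 0 ≤ ∑ k ∈ Finset.range (p + 1), a k := Finset.sum_nonneg fun k _ => ha k
      calc _ ≤ (∑ k ∈ Finset.range (p + 1), a k) * (d (p + 1) + 1) := by linarith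
        _ ≤ _ := mul_le_mul ih h2 (by linarith [hd0 (p + 1)]) (h3.trans ih)
  refine summable_of_sum_range_le (c := a 0 * Real.exp (∑' k, d k)) ha fun p => ?_
  calc _ ≤ ∑ k ∈ Finset.range (p + 1), a k :=
        Finset.sum_le_sum_of_subset_of_nonneg (Finset.range_mono (by omega)) fun k _ _ => ha k
    _ ≤ _ := key p
    _ ≤ _ := by
      gcongr
      · exact ha 0
      · exact hd.sum_le_tsum _ fun k _ => hd0 k

theorem summable_norm_dCoef (n : ℤ) (t : ℝ) : Summable fun p : ℕ => ‖dCoef n t p‖ := by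
  refine Summable.of_norm_bounded_eventually_nat (g := fun p : ℕ => 1 / (p : ℝ) ^ 2)
    (Real.summable_one_div_nat_pow.mpr one_lt_two) ?_
  filter_upwards [Filter.eventually_ge_atTop (⌈|2 * Real.pi * n + t|⌉₊ + 1)] with p hp
  have hp0 : (1:ℝ) ≤ p := by exact_mod_cast (by omega : 1 ≤ p)
  have hpa : |2 * Real.pi * n + t| ≤ p :=
    (Nat.le_ceil _).trans (by exact_mod_cast (by omega : ⌈|2 * Real.pi * n + t|⌉₊ ≤ p))
  have hd : dCoef n t p =
      (((-(4 * Real.pi * p * (2 * Real.pi * n + t + Real.pi * p)) : ℝ) : ℂ))⁻¹ := by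
    rw [dCoef]
    congr 1
    push_cast
    ring
  rw [norm_norm, hd, norm_inv, Complex.norm_real, Real.norm_eq_abs, abs_neg, one_div]
  have h1 := abs_le.mp hpa
  have hpi := Real.pi_gt_three
  have h2 : (p : ℝ) ≤ 2 * Real.pi * n + t + Real.pi * p := by nlinarith
  gcongr
  refine le_trans ?_ (le_abs_self _)
  have h3 : (p : ℝ) ≤ 4 * Real.pi * p := by nlinarith
  nlinarith

theorem norm_exp_I_mul_ofReal_mul (r x : ℝ) : ‖Complex.exp (Complex.I * (r : ℂ) * (x : ℂ))‖ = 1 := by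
  rw [show Complex.I * (r : ℂ) * (x : ℂ) = ((r * x : ℝ) : ℂ) * Complex.I by push_cast; ring,
    Complex.norm_exp_ofReal_mul_I]

theorem norm_fourierCoeff01_le (q : ℝ → ℂ) (m : ℤ) :
    ‖fourierCoeff01 q m‖ ≤ ∫ x in (0:ℝ)..1, ‖q x‖ := by
  refine (intervalIntegral.norm_integral_le_integral_norm zero_le_one).trans (le_of_eq ?_)
  refine intervalIntegral.integral_congr fun x _ => ?_
  have := norm_exp_I_mul_ofReal_mul (-(2 * Real.pi * m)) x
  rw [norm_mul, show -(2 * Real.pi * Complex.I * m) * (x : ℂ) =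
    Complex.I * ((-(2 * Real.pi * m) : ℝ) : ℂ) * x by push_cast; ring, this, mul_one]

theorem fourierCoeff01_one (m : ℤ) : fourierCoeff01 (fun _ => 1) m = if m = 0 then 1 else 0 := by
  rw [fourierCoeff01]
  split_ifs with h
  · simp [h]
  · have hne : -(2 * Real.pi * Complex.I * m) ≠ 0 := by
      simp [h, Real.pi_ne_zero, Complex.I_ne_zero]
    simp only [one_mul]
    rw [integral_exp_mul_complex hne]
    have : Complex.exp (-(2 * Real.pi * Complex.I * m) * (1 : ℝ)) = 1 :=
      Complex.exp_eq_one_iff.mpr ⟨-m, by push_cast; ring⟩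
    rw [this]
    simp

/-- The summable series `∑ c_k exp (i (2π(n+k)+t) x)`. -/
noncomputable def quasiFourierSeries (c : ℕ → ℂ) (n : ℤ) (t : ℝ) (x : ℝ) : ℂ :=
  ∑' k : ℕ, c k * Complex.exp (Complex.I * ((2 * Real.pi * (n + (k : ℤ)) + t : ℝ) : ℂ) * x)

theorem norm_quasiFourierSeries_term (c : ℕ → ℂ) (n : ℤ) (t : ℝ) (k : ℕ) (x : ℝ) :
    ‖c k * Complex.exp (Complex.I * ((2 * Real.pi * (n + (k : ℤ)) + t : ℝ) : ℂ) * x)‖ = ‖c k‖ := by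
  rw [norm_mul, norm_exp_I_mul_ofReal_mul, mul_one]

theorem continuous_quasiFourierSeries {c : ℕ → ℂ} (hc : Summable fun k => ‖c k‖) (n : ℤ) (t : ℝ) :
    Continuous (quasiFourierSeries c n t) :=
  continuous_tsum (fun k => by fun_prop) hc fun k x =>
    (norm_quasiFourierSeries_term c n t k x).le

theorem quasiFourierSeries_one (c : ℕ → ℂ) (n : ℤ) (t : ℝ) :
    quasiFourierSeries c n t 1 = Complex.exp (Complex.I * t) * quasiFourierSeries c n t 0 := by
  rw [quasiFourierSeries, quasiFourierSeries, ← tsum_mul_left]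
  refine tsum_congr fun k => ?_
  have : Complex.exp (Complex.I * ((2 * Real.pi * (n + (k : ℤ)) + t : ℝ) : ℂ) * (1 : ℝ)) =
      Complex.exp (Complex.I * t) := by
    rw [Complex.exp_eq_exp_iff_exists_int]
    exact ⟨n + k, by push_cast; ring⟩
  rw [this]
  simp [mul_comm]

theorem hasSum_quasiFourier_mul {c : ℕ → ℂ} (hc : Summable fun k => ‖c k‖) (n : ℤ) (t : ℝ)
    {r : ℝ → ℂ} (hr : IntervalIntegrable r volume 0 1) (p : ℤ) :
    HasSum (fun k : ℕ => c k * fourierCoeff01 r (p - k))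
      (∫ x in (0:ℝ)..1, r x * quasiFourierSeries c n t x *
        Complex.exp (-(Complex.I * ((2 * Real.pi * (n + p) + t : ℝ) : ℂ)) * x)) := by
  have hterm : ∀ (k : ℕ) (x : ℝ),
      c k * (r x * Complex.exp (-(2 * Real.pi * Complex.I * ((p - k : ℤ) : ℂ)) * (x : ℂ))) =
      r x * (c k * Complex.exp (Complex.I * ((2 * Real.pi * (n + (k : ℤ)) + t : ℝ) : ℂ) * x)) *
        Complex.exp (-(Complex.I * ((2 * Real.pi * (n + p) + t : ℝ) : ℂ)) * x) := by
    intro k x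
    have : Complex.exp (-(2 * Real.pi * Complex.I * ((p - k : ℤ) : ℂ)) * (x : ℂ)) =
        Complex.exp (Complex.I * ((2 * Real.pi * (n + (k : ℤ)) + t : ℝ) : ℂ) * x) *
        Complex.exp (-(Complex.I * ((2 * Real.pi * (n + p) + t : ℝ) : ℂ)) * x) := by
      rw [← Complex.exp_add]
      congr 1
      push_cast
      ring
    rw [this]
    ring
  have hnorm : ∀ x : ℝ,
      ‖Complex.exp (-(Complex.I * ((2 * Real.pi * (n + p) + t : ℝ) : ℂ)) * x)‖ = 1 := by
    intro x
    rw [← mul_neg, ← Complex.ofReal_neg, norm_exp_I_mul_ofReal_mul]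
  simp only [fourierCoeff01, ← intervalIntegral.integral_const_mul, hterm]
  refine intervalIntegral.hasSum_integral_of_dominated_convergence (fun k x => ‖c k‖ * ‖r x‖)
    (fun k => ?_) (fun k => ?_) ?_ ?_ ?_
  · refine AEStronglyMeasurable.mul (AEStronglyMeasurable.mul ?_ ?_) ?_
    · exact (intervalIntegrable_iff.mp hr).aestronglyMeasurable
    · exact Continuous.aestronglyMeasurable (by fun_prop)
    · exact Continuous.aestronglyMeasurable (by fun_prop)
  · refine Filter.Eventually.of_forall fun x _ => le_of_eq ?_
    rw [norm_mul, norm_mul, norm_quasiFourierSeries_term, hnorm, mul_one, mul_comm]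
  · exact Filter.Eventually.of_forall fun x _ => hc.mul_right _
  · simp only [tsum_mul_right]
    exact hr.norm.const_mul _
  · refine Filter.Eventually.of_forall fun x _ => ?_
    refine ((Summable.hasSum ?_).mul_left _).mul_right _
    exact Summable.of_norm (by simpa only [norm_quasiFourierSeries_term] using hc)

theorem ne_int_mul_pi {t : ℝ} (ht : t ∈ Set.Ioc (-Real.pi) Real.pi) (ht0 : t ≠ 0)
    (htpi : t ≠ Real.pi) (m : ℤ) : t ≠ m * Real.pi := by
  rintro h
  have hpi := Real.pi_pos
  have h1 : (m : ℝ) < 1 := by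
    have := lt_of_le_of_ne ht.2 htpi
    rw [h] at this
    nlinarith
  have h2 : (-1 : ℝ) < m := by
    have := ht.1
    rw [h] at this
    nlinarith
  have h3 : m < 1 := by exact_mod_cast h1
  have h4 : -1 < m := by exact_mod_cast h2
  have h5 : m = 0 := by omega
  exact ht0 (by simp [h, h5])

theorem dCoef_inv_ne_zero {t : ℝ} (hm : ∀ m : ℤ, t ≠ m * Real.pi) (n : ℤ) {p : ℤ} (hp : p ≠ 0) :
    (((2 * Real.pi * n + t : ℝ)) : ℂ) ^ 2 - (((2 * Real.pi * (n + p) + t : ℝ)) : ℂ) ^ 2 ≠ 0 := by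
  have h : (((2 * Real.pi * n + t : ℝ)) : ℂ) ^ 2 - (((2 * Real.pi * (n + p) + t : ℝ)) : ℂ) ^ 2 =
      ((-(4 * Real.pi * p * (t - (-(2 * n + p) : ℤ) * Real.pi)) : ℝ) : ℂ) := by
    push_cast
    ring
  rw [h, Complex.ofReal_ne_zero]
  have h1 : (p : ℝ) ≠ 0 := by exact_mod_cast hp
  have h2 := sub_ne_zero.mpr (hm (-(2 * n + p)))
  exact neg_ne_zero.mpr (mul_ne_zero (mul_ne_zero (mul_ne_zero four_ne_zero Real.pi_ne_zero) h1) h2)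

/-- Two continuous `t`-quasiperiodic functions with the same quasi-Fourier coefficients agree. -/
theorem eqOn_of_quasiFourierCoeff_eq {f g : ℝ → ℂ} {t : ℝ} (hf : ContinuousOn f (Icc 0 1))
    (hg : ContinuousOn g (Icc 0 1)) (hf1 : f 1 = Complex.exp (Complex.I * t) * f 0)
    (hg1 : g 1 = Complex.exp (Complex.I * t) * g 0) (n : ℤ)
    (h : ∀ p : ℤ,
      ∫ x in (0:ℝ)..1, f x *
        Complex.exp (-(Complex.I * ((2 * Real.pi * (n + p) + t : ℝ) : ℂ)) * x) =
      ∫ x in (0:ℝ)..1, g x *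
        Complex.exp (-(Complex.I * ((2 * Real.pi * (n + p) + t : ℝ) : ℂ)) * x)) :
    ∀ x ∈ Icc (0:ℝ) 1, f x = g x := by
  have hexp : Complex.exp (-(Complex.I * t)) * Complex.exp (Complex.I * t) = 1 := by
    rw [← Complex.exp_add]; simp
  have key := eqOn_zero_of_fourierCoeff_eq_zero
    (f := fun x => (f x - g x) * Complex.exp (-(Complex.I * t) * x))
    ((hf.sub hg).mul (by fun_prop)) (by
      simp only [hf1, hg1, Complex.ofReal_zero, mul_zero, Complex.exp_zero, Complex.ofReal_one,
        mul_one]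
      linear_combination -(f 0 - g 0) * hexp) (by
      intro p
      have hp := h (p - n)
      rw [← sub_eq_zero, ← intervalIntegral.integral_sub] at hp
      · rw [← hp]
        refine intervalIntegral.integral_congr fun x _ => ?_
        rw [mul_assoc, ← Complex.exp_add, ← sub_mul]
        congr 2
        push_cast
        ring
      · exact ContinuousOn.intervalIntegrable (by
          rw [uIcc_of_le zero_le_one]; exact hf.mul (by fun_prop))
      · exact ContinuousOn.intervalIntegrable (by
          rw [uIcc_of_le zero_le_one]; exact hg.mul (by fun_prop)))
  intro x hx
  exact sub_eq_zero.mp ((mul_eq_zero.mp (key x hx)).resolve_right (Complex.exp_ne_zero _))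

/-- If the quasi-Fourier coefficients of a continuous `t`-quasiperiodic function formally satisfy
the eigenvalue equation, then the function is an eigenfunction. -/
theorem isEigenfunL_of_quasiFourierCoeff {q Ψ : ℝ → ℂ} {t : ℝ} {lam : ℂ}
    (hq : IntervalIntegrable q volume 0 1) (hΨ : Continuous Ψ)
    (hΨ1 : Ψ 1 = Complex.exp (Complex.I * t) * Ψ 0) (hw : Complex.exp (Complex.I * t) ≠ 1)
    (hne : ¬ ∀ x ∈ Set.Icc (0:ℝ) 1, Ψ x = 0) (n : ℤ)
    (h : ∀ p : ℤ,
      ∫ x in (0:ℝ)..1, (q x - lam) * Ψ x *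
        Complex.exp (-(Complex.I * ((2 * Real.pi * (n + p) + t : ℝ) : ℂ)) * x) =
      -((2 * Real.pi * (n + p) + t : ℝ) : ℂ) ^ 2 * ∫ x in (0:ℝ)..1, Ψ x *
        Complex.exp (-(Complex.I * ((2 * Real.pi * (n + p) + t : ℝ) : ℂ)) * x)) :
    IsEigenfunL q t lam Ψ := by
  have hF : IntervalIntegrable (fun x => (q x - lam) * Ψ x) volume 0 1 :=
    (hq.sub intervalIntegrable_const).mul_continuousOn hΨ.continuousOn
  obtain ⟨g, hgc, hg, hg1, hgF⟩ := exists_quasiperiodic_primitive hF hw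
  obtain ⟨y, hyc, hy, hy1, hyF⟩ := exists_quasiperiodic_primitive
    (ContinuousOn.intervalIntegrable (by rwa [uIcc_of_le zero_le_one])) hw
  have hyΨ : ∀ x ∈ Icc (0:ℝ) 1, y x = Ψ x := by
    refine eqOn_of_quasiFourierCoeff_eq hyc hΨ.continuousOn hy1 hΨ1 n fun p => ?_
    set a : ℂ := -(Complex.I * ((2 * Real.pi * (n + p) + t : ℝ) : ℂ)) with ha
    have ha1 : Complex.exp a * Complex.exp (Complex.I * t) = 1 := by
      rw [← Complex.exp_add]
      exact Complex.exp_eq_one_iff.mpr ⟨-(n + p), by rw [ha]; push_cast; ring⟩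
    have ha0 : a ≠ 0 := by
      intro h0
      rw [h0, Complex.exp_zero, one_mul] at ha1
      exact hw ha1
    have h1 := hgF a ha1
    have h2 := hyF a ha1
    have h3 := h p
    rw [← ha] at h3
    have ha2 : a ^ 2 = -((2 * Real.pi * (n + p) + t : ℝ) : ℂ) ^ 2 := by
      rw [ha, neg_sq, mul_pow, Complex.I_sq]; ring
    rw [← ha2] at h3
    refine mul_left_cancel₀ (pow_ne_zero 2 ha0) ?_
    linear_combination a * h2 - h1 + h3
  refine ⟨g, hΨ.continuousOn, hgc, fun x hx => ?_, fun x _ => hg x, hne, hΨ1, hg1⟩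
  rw [← hyΨ x hx, ← hyΨ 0 (by simp)]
  exact hy x

theorem gasymov_eigenfunction_expansion (q : ℝ → ℂ)
    (hper : ∀ x : ℝ, q (x + 1) = q x)
    (hint : IntegrableOn q (Set.Icc (0:ℝ) 1))
    (hfour : ∀ m : ℤ, m ≤ 0 → fourierCoeff01 q m = 0)
    (t : ℝ) (ht : t ∈ Set.Ioc (-Real.pi) Real.pi) (ht0 : t ≠ 0) (htpi : t ≠ Real.pi)
    (n : ℤ) :
    ∃ Ψ : ℝ → ℂ, IsEigenfunL q t ((((2 * Real.pi * n + t : ℝ) : ℂ))^2) Ψ ∧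
      (∫ x in (0:ℝ)..1,
          Ψ x * Complex.exp (-(Complex.I * ((2 * Real.pi * n + t : ℝ) : ℂ)) * (x : ℂ))) = 1 ∧
      (∀ p : ℕ, 1 ≤ p →
        (∫ x in (0:ℝ)..1,
          Ψ x * Complex.exp
            (-(Complex.I * ((2 * Real.pi * (n + (p : ℤ)) + t : ℝ) : ℂ)) * (x : ℂ))) =
          cCoef q n t p) ∧
      (∀ p : ℤ, p ≤ -1 →
        (∫ x in (0:ℝ)..1,
          Ψ x * Complex.exp
            (-(Complex.I * ((2 * Real.pi * (n + p) + t : ℝ) : ℂ)) * (x : ℂ))) = 0) := by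
  have hm := ne_int_mul_pi ht ht0 htpi
  have hq : IntervalIntegrable q volume 0 1 :=
    (intervalIntegrable_iff_integrableOn_Icc_of_le zero_le_one).mpr hint
  have hw : Complex.exp (Complex.I * t) ≠ 1 := by
    rw [Ne, Complex.exp_eq_one_iff]
    rintro ⟨k, hk⟩
    refine hm (2 * k) ?_
    have : (t : ℂ) = ((((2 * k : ℤ) : ℝ) * Real.pi : ℝ) : ℂ) := by
      push_cast
      linear_combination -Complex.I * hk + (t - 2 * k * Real.pi) * Complex.I_sq
    exact_mod_cast this
  set c : ℕ → ℂ := fun k => if k = 0 then 1 else cCoef q n t k with hc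
  have hrec : ∀ p : ℕ, 1 ≤ p → c p = dCoef n t p *
      ∑ k ∈ Finset.range p, c k * fourierCoeff01 q ((p : ℤ) - k) := by
    intro p hp
    rw [← cCoef_eq_dCoef_mul_convolution q n t hp]
    exact if_neg (by omega)
  set M : ℝ := ∫ x in (0:ℝ)..1, ‖q x‖ with hM
  have hM0 : 0 ≤ M := (norm_nonneg _).trans (norm_fourierCoeff01_le q 0)
  have hcs : Summable fun k => ‖c k‖ := by
    refine summable_of_le_mul_sum_range (d := fun p => ‖dCoef n t p‖ * M)
      (fun _ => norm_nonneg _) (fun _ => mul_nonneg (norm_nonneg _) hM0)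
      ((summable_norm_dCoef n t).mul_right M) fun p hp => ?_
    rw [hrec p hp, norm_mul, mul_assoc, Finset.mul_sum]
    gcongr
    refine (norm_sum_le _ _).trans (Finset.sum_le_sum fun k _ => ?_)
    rw [norm_mul, mul_comm M]
    gcongr
    exact norm_fourierCoeff01_le q _
  set Ψ := quasiFourierSeries c n t with hΨ
  have hΨc : Continuous Ψ := continuous_quasiFourierSeries hcs n t
  have hcoef : ∀ p : ℤ, HasSum (fun k : ℕ => c k * if p - k = 0 then 1 else 0)
      (∫ x in (0:ℝ)..1, Ψ x *
        Complex.exp (-(Complex.I * ((2 * Real.pi * (n + p) + t : ℝ) : ℂ)) * x)) := by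
    intro p
    have := hasSum_quasiFourier_mul hcs n t (r := fun _ => 1) intervalIntegrable_const p
    simpa only [fourierCoeff01_one, one_mul] using this
  have hcoef_nat : ∀ p : ℕ, (∫ x in (0:ℝ)..1, Ψ x *
      Complex.exp (-(Complex.I * ((2 * Real.pi * (n + (p : ℤ)) + t : ℝ) : ℂ)) * x)) = c p := by
    intro p
    refine (hcoef p).unique ?_
    have := hasSum_single (f := fun k : ℕ => c k * if (p : ℤ) - k = 0 then 1 else 0) p
      (fun k hk => by rw [if_neg (by omega), mul_zero])
    simpa using this
  have hcoef_neg : ∀ p : ℤ, p ≤ -1 → (∫ x in (0:ℝ)..1, Ψ x *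
      Complex.exp (-(Complex.I * ((2 * Real.pi * (n + p) + t : ℝ) : ℂ)) * x)) = 0 := by
    intro p hp
    refine (hcoef p).unique ?_
    convert! hasSum_zero using 2 with k
    rw [if_neg (by omega), mul_zero]
  have hone : (∫ x in (0:ℝ)..1,
      Ψ x * Complex.exp (-(Complex.I * ((2 * Real.pi * n + t : ℝ) : ℂ)) * (x : ℂ))) = 1 := by
    simpa [hc] using hcoef_nat 0
  refine ⟨Ψ, ?_, hone, fun p hp => ?_, hcoef_neg⟩
  · refine isEigenfunL_of_quasiFourierCoeff hq hΨc (quasiFourierSeries_one c n t) hw ?_ n ?_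
    · intro h0
      rw [intervalIntegral.integral_congr (g := fun _ => 0) fun x hx => ?_] at hone
      · simp at hone
      · rw [uIcc_of_le zero_le_one] at hx
        simp [h0 x hx]
    · intro p
      have hsplit : ∀ x : ℝ, (q x - (((2 * Real.pi * n + t : ℝ) : ℂ)) ^ 2) * Ψ x *
          Complex.exp (-(Complex.I * ((2 * Real.pi * (n + p) + t : ℝ) : ℂ)) * x) =
          q x * Ψ x * Complex.exp (-(Complex.I * ((2 * Real.pi * (n + p) + t : ℝ) : ℂ)) * x) -
          (((2 * Real.pi * n + t : ℝ) : ℂ)) ^ 2 * (Ψ x *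
            Complex.exp (-(Complex.I * ((2 * Real.pi * (n + p) + t : ℝ) : ℂ)) * x)) := by
        intro x; ring
      simp only [hsplit]
      rw [intervalIntegral.integral_sub, intervalIntegral.integral_const_mul]
      rotate_left
      · exact (hq.mul_continuousOn hΨc.continuousOn).mul_continuousOn (by fun_prop)
      · exact Continuous.intervalIntegrable (by fun_prop) _ _
      have hconv := hasSum_quasiFourier_mul hcs n t hq p
      rcases lt_trichotomy p 0 with hp | rfl | hp
      · rw [hcoef_neg p (by omega), hconv.unique (by
          convert! hasSum_zero using 2 with k
          rw [hfour _ (by omega), mul_zero])]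
        simp
      · rw [hconv.unique (by
          convert! hasSum_zero using 2 with k
          rw [hfour _ (by omega), mul_zero])]
        simp
      · obtain ⟨p, rfl⟩ := Int.eq_ofNat_of_zero_le hp.le
        have hp' : 1 ≤ p := by omega
        have hs := hasSum_sum_of_ne_finset_zero (L := .unconditional ℕ)
          (f := fun k : ℕ => c k * fourierCoeff01 q ((p : ℤ) - k)) (s := Finset.range p)
          (fun k hk => by
            rw [Finset.mem_range] at hk
            rw [hfour _ (by omega), mul_zero])
        rw [hconv.unique hs, hcoef_nat]
        have hd := dCoef_inv_ne_zero hm n hp.ne'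
        have hr := hrec p hp'
        rw [dCoef, eq_inv_mul_iff_mul_eq₀ hd] at hr
        rw [← hr]
        ring
  · rw [hcoef_nat p]
    exact if_neg (by omega)
end

section
/- Let q : ℝ → ℂ be 1-periodic and integrable on [0,1] with Fourier coefficients q_m = 0 for all integers m ≤ 0, let t ∈ (−π, π] with t ≠ 0 and t ≠ π, and let n be an integer. If Ψ is any eigenfunction of L_t(q) corresponding to the eigenvalue (2πn + t)², then ∫₀¹ Ψ(x)·exp(−i(2πn + t)x) dx ≠ 0, and ∫₀¹ Ψ(x)·exp(−i(2π(n + p) + t)x) dx = 0 for every integer p < 0. -/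
open Real Complex Set MeasureTheory

/-- Exchanging the order of integration over the triangle `0 < s ≤ x ≤ 1`. -/
lemma integral_primitive_mul_eq {U w : ℝ → ℂ} (hU : IntegrableOn U (Ioc 0 1))
    (hw : IntegrableOn w (Ioc 0 1)) :
    ∫ x in (0:ℝ)..1, (∫ s in (0:ℝ)..x, U s) * w x =
      ∫ s in (0:ℝ)..1, U s * ∫ x in s..1, w x := by
  have hint : Integrable (Function.uncurry fun x s : ℝ => (Iic x).indicator U s * w x)
      ((volume.restrict (Ioc 0 1)).prod (volume.restrict (Ioc 0 1))) := by
    have h := (hw.mul_prod hU).indicator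
      (measurableSet_le measurable_snd measurable_fst : MeasurableSet {p : ℝ × ℝ | p.2 ≤ p.1})
    refine h.congr (ae_of_all _ fun p => ?_)
    simp only [Function.uncurry, indicator, mem_ofPred_eq, mem_Iic]
    split_ifs <;> ring
  have hswap := integral_integral_swap hint
  rw [intervalIntegral.integral_of_le zero_le_one, intervalIntegral.integral_of_le zero_le_one]
  convert hswap using 1
  · refine setIntegral_congr_fun measurableSet_Ioc fun x hx => ?_
    have hset : Ioc (0:ℝ) 1 ∩ Iic x = Ioc 0 x := by
      ext s; simp only [mem_inter_iff, mem_Ioc, mem_Iic]; grind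
    rw [integral_mul_const, setIntegral_indicator measurableSet_Iic, hset,
      intervalIntegral.integral_of_le hx.1.le]
  · refine setIntegral_congr_fun measurableSet_Ioc fun s hs => ?_
    have hset : Ioc (0:ℝ) 1 ∩ Ici s = Icc s 1 := by
      ext x; simp only [mem_inter_iff, mem_Ioc, mem_Ici, mem_Icc]; grind
    have hfun : ∀ x, (Iic x).indicator U s * w x = U s * (Ici s).indicator w x := by
      intro x; simp only [indicator, mem_Iic, mem_Ici]; split_ifs <;> simp
    simp only [hfun]
    rw [integral_const_mul, setIntegral_indicator measurableSet_Ici, hset,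
      intervalIntegral.integral_of_le hs.2, integral_Icc_eq_integral_Ioc]

lemma hasDerivAt_cexp_const_mul_ofReal (α : ℂ) (x : ℝ) :
    HasDerivAt (fun x : ℝ => cexp (α * x)) (α * cexp (α * x)) x := by
  have h := ((Complex.ofRealCLM.hasDerivAt (x := x)).const_mul α).cexp
  simpa [mul_comm] using h

/-- Integration by parts of an absolutely continuous function against an exponential, when the
boundary terms cancel. -/
lemma mul_integral_mul_cexp_eq_neg {u U : ℝ → ℂ} {α : ℂ} (hU : IntegrableOn U (Ioc 0 1))
    (hu : ∀ x ∈ Icc (0:ℝ) 1, u x = u 0 + ∫ s in (0:ℝ)..x, U s)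
    (hbd : u 1 * cexp α = u 0) :
    α * ∫ x in (0:ℝ)..1, u x * cexp (α * x) = -∫ x in (0:ℝ)..1, U x * cexp (α * x) := by
  have hcont : Continuous fun x : ℝ => cexp (α * x) := by fun_prop
  have hprim : ∀ s : ℝ, ∫ x in s..1, α * cexp (α * x) = cexp α - cexp (α * s) := by
    intro s
    rw [intervalIntegral.integral_eq_sub_of_hasDerivAt
      (fun x _ => hasDerivAt_cexp_const_mul_ofReal α x)
      ((continuous_const.mul hcont).intervalIntegrable _ _)]
    simp
  have hU' : IntervalIntegrable U volume 0 1 :=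
    (intervalIntegrable_iff_integrableOn_Ioc_of_le zero_le_one).2 hU
  have hswap := integral_primitive_mul_eq (w := fun x : ℝ => α * cexp (α * x)) hU
    (continuous_const.mul hcont).integrableOn_Ioc
  simp only [hprim, mul_sub] at hswap
  rw [intervalIntegral.integral_sub (hU'.mul_const _) (hU'.mul_continuousOn hcont.continuousOn),
    intervalIntegral.integral_mul_const] at hswap
  have hprimcont : ContinuousOn (fun x => ∫ s in (0:ℝ)..x, U s) (uIcc 0 1) :=
    intervalIntegral.continuousOn_primitive_interval (by
      rw [uIcc_of_le zero_le_one]; exact (integrableOn_Icc_iff_integrableOn_Ioc (by simp)).2 hU)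
  have hsplit : α * ∫ x in (0:ℝ)..1, u x * cexp (α * x) =
      (∫ x in (0:ℝ)..1, u 0 * (α * cexp (α * x))) +
        ∫ x in (0:ℝ)..1, (∫ s in (0:ℝ)..x, U s) * (α * cexp (α * x)) := by
    rw [← intervalIntegral.integral_const_mul, ← intervalIntegral.integral_add]
    · refine intervalIntegral.integral_congr fun x hx => ?_
      rw [uIcc_of_le zero_le_one] at hx
      rw [hu x hx]; ring
    · exact (continuous_const.mul (continuous_const.mul hcont)).intervalIntegrable _ _
    · exact (hprimcont.mul (continuous_const.mul hcont).continuousOn).intervalIntegrable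
  rw [hsplit, hswap, intervalIntegral.integral_const_mul, hprim]
  have h1 := hu 1 (by simp)
  simp only [ofReal_zero, mul_zero, Complex.exp_zero]
  linear_combination hbd - cexp α * h1

/-- A summable solution of a lower triangular convolution recursion with summable reciprocal
diagonal entries vanishes to the left of the first index at which the diagonal may vanish. -/
lemma eq_zero_of_triangular_recursion {c d Q : ℤ → ℂ} {B : ℝ}
    (hc : Summable fun k => ‖c k‖) (hd : Summable fun k => ‖d k‖⁻¹)
    (hQ : ∀ m ≤ 0, Q m = 0) (hB : ∀ m, ‖Q m‖ ≤ B)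
    (hrec : ∀ k, HasSum (fun m => c m * Q (k - m)) (d k * c k)) {N : ℤ}
    (hN : ∀ k < N, d k ≠ 0 ∨ c k = 0) {k : ℤ} (hk : k < N) : c k = 0 := by
  have hB0 : 0 ≤ B := (norm_nonneg _).trans (hB 0)
  have hstep : ∀ k < N, (∀ m < k, c m = 0) → c k = 0 := by
    intro k hk hm
    refine (hN k hk).elim (fun hdk => ?_) id
    have h0 : ∀ m, c m * Q (k - m) = 0 := fun m => by
      rcases lt_or_ge m k with h | h
      · simp [hm m h]
      · simp [hQ (k - m) (by lia)]
    have := hrec k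
    simp only [h0] at this
    exact (mul_eq_zero.1 (this.unique hasSum_zero)).resolve_left hdk
  -- the tails of the reciprocal diagonal are eventually small
  obtain ⟨K, hKN, hK⟩ : ∃ K ≤ N, B * ∑' k, (Iio K).indicator (fun k => ‖d k‖⁻¹) k < 1 := by
    have hlim : Filter.Tendsto (fun K : ℤ => ∑' k, (Iio K).indicator (fun k => ‖d k‖⁻¹) k)
        Filter.atBot (nhds (∑' _ : ℤ, (0:ℝ))) := by
      refine tendsto_tsum_of_dominated_convergence hd (fun k => ?_) (.of_forall fun K k => ?_)
      · refine tendsto_const_nhds.congr' ?_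
        filter_upwards [Filter.eventually_le_atBot k] with K hK
        simp [indicator, hK]
      · rw [Real.norm_of_nonneg (indicator_nonneg (fun _ _ => by positivity) _)]
        exact indicator_le_self' (fun _ _ => by positivity) _
    have hlim' := hlim.const_mul B
    simp only [tsum_zero, mul_zero] at hlim'
    obtain ⟨K, h1, h2⟩ := ((hlim'.eventually_lt_const zero_lt_one).and
      (Filter.eventually_le_atBot N)).exists
    exact ⟨K, h2, h1⟩
  set S := ∑' m, (Iio K).indicator (fun m => ‖c m‖) m with hS
  have hsS : Summable ((Iio K).indicator fun m => ‖c m‖) := hc.indicator _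
  have hS0 : 0 ≤ S := tsum_nonneg fun m => indicator_nonneg (fun _ _ => norm_nonneg _) _
  have hbound : ∀ k < K, ‖c k‖ ≤ ‖d k‖⁻¹ * (B * S) := by
    intro k hk
    rcases hN k (hk.trans_le hKN) with hdk | hck
    · rw [le_inv_mul_iff₀ (norm_pos_iff.2 hdk), ← norm_mul, ← (hrec k).tsum_eq, hS, ← tsum_mul_left]
      refine tsum_of_norm_bounded (hsS.mul_left B).hasSum fun m => ?_
      by_cases hm : m < K
      · rw [indicator_of_mem (mem_Iio.2 hm), norm_mul, mul_comm]
        exact mul_le_mul_of_nonneg_right (hB _) (norm_nonneg _)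
      · simp [hQ (k - m) (by lia), hm]
    · rw [hck, norm_zero]
      positivity
  have hSle : S ≤ (∑' k, (Iio K).indicator (fun k => ‖d k‖⁻¹) k) * (B * S) := by
    rw [← tsum_mul_right]
    refine hsS.tsum_le_tsum (fun k => ?_) ((hd.indicator _).mul_right _)
    by_cases hk : k < K
    · simpa [indicator, hk] using hbound k hk
    · simp [indicator, hk]
  have hSz : S = 0 := by nlinarith
  have hlow : ∀ k < K, c k = 0 := fun k hk => by
    have := hbound k hk
    rw [hSz, mul_zero, mul_zero] at this
    exact norm_le_zero_iff.1 this
  have hall : ∀ j : ℕ, ∀ m < K + j, m < N → c m = 0 := by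
    intro j
    induction j with
    | zero => exact fun m hm _ => hlow m (by simpa using hm)
    | succ j ih =>
      exact fun m hm hmN => hstep m hmN fun l hl => ih l (by push_cast at hm; lia) (by lia)
  exact hall (k - K + 1).toNat k (by lia) hk

/-- The coefficient of `y` with respect to the quasiperiodic exponential of frequency
`2πk + t`. -/
noncomputable def quasiFourierCoeff (y : ℝ → ℂ) (t : ℝ) (k : ℤ) : ℂ :=
  ∫ x in (0:ℝ)..1, y x * cexp (-(I * ((2 * π * k + t : ℝ) : ℂ)) * (x : ℂ))

/-- A quasiperiodic continuous function with summable coefficients is the sum of its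
quasiperiodic Fourier series. -/
lemma hasSum_quasiFourierCoeff {y : ℝ → ℂ} {t : ℝ} (hy : ContinuousOn y (Icc 0 1))
    (hbd : y 1 = cexp (I * t) * y 0) (hs : Summable (quasiFourierCoeff y t)) {x : ℝ}
    (hx : x ∈ Ico (0:ℝ) 1) :
    HasSum (fun k : ℤ => quasiFourierCoeff y t k * cexp (I * ((2 * π * k + t : ℝ) : ℂ) * x))
      (y x) := by
  set f : ℝ → ℂ := fun x => y x * cexp (-(I * t) * x) with hf
  have hf01 : f 0 = f 1 := by
    have h : cexp (I * t) * cexp (-(I * t)) = 1 := by rw [← Complex.exp_add]; simp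
    simp only [hf, hbd, ofReal_zero, ofReal_one, mul_zero, mul_one, Complex.exp_zero]
    linear_combination -y 0 * h
  have hfc : ContinuousOn f (Icc 0 1) :=
    hy.mul (by fun_prop : Continuous fun x : ℝ => cexp (-(I * t) * x)).continuousOn
  let F : C(AddCircle (1:ℝ), ℂ) := ⟨_, AddCircle.liftIco_zero_continuous hf01 hfc⟩
  have hF : ∀ k, fourierCoeff F k = quasiFourierCoeff y t k := by
    intro k
    change fourierCoeff (AddCircle.liftIco 1 0 f) k = _
    rw [fourierCoeff_liftIco_eq, fourierCoeffOn_eq_integral, quasiFourierCoeff]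
    simp only [zero_add, sub_zero, div_one, one_smul]
    refine intervalIntegral.integral_congr fun x _ => ?_
    simp only [hf, smul_eq_mul, fourier_coe_apply]
    rw [mul_left_comm, ← Complex.exp_add]
    congr 2
    push_cast
    ring
  have hsum := has_pointwise_sum_fourier_series_of_summable
    (f := F) (by simpa only [funext hF] using hs) (x : AddCircle (1:ℝ))
  have hFx : F (x : AddCircle (1:ℝ)) = f x :=
    AddCircle.liftIco_coe_apply (p := (1:ℝ)) (a := 0) (f := f) (by simpa using hx)
  rw [hFx] at hsum
  have hterm : (fun k : ℤ => quasiFourierCoeff y t k * cexp (I * ((2 * π * k + t : ℝ) : ℂ) * x)) =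
      fun k : ℤ => fourierCoeff F k • fourier k (x : AddCircle (1:ℝ)) * cexp (I * t * x) := by
    funext k
    rw [hF, smul_eq_mul, fourier_coe_apply, mul_assoc (quasiFourierCoeff y t k),
      ← Complex.exp_add]
    congr 2
    push_cast
    ring
  have hval : y x = f x * cexp (I * t * x) := by
    simp only [hf]
    rw [mul_assoc, ← Complex.exp_add]
    simp
  rw [hterm, hval]
  exact hsum.mul_right (cexp (I * t * x))

/-- The coefficients of a product are given by convolution. -/
lemma hasSum_quasiFourierCoeff_mul {q y : ℝ → ℂ} {t : ℝ} (hq : IntegrableOn q (Ioc 0 1))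
    (hy : ContinuousOn y (Icc 0 1)) (hbd : y 1 = cexp (I * t) * y 0)
    (hs : Summable (quasiFourierCoeff y t)) (k : ℤ) :
    HasSum (fun m => quasiFourierCoeff y t m * fourierCoeff01 q (k - m))
      (quasiFourierCoeff (fun x => q x * y x) t k) := by
  set F : ℤ → ℝ → ℂ := fun m x => quasiFourierCoeff y t m *
    (q x * cexp (-(2 * π * I * ((k - m : ℤ) : ℂ)) * x)) with hF
  have hint : ∀ m, ∫ x in (0:ℝ)..1, F m x =
      quasiFourierCoeff y t m * fourierCoeff01 q (k - m) := fun m => by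
    simp only [hF, fourierCoeff01]
    rw [intervalIntegral.integral_const_mul]
  simp only [← hint]
  refine intervalIntegral.hasSum_integral_of_dominated_convergence
    (fun m x => ‖quasiFourierCoeff y t m‖ * ‖q x‖) (fun m => ?_) (fun m => ?_) ?_ ?_ ?_
  · rw [uIoc_of_le zero_le_one]
    exact (hq.aestronglyMeasurable.mul
      (by fun_prop : Continuous fun x : ℝ =>
        cexp (-(2 * π * I * ((k - m : ℤ) : ℂ)) * x)).aestronglyMeasurable).const_mul _
  · refine ae_of_all _ fun x _ => ?_
    have h1 : ‖cexp (-(2 * π * I * ((k - m : ℤ) : ℂ)) * x)‖ = 1 := by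
      rw [Complex.norm_exp]; simp
    simp only [hF, norm_mul, h1, mul_one, le_refl]
  · exact ae_of_all _ fun x _ => hs.norm.mul_right _
  · simp only [tsum_mul_right]
    exact ((intervalIntegrable_iff_integrableOn_Ioc_of_le zero_le_one).2 hq).norm.const_mul _
  · have h1 : ∀ᵐ x : ℝ, x ≠ 1 := by simp [ae_iff, measure_singleton]
    filter_upwards [h1] with x hx1 hx
    rw [uIoc_of_le zero_le_one] at hx
    have h := (hasSum_quasiFourierCoeff hy hbd hs ⟨hx.1.le, lt_of_le_of_ne hx.2 hx1⟩).mul_left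
      (q x * cexp (-(I * ((2 * π * k + t : ℝ) : ℂ)) * x))
    have hfun : (fun m => F m x) = fun m : ℤ => q x * cexp (-(I * ((2 * π * k + t : ℝ) : ℂ)) * x) *
        (quasiFourierCoeff y t m * cexp (I * ((2 * π * m + t : ℝ) : ℂ) * x)) := by
      funext m
      have he : cexp (-(2 * π * I * ((k - m : ℤ) : ℂ)) * x) =
          cexp (-(I * ((2 * π * k + t : ℝ) : ℂ)) * x) *
            cexp (I * ((2 * π * m + t : ℝ) : ℂ) * x) := by
        rw [← Complex.exp_add]
        congr 1
        push_cast
        ring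
      simp only [hF]
      rw [he]
      ring
    rw [hfun, mul_right_comm (q x)]
    exact h

/-- The integral of a product with a unimodular exponential is at most the `L¹` norm. -/
lemma norm_integral_mul_cexp_le {f : ℝ → ℂ} {α : ℂ} (hα : α.re = 0) :
    ‖∫ x in (0:ℝ)..1, f x * cexp (α * x)‖ ≤ ∫ x in (0:ℝ)..1, ‖f x‖ := by
  refine (intervalIntegral.norm_integral_le_integral_norm zero_le_one).trans_eq ?_
  refine intervalIntegral.integral_congr fun x _ => ?_
  simp [Complex.norm_exp, hα]

/-- The eigenvalue equation in terms of coefficients. -/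
lemma IsEigenfunL.quasiFourierCoeff_mul_eq {q y : ℝ → ℂ} {t : ℝ} {lam : ℂ}
    (hq : IntegrableOn q (Ioc 0 1)) (h : IsEigenfunL q t lam y) (k : ℤ) :
    quasiFourierCoeff (fun x => q x * y x) t k =
      (lam - ((2 * π * k + t : ℝ) : ℂ) ^ 2) * quasiFourierCoeff y t k := by
  obtain ⟨g, hyc, hgc, hy, hg, -, hy1, hg1⟩ := h
  set α : ℂ := -(I * ((2 * π * k + t : ℝ) : ℂ)) with hα
  have hexp : cexp (I * t) * cexp α = 1 := by
    rw [← Complex.exp_add, Complex.exp_eq_one_iff]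
    refine ⟨-k, ?_⟩
    rw [hα]; push_cast; ring
  have hec : Continuous fun x : ℝ => cexp (α * x) := by fun_prop
  have hqy : IntervalIntegrable (fun x => q x * y x) volume 0 1 :=
    ((intervalIntegrable_iff_integrableOn_Ioc_of_le zero_le_one).2 hq).mul_continuousOn
      (by rwa [uIcc_of_le zero_le_one])
  have hyi : IntervalIntegrable y volume 0 1 :=
    ContinuousOn.intervalIntegrable (by rwa [uIcc_of_le zero_le_one])
  have hU : IntervalIntegrable (fun x => (q x - lam) * y x) volume 0 1 := by
    simpa only [sub_mul] using hqy.sub (hyi.const_mul lam)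
  have e1 := mul_integral_mul_cexp_eq_neg (α := α)
    (hgc.integrableOn_Icc.mono_set Ioc_subset_Icc_self) hy
    (by rw [hy1]; linear_combination y 0 * hexp)
  have e2 := mul_integral_mul_cexp_eq_neg (α := α)
    ((intervalIntegrable_iff_integrableOn_Ioc_of_le zero_le_one).1 hU) hg
    (by rw [hg1]; linear_combination g 0 * hexp)
  have e3 : ∫ x in (0:ℝ)..1, (q x - lam) * y x * cexp (α * x) =
      (∫ x in (0:ℝ)..1, q x * y x * cexp (α * x)) -
        lam * ∫ x in (0:ℝ)..1, y x * cexp (α * x) := by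
    rw [← intervalIntegral.integral_const_mul, ← intervalIntegral.integral_sub
      (hqy.mul_continuousOn hec.continuousOn)
      ((hyi.mul_continuousOn hec.continuousOn).const_mul lam)]
    refine intervalIntegral.integral_congr fun x _ => ?_
    ring
  have hα2 : α ^ 2 = -((2 * π * k + t : ℝ) : ℂ) ^ 2 := by
    rw [hα, neg_sq, mul_pow, I_sq, neg_one_mul]
  rw [e3] at e2
  simp only [quasiFourierCoeff, ← hα]
  rw [sub_eq_add_neg, ← hα2]
  linear_combination e2 - α * e1

lemma summable_norm_inv_sq_sub_sq (n : ℤ) (t : ℝ) :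
    Summable fun k : ℤ =>
      ‖(((2 * π * n + t : ℝ) : ℂ) ^ 2 - ((2 * π * k + t : ℝ) : ℂ) ^ 2)‖⁻¹ := by
  have hs : ∀ a : ℝ, Summable fun k : ℤ => (|(k:ℝ) + a|⁻¹) ^ 2 := fun a => by
    have := (Real.summable_one_div_int_add_rpow a 2).2 one_lt_two
    simpa only [Real.rpow_two, one_div, inv_pow] using this
  refine Summable.of_nonneg_of_le (fun _ => by positivity) (fun k => ?_)
    (((hs (-n)).add (hs (n + t / π))).mul_left (4 * π ^ 2)⁻¹)
  have hfac : (2 * π * n + t) ^ 2 - (2 * π * k + t) ^ 2 =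
      -((4 * π ^ 2) * ((k + -n) * (k + (n + t / π)))) := by
    field_simp
    ring
  rw [← ofReal_pow, ← ofReal_pow, ← ofReal_sub, hfac, norm_real, norm_neg, Real.norm_eq_abs,
    abs_mul, abs_of_nonneg (by positivity : 0 ≤ 4 * π ^ 2), abs_mul, mul_inv, mul_inv |(k:ℝ) + -n|]
  refine mul_le_mul_of_nonneg_left ?_ (by positivity)
  nlinarith [sq_nonneg (|(k:ℝ) + -n|⁻¹ - |(k:ℝ) + (n + t / π)|⁻¹),
    sq_nonneg (|(k:ℝ) + -n|⁻¹), sq_nonneg (|(k:ℝ) + (n + t / π)|⁻¹)]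

lemma sq_sub_sq_ne_zero_of_ne {t : ℝ} (ht : t ∈ Ioc (-π) π) (ht0 : t ≠ 0) (htpi : t ≠ π)
    {n k : ℤ} (hk : k ≠ n) :
    ((2 * π * n + t : ℝ) : ℂ) ^ 2 - ((2 * π * k + t : ℝ) : ℂ) ^ 2 ≠ 0 := by
  rw [← ofReal_pow, ← ofReal_pow, ← ofReal_sub, ofReal_ne_zero]
  have hfac : (2 * π * n + t) ^ 2 - (2 * π * k + t) ^ 2 =
      4 * π * ((n - k : ℤ) : ℝ) * (((n + k : ℤ) : ℝ) * π + t) := by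
    push_cast; ring
  rw [hfac]
  refine mul_ne_zero (mul_ne_zero (by positivity) (Int.cast_ne_zero.2 (by lia))) fun h => ?_
  have hπ := Real.pi_pos
  have h1 : ((n + k : ℤ) : ℝ) < 1 := by
    by_contra! hc
    nlinarith [ht.1, ht.2]
  have h2 : (-1 : ℝ) < ((n + k : ℤ) : ℝ) := by
    by_contra! hc
    exact htpi (le_antisymm ht.2 (by nlinarith))
  have h3 : n + k < 1 := by exact_mod_cast h1
  have h4 : -1 < n + k := by exact_mod_cast h2
  have h5 : n + k = 0 := by lia
  rw [h5] at h
  exact ht0 (by simpa using h)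

theorem eigenfunction_fourier_coefficients (q : ℝ → ℂ) (hper : ∀ x : ℝ, q (x + 1) = q x)
    (hint : IntegrableOn q (Set.Icc (0:ℝ) 1))
    (hfour : ∀ m : ℤ, m ≤ 0 → fourierCoeff01 q m = 0)
    (t : ℝ) (ht : t ∈ Set.Ioc (-Real.pi) Real.pi) (ht0 : t ≠ 0) (htpi : t ≠ Real.pi)
    (n : ℤ) (Ψ : ℝ → ℂ)
    (hΨ : IsEigenfunL q t ((((2 * Real.pi * n + t : ℝ) : ℂ))^2) Ψ) :
    (∫ x in (0:ℝ)..1, Ψ x * Complex.exp (-(Complex.I * ((2 * Real.pi * n + t : ℝ) : ℂ)) * (x : ℂ))) ≠ 0 ∧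
      ∀ p : ℤ, p < 0 →
        (∫ x in (0:ℝ)..1,
          Ψ x * Complex.exp (-(Complex.I * ((2 * Real.pi * (n + p) + t : ℝ) : ℂ)) * (x : ℂ))) = 0 := by
  have hq : IntegrableOn q (Ioc 0 1) := hint.mono_set Ioc_subset_Icc_self
  have heq := hΨ.quasiFourierCoeff_mul_eq hq
  have hdinv := summable_norm_inv_sq_sub_sq n t
  obtain ⟨-, hyc, -, -, -, hne, hy1, -⟩ := id hΨ
  set c := quasiFourierCoeff Ψ t with hc
  set d : ℤ → ℂ := fun k => ((2 * π * n + t : ℝ) : ℂ) ^ 2 - ((2 * π * k + t : ℝ) : ℂ) ^ 2 with hd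
  have hd0 : ∀ k, k ≠ n → d k ≠ 0 := fun k hk => sq_sub_sq_ne_zero_of_ne ht ht0 htpi hk
  have hsum : Summable fun k => ‖c k‖ := by
    refine Summable.of_norm_bounded_eventually
      (hdinv.mul_right (∫ x in (0:ℝ)..1, ‖q x * Ψ x‖)) ?_
    refine (finite_singleton n).subset fun k hk => ?_
    by_contra hkn
    refine hk ?_
    simp only [norm_norm]
    rw [mem_ofPred_eq, le_inv_mul_iff₀ (norm_pos_iff.2 (hd0 k hkn)), ← norm_mul, ← heq k]
    exact norm_integral_mul_cexp_le (by simp)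
  have hrec : ∀ k, HasSum (fun m => c m * fourierCoeff01 q (k - m)) (d k * c k) := fun k => by
    rw [← heq k]
    exact hasSum_quasiFourierCoeff_mul hq hyc hy1 hsum.of_norm k
  have hvanish : ∀ N : ℤ, (∀ k < N, d k ≠ 0 ∨ c k = 0) → ∀ k < N, c k = 0 := fun N hN k hk =>
    eq_zero_of_triangular_recursion hsum hdinv hfour
      (fun m => norm_integral_mul_cexp_le (by simp)) hrec hN hk
  constructor
  · intro hcn
    have hall : ∀ k, c k = 0 := fun k => by
      refine hvanish (k + 1) (fun m _ => ?_) k (by lia)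
      by_cases hm : m = n
      · exact Or.inr (hm ▸ hcn)
      · exact Or.inl (hd0 m hm)
    have hIco : ∀ x ∈ Ico (0:ℝ) 1, Ψ x = 0 := fun x hx => by
      have h := hasSum_quasiFourierCoeff hyc hy1 hsum.of_norm hx
      simp only [← hc, hall, zero_mul] at h
      exact h.unique hasSum_zero
    refine hne fun x hx => ?_
    rcases hx.2.lt_or_eq with h | rfl
    · exact hIco x ⟨hx.1, h⟩
    · rw [hy1, hIco 0 (by simp), mul_zero]
  · intro p hp
    have h := hvanish n (fun k hk => Or.inl (hd0 k hk.ne)) (n + p) (by lia)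
    simpa only [hc, quasiFourierCoeff, Int.cast_add] using h
end

section
/- Let a, b, c, d be complex numbers with ab = cd. Then for every integer n, every integer k ≥ 1, every real t, and every λ ∈ ℂ for which all occurring denominators are nonzero, the quantity a_k(λ,t) computed with (q_{−1}, q_1) = (a, b) is equal to the quantity a_k(λ,t) computed with (q_{−1}, q_1) = (c, d). -/
open Real Complex Finset

/-- `q_{−1} = a`, `q_1 = b`, `q_m = 0` otherwise. -/
def qCoef (a b : ℂ) : ℤ → ℂ := fun m => if m = -1 then a else if m = 1 then b else 0

/-- Partial sum `n_1 + ⋯ + n_s` of the first `s` entries of a tuple. -/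
def zpsum {k : ℕ} (v : Fin k → ℤ) (s : ℕ) : ℤ :=
  ∑ i ∈ Finset.univ.filter (fun i : Fin k => (i : ℕ) < s), v i

/-- Tuples `(n_1,…,n_k) ∈ {−1,1}^k` whose partial sums `n_1+⋯+n_s` are nonzero
for every `s = 1,…,k`. -/
noncomputable def pmTuples (k : ℕ) : Finset (Fin k → ℤ) :=
  open scoped Classical in
  (Fintype.piFinset fun _ : Fin k => ({-1, 1} : Finset ℤ)).filter
    fun v => ∀ s ∈ Finset.Icc 1 k, zpsum v s ≠ 0

/-- The coefficient `a_k(λ,t)` from the iteration. -/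
noncomputable def aCoef (a b : ℂ) (n : ℤ) (k : ℕ) (t : ℝ) (lam : ℂ) : ℂ :=
  ∑ v ∈ pmTuples k,
    ((∏ i, qCoef a b (v i)) * qCoef a b (-(∑ i, v i))) /
      ∏ s ∈ Finset.Icc 1 k,
        (lam - (((2 * Real.pi * ((n : ℝ) - (zpsum v s : ℝ)) + t : ℝ)) : ℂ)^2)

theorem exists_prod_qCoef_eq_pow {ι : Type*} (s : Finset ι) (v : ι → ℤ)
    (hv : ∀ i ∈ s, v i = -1 ∨ v i = 1) :
    ∃ p q : ℕ, (∀ a b : ℂ, ∏ i ∈ s, qCoef a b (v i) = a ^ p * b ^ q) ∧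
      ∑ i ∈ s, v i = (q : ℤ) - p := by
  classical
  induction s using Finset.induction_on with
  | empty => exact ⟨0, 0, by simp, by simp⟩
  | insert j s hj ih =>
    obtain ⟨p, q, hprod, hsum⟩ := ih fun i hi => hv i (Finset.mem_insert_of_mem hi)
    rcases hv j (Finset.mem_insert_self j s) with h | h
    · refine ⟨p + 1, q, fun a b => ?_, ?_⟩
      · rw [Finset.prod_insert hj, hprod, h]
        simp only [qCoef, if_true]
        ring
      · rw [Finset.sum_insert hj, hsum, h]
        push_cast
        ring
    · refine ⟨p, q + 1, fun a b => ?_, ?_⟩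
      · rw [Finset.prod_insert hj, hprod, h]
        norm_num [qCoef]
        ring
      · rw [Finset.sum_insert hj, hsum, h]
        push_cast
        ring

/-- The closed product `q_{n_1}⋯q_{n_k}·q_{−(n_1+⋯+n_k)}` depends on `a`, `b` only through `a * b`. -/
theorem prod_qCoef_mul_qCoef_neg_sum_congr {ι : Type*} (s : Finset ι) (v : ι → ℤ)
    (hv : ∀ i ∈ s, v i = -1 ∨ v i = 1) {a b c d : ℂ} (h : a * b = c * d) :
    (∏ i ∈ s, qCoef a b (v i)) * qCoef a b (-∑ i ∈ s, v i) =
      (∏ i ∈ s, qCoef c d (v i)) * qCoef c d (-∑ i ∈ s, v i) := by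
  obtain ⟨p, q, hprod, hsum⟩ := exists_prod_qCoef_eq_pow s v hv
  rw [hprod, hprod]
  by_cases h₁ : ∑ i ∈ s, v i = 1
  · obtain rfl : q = p + 1 := by omega
    have key (x y : ℂ) : x ^ p * y ^ (p + 1) * x = (x * y) ^ (p + 1) := by ring
    simp only [h₁, qCoef, if_true, key, h]
  by_cases h₂ : ∑ i ∈ s, v i = -1
  · obtain rfl : p = q + 1 := by omega
    have key (x y : ℂ) : x ^ (q + 1) * y ^ q * y = (x * y) ^ (q + 1) := by ring
    have hq (x y : ℂ) : qCoef x y (-(-1)) = y := by norm_num [qCoef]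
    simp only [h₂, hq, key, h]
  · have hq (x y : ℂ) : qCoef x y (-∑ i ∈ s, v i) = 0 := by
      rw [qCoef, if_neg (by omega), if_neg (by omega)]
    rw [hq, hq, mul_zero, mul_zero]

theorem aCoef_depends_only_on_ab (a b c d : ℂ) (h : a * b = c * d)
    (n : ℤ) (k : ℕ) (hk : 1 ≤ k) (t : ℝ) (lam : ℂ)
    (hden : ∀ v ∈ pmTuples k, ∀ s ∈ Finset.Icc 1 k,
      lam - (((2 * Real.pi * ((n : ℝ) - (zpsum v s : ℝ)) + t : ℝ)) : ℂ)^2 ≠ 0) :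
    aCoef a b n k t lam = aCoef c d n k t lam := by
  refine Finset.sum_congr rfl fun v hv => ?_
  rw [prod_qCoef_mul_qCoef_neg_sum_congr Finset.univ v (fun i _ => ?_) h]
  simp only [pmTuples, Finset.mem_filter] at hv
  simpa using Fintype.mem_piFinset.1 hv.1 i
end

section
/- For every ρ ∈ (0, π/2) there exists a natural number N such that for every t ∈ [ρ, π − ρ], every integer n with |n| > N, every nonzero integer k, and every complex number λ with |λ − (2πn + t)²| ≤ 1, one has |λ − (2π(n − k) + t)²| > |n|·ρ. -/
open Real

/-- If `t` stays at distance `ρ` from both ends of `[0, π]`, then so does `π m + t` from `0`. -/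
lemma le_abs_pi_mul_int_add {ρ t : ℝ} (ht : t ∈ Set.Icc ρ (Real.pi - ρ)) (m : ℤ) :
    ρ ≤ |Real.pi * m + t| := by
  obtain ⟨h1, h2⟩ := ht
  have hpi := Real.pi_pos
  rcases le_or_gt 0 m with hm | hm
  · have hm' : (0 : ℝ) ≤ m := by exact_mod_cast hm
    exact le_trans (by nlinarith) (le_abs_self _)
  · have hm' : (m : ℝ) ≤ -1 := by exact_mod_cast (by omega : m ≤ -1)
    exact le_trans (by nlinarith) (neg_le_abs _)

lemma abs_mul_le_abs_mul_abs_pi_mul_int_add {ρ t : ℝ} (hρ : 0 < ρ)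
    (ht : t ∈ Set.Icc ρ (Real.pi - ρ)) (n : ℤ) {k : ℤ} (hk : k ≠ 0) :
    |(n : ℝ)| * ρ ≤ |(k : ℝ)| * |Real.pi * (2 * n - k) + t| := by
  have hpi := Real.pi_pos
  rcases le_or_gt |n| |k| with h | h
  · have h' : |(n : ℝ)| ≤ |(k : ℝ)| := by exact_mod_cast h
    have hm := le_abs_pi_mul_int_add ht (2 * n - k)
    push_cast at hm
    exact mul_le_mul h' hm hρ.le (abs_nonneg _)
  · have hk1 : (1 : ℝ) ≤ |(k : ℝ)| := by exact_mod_cast Int.one_le_abs hk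
    have hb : |n| + 1 ≤ |2 * n - k| := by
      have := abs_sub_abs_le_abs_sub (2 * n) k
      rw [abs_mul, abs_two] at this
      omega
    have hb' : |(n : ℝ)| + 1 ≤ |2 * (n : ℝ) - k| := by exact_mod_cast hb
    have h2 := abs_sub_abs_le_abs_sub (Real.pi * (2 * (n : ℝ) - k)) (-t)
    rw [abs_mul, abs_of_pos hpi, abs_neg, abs_of_pos (hρ.trans_le ht.1), sub_neg_eq_add] at h2
    have h3 : |(n : ℝ)| * ρ ≤ |Real.pi * (2 * (n : ℝ) - k) + t| := by
      nlinarith [ht.1, ht.2, abs_nonneg (n : ℝ)]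
    exact h3.trans (le_mul_of_one_le_left (abs_nonneg _) hk1)

theorem denominator_lower_bound (ρ : ℝ) (hρ : ρ ∈ Set.Ioo 0 (Real.pi / 2)) :
    ∃ N : ℕ, ∀ t ∈ Set.Icc ρ (Real.pi - ρ), ∀ n : ℤ, (N : ℤ) < |n| →
      ∀ k : ℤ, k ≠ 0 → ∀ lam : ℂ,
        ‖lam - (((2 * Real.pi * n + t : ℝ)) : ℂ)^2‖ ≤ 1 →
        ‖lam - (((2 * Real.pi * (n - k) + t : ℝ)) : ℂ)^2‖ > (|n| : ℝ) * ρ := by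
  obtain ⟨N, hN⟩ := exists_nat_gt (1 / ρ)
  refine ⟨N, fun t ht n hn k hk lam hlam ↦ ?_⟩
  have hnρ : 1 < |(n : ℝ)| * ρ := by
    have hn' : (N : ℝ) < |(n : ℝ)| := by exact_mod_cast hn
    exact (div_lt_iff₀ hρ.1).1 (hN.trans hn')
  have hkey := abs_mul_le_abs_mul_abs_pi_mul_int_add hρ.1 ht n hk
  have hdiff : ‖((2 * Real.pi * n + t : ℝ) : ℂ) ^ 2 -
      ((2 * Real.pi * (n - k) + t : ℝ) : ℂ) ^ 2‖ =
      4 * Real.pi * (|(k : ℝ)| * |Real.pi * (2 * n - k) + t|) := by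
    rw [← Complex.ofReal_pow, ← Complex.ofReal_pow, ← Complex.ofReal_sub, Complex.norm_real,
      Real.norm_eq_abs, ← abs_mul, ← abs_of_pos (by positivity : 0 < 4 * Real.pi), ← abs_mul]
    congr 1
    ring
  have htri := norm_sub_le_norm_sub_add_norm_sub (((2 * Real.pi * n + t : ℝ) : ℂ) ^ 2) lam
    (((2 * Real.pi * (n - k) + t : ℝ) : ℂ) ^ 2)
  rw [hdiff, norm_sub_rev _ lam] at htri
  nlinarith [Real.pi_gt_three]
end

section
/- Let a, b be complex numbers and ρ ∈ (0, π/2). There exists a natural number N such that for every t ∈ [ρ, π − ρ], every integer n with |n| > N, every complex number λ with |λ − (2πn + t)²| ≤ 1, and every integer p ≥ 1, one has |a_{2p−1}(λ,t)| ≤ 2^{2p−1}·|ab|^p·(|n|·ρ)^{−(2p−1)}. -/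
open Real Complex Finset

theorem mem_pmTuples {k : ℕ} {v : Fin k → ℤ} :
    v ∈ pmTuples k ↔ (∀ i, v i = -1 ∨ v i = 1) ∧ ∀ s ∈ Finset.Icc 1 k, zpsum v s ≠ 0 := by
  simp [pmTuples, Fintype.mem_piFinset]

theorem card_pmTuples_le (k : ℕ) : (pmTuples k).card ≤ 2 ^ k := by
  have hsub : pmTuples k ⊆ Fintype.piFinset fun _ : Fin k => ({-1, 1} : Finset ℤ) := fun v hv => by
    simpa [Fintype.mem_piFinset] using (mem_pmTuples.mp hv).1
  simpa [Fintype.card_piFinset] using Finset.card_le_card hsub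

/-- A product of coefficients over signs is determined by the number of each sign. -/
theorem exists_prod_qCoef_eq (a b : ℂ) {ι : Type*} (s : Finset ι) (v : ι → ℤ)
    (hv : ∀ i ∈ s, v i = -1 ∨ v i = 1) :
    ∃ x y : ℕ, x + y = s.card ∧ ∑ i ∈ s, v i = (y : ℤ) - x ∧
      ∏ i ∈ s, qCoef a b (v i) = a ^ x * b ^ y := by
  classical
  induction s using Finset.induction_on with
  | empty => exact ⟨0, 0, by simp⟩
  | insert i s hi ih =>
    obtain ⟨x, y, hcard, hsum, hprod⟩ := ih fun j hj => hv j (Finset.mem_insert_of_mem hj)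
    rw [Finset.card_insert_of_notMem hi, Finset.sum_insert hi, Finset.prod_insert hi, hsum, hprod]
    rcases hv i (Finset.mem_insert_self i s) with h | h
    · refine ⟨x + 1, y, by omega, by rw [h]; push_cast; ring, ?_⟩
      rw [h, qCoef, if_pos rfl, pow_succ]
      ring
    · refine ⟨x, y + 1, by omega, by rw [h]; push_cast; ring, ?_⟩
      rw [h, qCoef, if_neg (by norm_num), if_pos rfl, pow_succ]
      ring

theorem norm_numerator_le (a b : ℂ) {p : ℕ} (hp : 1 ≤ p) {v : Fin (2 * p - 1) → ℤ}
    (hv : ∀ i, v i = -1 ∨ v i = 1) :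
    ‖(∏ i, qCoef a b (v i)) * qCoef a b (-(∑ i, v i))‖ ≤ ‖a * b‖ ^ p := by
  obtain ⟨x, y, hcard, hsum, hprod⟩ := exists_prod_qCoef_eq a b Finset.univ v fun i _ => hv i
  rw [Finset.card_univ, Fintype.card_fin] at hcard
  rw [hsum, hprod, ← norm_pow, mul_pow]
  unfold qCoef
  split_ifs with h₁ h₂
  · obtain rfl : y = p := by omega
    rw [mul_right_comm, ← pow_succ, show x + 1 = y by omega]
  · obtain rfl : x = p := by omega
    rw [mul_assoc, ← pow_succ, show y + 1 = x by omega]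
  · simp only [mul_zero, norm_zero]
    positivity

/-- A translate of `t` by a multiple of `π` stays at distance at least `ρ` from zero. -/
theorem le_abs_int_mul_pi_add {ρ t : ℝ} (ht : t ∈ Set.Icc ρ (Real.pi - ρ)) (hρ : 0 < ρ) (m : ℤ) :
    ρ ≤ |Real.pi * m + t| := by
  obtain ⟨h₁, h₂⟩ := ht
  have hpi := Real.pi_pos
  rcases le_or_gt 0 m with hm | hm
  · have : (0 : ℝ) ≤ m := by exact_mod_cast hm
    exact le_abs.mpr (Or.inl (by nlinarith))
  · have : (m : ℝ) ≤ -1 := by exact_mod_cast (by omega : m ≤ -1)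
    exact le_abs.mpr (Or.inr (by nlinarith))

theorem abs_mul_le_abs_mul_abs {ρ t : ℝ} (ht : t ∈ Set.Icc ρ (Real.pi - ρ)) (hρ : 0 < ρ)
    (n j : ℤ) (hj : j ≠ 0) :
    |(n : ℝ)| * ρ ≤ |(j : ℝ)| * |Real.pi * ((2 * n - j : ℤ) : ℝ) + t| := by
  have hm := le_abs_int_mul_pi_add ht hρ (2 * n - j)
  rcases le_or_gt |n| |j| with h | h
  · have h' : |(n : ℝ)| ≤ |(j : ℝ)| := by exact_mod_cast h
    gcongr
  · have hj1 : (1 : ℝ) ≤ |(j : ℝ)| := by exact_mod_cast Int.one_le_abs hj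
    have hm1 : |n| + 1 ≤ |2 * n - j| := by
      have : |2 * n| ≤ |2 * n - j| + |j| := by simpa using abs_add_le (2 * n - j) j
      rw [abs_mul, abs_two] at this
      omega
    have hm2 : |(n : ℝ)| + 1 ≤ |((2 * n - j : ℤ) : ℝ)| := by exact_mod_cast hm1
    obtain ⟨h₁, h₂⟩ := ht
    have hpi := Real.pi_pos
    have htri : Real.pi * |((2 * n - j : ℤ) : ℝ)| ≤
        |Real.pi * ((2 * n - j : ℤ) : ℝ) + t| + t := by
      have := abs_sub (Real.pi * ((2 * n - j : ℤ) : ℝ) + t) t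
      rwa [add_sub_cancel_right, abs_mul, abs_of_pos hpi, abs_of_pos (hρ.trans_le h₁)] at this
    have hn := abs_nonneg (n : ℝ)
    have : |(n : ℝ)| * ρ ≤ |Real.pi * ((2 * n - j : ℤ) : ℝ) + t| := by nlinarith
    exact this.trans (le_mul_of_one_le_left (abs_nonneg _) hj1)

theorem le_norm_denominator {ρ t : ℝ} (ht : t ∈ Set.Icc ρ (Real.pi - ρ)) (hρ : 0 < ρ)
    {n j : ℤ} (hj : j ≠ 0) (hn : 1 ≤ |(n : ℝ)| * ρ) {lam : ℂ}
    (hlam : ‖lam - (((2 * Real.pi * n + t : ℝ)) : ℂ) ^ 2‖ ≤ 1) :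
    |(n : ℝ)| * ρ ≤
      ‖lam - (((2 * Real.pi * ((n : ℝ) - (j : ℝ)) + t : ℝ)) : ℂ) ^ 2‖ := by
  have hgap := abs_mul_le_abs_mul_abs ht hρ n j hj
  have hdiff : ‖(((2 * Real.pi * n + t : ℝ)) : ℂ) ^ 2 -
      (((2 * Real.pi * ((n : ℝ) - (j : ℝ)) + t : ℝ)) : ℂ) ^ 2‖ =
      4 * Real.pi * (|(j : ℝ)| * |Real.pi * ((2 * n - j : ℤ) : ℝ) + t|) := by
    rw [← Complex.ofReal_pow, ← Complex.ofReal_pow, ← Complex.ofReal_sub, Complex.norm_real,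
      Real.norm_eq_abs, ← abs_mul, ← abs_of_pos (show 0 < 4 * Real.pi by positivity), ← abs_mul]
    congr 1
    push_cast
    ring
  have htri := norm_sub_le_norm_sub_add_norm_sub (((2 * Real.pi * n + t : ℝ) : ℂ) ^ 2) lam
    (((2 * Real.pi * ((n : ℝ) - (j : ℝ)) + t : ℝ) : ℂ) ^ 2)
  rw [norm_sub_rev _ lam, hdiff] at htri
  nlinarith [Real.pi_gt_three]

theorem aCoef_odd_bound (a b : ℂ) (ρ : ℝ) (hρ : ρ ∈ Set.Ioo 0 (Real.pi / 2)) :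
    ∃ N : ℕ, ∀ t ∈ Set.Icc ρ (Real.pi - ρ), ∀ n : ℤ, (N : ℤ) < |n| →
      ∀ lam : ℂ, ‖lam - (((2 * Real.pi * n + t : ℝ)) : ℂ)^2‖ ≤ 1 →
        ∀ p : ℕ, 1 ≤ p →
          ‖aCoef a b n (2 * p - 1) t lam‖ ≤
            2 ^ (2 * p - 1) * ‖a * b‖ ^ p / ((|n| : ℝ) * ρ) ^ (2 * p - 1) := by
  obtain ⟨hρ, -⟩ := hρ
  obtain ⟨N, hN⟩ := exists_nat_ge (1 / ρ)
  refine ⟨N, fun t ht n hn lam hlam p hp => ?_⟩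
  have hNn : (N : ℝ) ≤ |(n : ℝ)| := by exact_mod_cast hn.le
  have hn1 : 1 ≤ |(n : ℝ)| * ρ := (div_le_iff₀ hρ).mp (hN.trans hNn)
  have hterm : ∀ v ∈ pmTuples (2 * p - 1),
      ‖((∏ i, qCoef a b (v i)) * qCoef a b (-(∑ i, v i))) /
        ∏ s ∈ Finset.Icc 1 (2 * p - 1),
          (lam - (((2 * Real.pi * ((n : ℝ) - (zpsum v s : ℝ)) + t : ℝ)) : ℂ) ^ 2)‖ ≤
        ‖a * b‖ ^ p / (|(n : ℝ)| * ρ) ^ (2 * p - 1) := by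
    intro v hv
    obtain ⟨hsign, hne⟩ := mem_pmTuples.mp hv
    rw [norm_div, norm_prod]
    refine div_le_div₀ (by positivity) (norm_numerator_le a b hp hsign) (by positivity) ?_
    calc (|(n : ℝ)| * ρ) ^ (2 * p - 1)
        = ∏ s ∈ Finset.Icc 1 (2 * p - 1), |(n : ℝ)| * ρ := by simp
      _ ≤ _ := Finset.prod_le_prod (fun _ _ => by positivity)
          fun s hs => le_norm_denominator ht hρ (hne s hs) hn1 hlam
  refine (norm_sum_le_of_le _ hterm).trans ?_
  rw [Finset.sum_const, nsmul_eq_mul, mul_div_assoc]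
  gcongr
  exact_mod_cast card_pmTuples_le (2 * p - 1)
end

section
/- Let a, b be complex numbers and ρ ∈ (0, π/2). There exists a natural number N such that for every t ∈ [ρ, π − ρ] and every integer n with |n| > N: the series A(λ,t) = Σ_{p=1}^∞ a_{2p−1}(λ,t) converges absolutely for every λ ∈ U(n,t), and a complex number λ ∈ U(n,t) is an eigenvalue of H_t(a,b) if and only if λ − (2πn + t)² = A(λ,t). -/
open Real Complex Finset

open Real Complex Set

/-- The Mathieu potential `a·exp(−2πi x) + b·exp(2πi x)`. -/
noncomputable def mathieuPot (a b : ℂ) (x : ℝ) : ℂ :=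
  a * Complex.exp (-(2 * Real.pi * Complex.I) * (x : ℂ)) +
    b * Complex.exp (2 * Real.pi * Complex.I * (x : ℂ))

/-- `λ` is an eigenvalue of the operator `H_t(a,b)`: there is a twice continuously
differentiable function `y`, not identically zero on `[0,1]`, satisfying
`−y'' + (a e^{−2πix} + b e^{2πix}) y = λ y` on `[0,1]` with the `t`-quasiperiodic
boundary conditions. -/
def IsEigenvalueH (a b : ℂ) (t : ℝ) (lam : ℂ) : Prop :=
  ∃ y : ℝ → ℂ, ContDiff ℝ 2 y ∧
    (¬ ∀ x ∈ Set.Icc (0:ℝ) 1, y x = 0) ∧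
    (∀ x ∈ Set.Icc (0:ℝ) 1,
      -(deriv (deriv y) x) + mathieuPot a b x * y x = lam * y x) ∧
    y 1 = Complex.exp (Complex.I * t) * y 0 ∧
    deriv y 1 = Complex.exp (Complex.I * t) * deriv y 0


/-- The action of the Mathieu potential on Fourier coefficients. -/
def neighborSum (a b : ℂ) (u : ℤ → ℂ) (j : ℤ) : ℂ := a * u (j - 1) + b * u (j + 1)

theorem norm_neighborSum_le {a b : ℂ} {u : ℤ → ℂ} {B : ℝ} (hu : ∀ j, ‖u j‖ ≤ B) (j : ℤ) :
    ‖neighborSum a b u j‖ ≤ (‖a‖ + ‖b‖) * B := by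
  unfold neighborSum
  refine (norm_add_le _ _).trans ?_
  rw [norm_mul, norm_mul, add_mul]
  gcongr <;> apply hu

theorem qCoef_neg_eq_neighborSum (a b : ℂ) (j : ℤ) :
    qCoef a b (-j) = neighborSum a b (Pi.single 0 1) j := by
  unfold qCoef neighborSum
  by_cases h1 : j = 1
  · subst h1; simp
  · by_cases h2 : j = -1
    · subst h2; simp
    · have h3 : j - 1 ≠ 0 := by omega
      have h4 : j + 1 ≠ 0 := by omega
      have h5 : -j ≠ 1 := by omega
      have h6 : -j ≠ -1 := by omega
      rw [if_neg h6, if_neg h5, Pi.single_eq_of_ne h3, Pi.single_eq_of_ne h4]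
      simp

/-- One step of the iteration: multiply by `E`, then apply the potential. -/
def iterStep (a b : ℂ) (E φ : ℤ → ℂ) : ℤ → ℂ := neighborSum a b fun j => E j * φ j

section Paths

theorem zpsum_snoc_of_le {k : ℕ} (v : Fin k → ℤ) (x : ℤ) {s : ℕ} (hs : s ≤ k) :
    zpsum (Fin.snoc v x : Fin (k + 1) → ℤ) s = zpsum v s := by
  unfold zpsum
  rw [Finset.sum_filter, Finset.sum_filter, Fin.sum_univ_castSucc]
  simp [hs]

theorem zpsum_self {k : ℕ} (v : Fin k → ℤ) : zpsum v k = ∑ i, v i := by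
  unfold zpsum
  congr 1
  ext i
  simp

theorem sum_pmPaths_succ (a b : ℂ) (E φ : ℤ → ℂ) (k : ℕ) :
    (∑ v ∈ Fintype.piFinset fun _ : Fin (k + 1) => ({-1, 1} : Finset ℤ),
      (∏ i, qCoef a b (v i)) * (∏ s ∈ Finset.Icc 1 (k + 1), E (zpsum v s)) * φ (∑ i, v i)) =
    ∑ v ∈ Fintype.piFinset fun _ : Fin k => ({-1, 1} : Finset ℤ),
      (∏ i, qCoef a b (v i)) * (∏ s ∈ Finset.Icc 1 k, E (zpsum v s)) *
        iterStep a b E φ (∑ i, v i) := by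
  have key : ∀ v : Fin k → ℤ,
      (∏ i, qCoef a b (v i)) * (∏ s ∈ Finset.Icc 1 k, E (zpsum v s)) *
        iterStep a b E φ (∑ i, v i) =
      ∑ x ∈ ({-1, 1} : Finset ℤ),
        (∏ i, qCoef a b ((Fin.snoc v x : Fin (k + 1) → ℤ) i)) *
          (∏ s ∈ Finset.Icc 1 (k + 1), E (zpsum (Fin.snoc v x : Fin (k + 1) → ℤ) s)) *
          φ (∑ i, (Fin.snoc v x : Fin (k + 1) → ℤ) i) := by
    intro v
    have hprod : ∀ x : ℤ,
        (∏ s ∈ Finset.Icc 1 (k + 1), E (zpsum (Fin.snoc v x : Fin (k + 1) → ℤ) s)) =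
          (∏ s ∈ Finset.Icc 1 k, E (zpsum v s)) * E ((∑ i, v i) + x) := by
      intro x
      rw [Finset.prod_Icc_succ_top (by omega), zpsum_self, Fin.sum_univ_castSucc]
      simp only [Fin.snoc_castSucc, Fin.snoc_last]
      congr 1
      refine Finset.prod_congr rfl fun s hs => ?_
      rw [zpsum_snoc_of_le v x (Finset.mem_Icc.1 hs).2]
    rw [Finset.sum_pair (by norm_num)]
    simp only [hprod, Fin.prod_univ_castSucc, Fin.sum_univ_castSucc, Fin.snoc_castSucc,
      Fin.snoc_last, iterStep, neighborSum]
    have h1 : qCoef a b (-1) = a := by simp [qCoef]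
    have h2 : qCoef a b 1 = b := by simp [qCoef]
    rw [h1, h2, ← sub_eq_add_neg]
    ring
  rw [Finset.sum_congr rfl fun v _ => key v, ← Finset.sum_product']
  refine Finset.sum_nbij' (fun v => (Fin.init v, v (Fin.last k))) (fun p => Fin.snoc p.1 p.2)
    ?_ ?_ ?_ ?_ ?_
  · intro v hv
    rw [Fintype.mem_piFinset] at hv
    rw [Finset.mem_product, Fintype.mem_piFinset]
    exact ⟨fun i => hv _, hv _⟩
  · intro p hp
    rw [Finset.mem_product, Fintype.mem_piFinset] at hp
    rw [Fintype.mem_piFinset]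
    intro i
    refine Fin.lastCases ?_ (fun i => ?_) i
    · simpa using hp.2
    · simpa using hp.1 i
  · intro v _
    simp
  · intro p _
    simp
  · intro v _
    simp

theorem sum_pmPaths_eq_iterate (a b : ℂ) (E φ : ℤ → ℂ) (k : ℕ) :
    (∑ v ∈ Fintype.piFinset fun _ : Fin k => ({-1, 1} : Finset ℤ),
      (∏ i, qCoef a b (v i)) * (∏ s ∈ Finset.Icc 1 k, E (zpsum v s)) * φ (∑ i, v i)) =
    (iterStep a b E)^[k] φ 0 := by
  induction k generalizing φ with
  | zero => simp
  | succ k ih => rw [sum_pmPaths_succ, ih, Function.iterate_succ_apply]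

end Paths

/-- The inverse of the diagonal part `λ − (2π(n−j)+t)²`, set to zero at `j = 0`. -/
noncomputable def diagInv (n : ℤ) (t : ℝ) (lam : ℂ) (j : ℤ) : ℂ :=
  if j = 0 then 0 else (lam - ((2 * Real.pi * ((n : ℝ) - (j : ℝ)) + t : ℝ) : ℂ) ^ 2)⁻¹

theorem aCoef_eq_iterate (a b : ℂ) (n : ℤ) (k : ℕ) (t : ℝ) (lam : ℂ) :
    aCoef a b n k t lam =
      (iterStep a b (diagInv n t lam))^[k] (fun j => qCoef a b (-j)) 0 := by
  rw [← sum_pmPaths_eq_iterate, aCoef, pmTuples, Finset.sum_filter]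
  refine Finset.sum_congr rfl fun v _ => ?_
  split_ifs with h
  · rw [div_eq_mul_inv, ← Finset.prod_inv_distrib]
    rw [mul_right_comm]
    congr 2
    refine Finset.prod_congr rfl fun s hs => ?_
    rw [diagInv, if_neg (h s hs)]
  · push Not at h
    obtain ⟨s, hs, h0⟩ := h
    rw [Finset.prod_eq_zero hs (by rw [diagInv, if_pos h0])]
    simp

theorem iterate_iterStep_eq_zero (a b : ℂ) (E : ℤ → ℂ) (k : ℕ) (j : ℤ) (h : Even (k + j)) :
    (iterStep a b E)^[k] (fun j => qCoef a b (-j)) j = 0 := by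
  induction k generalizing j with
  | zero =>
    have : Even j := by simpa using h
    have h1 : -j ≠ -1 := by rintro h; obtain ⟨r, hr⟩ := this; omega
    have h2 : -j ≠ 1 := by rintro h; obtain ⟨r, hr⟩ := this; omega
    simp only [Function.iterate_zero, id, qCoef, if_neg h1, if_neg h2]
  | succ k ih =>
    obtain ⟨r, hr⟩ := h
    push_cast at hr
    rw [Function.iterate_succ_apply', iterStep, neighborSum, ih (j - 1) ⟨r - 1, by omega⟩,
      ih (j + 1) ⟨r, by omega⟩]
    simp

section Neumann

variable {a b : ℂ} {E : ℤ → ℂ}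

theorem norm_iterStep_le {φ : ℤ → ℂ} {B : ℝ} (hE : ∀ j, (‖a‖ + ‖b‖) * ‖E j‖ ≤ 1 / 2)
    (hφ : ∀ j, ‖φ j‖ ≤ B) (j : ℤ) : ‖iterStep a b E φ j‖ ≤ 1 / 2 * B := by
  have hB : 0 ≤ B := (norm_nonneg _).trans (hφ 0)
  have h : ∀ i, (‖a‖ + ‖b‖) * ‖E i * φ i‖ ≤ 1 / 2 * B := fun i => by
    rw [norm_mul, ← mul_assoc]
    exact mul_le_mul (hE i) (hφ i) (norm_nonneg _) (by norm_num)
  refine (norm_add_le _ _).trans ?_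
  rw [norm_mul a, norm_mul b]
  rcases le_total ‖E (j - 1) * φ (j - 1)‖ ‖E (j + 1) * φ (j + 1)‖ with h' | h'
  · refine le_trans ?_ (h (j + 1))
    rw [add_mul]
    exact add_le_add (mul_le_mul_of_nonneg_left h' (norm_nonneg _))
      (mul_le_mul_of_nonneg_left le_rfl (norm_nonneg _))
  · refine le_trans ?_ (h (j - 1))
    rw [add_mul]
    exact add_le_add (mul_le_mul_of_nonneg_left le_rfl (norm_nonneg _))
      (mul_le_mul_of_nonneg_left h' (norm_nonneg _))

theorem norm_iterate_iterStep_le {φ : ℤ → ℂ} {B : ℝ} (hE : ∀ j, (‖a‖ + ‖b‖) * ‖E j‖ ≤ 1 / 2)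
    (hφ : ∀ j, ‖φ j‖ ≤ B) (k : ℕ) (j : ℤ) :
    ‖(iterStep a b E)^[k] φ j‖ ≤ (1 / 2) ^ k * B := by
  induction k generalizing j with
  | zero => simpa using hφ j
  | succ k ih =>
    rw [Function.iterate_succ_apply', pow_succ', mul_assoc]
    exact norm_iterStep_le hE ih j

theorem summable_norm_iterate_iterStep {φ : ℤ → ℂ} {B : ℝ}
    (hE : ∀ j, (‖a‖ + ‖b‖) * ‖E j‖ ≤ 1 / 2) (hφ : ∀ j, ‖φ j‖ ≤ B) (j : ℤ) :
    Summable fun k => ‖(iterStep a b E)^[k] φ j‖ :=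
  .of_nonneg_of_le (fun _ => norm_nonneg _) (fun k => norm_iterate_iterStep_le hE hφ k j)
    (summable_geometric_two.mul_right B)

theorem norm_tsum_iterate_iterStep_le {φ : ℤ → ℂ} {B : ℝ}
    (hE : ∀ j, (‖a‖ + ‖b‖) * ‖E j‖ ≤ 1 / 2) (hφ : ∀ j, ‖φ j‖ ≤ B) (j : ℤ) :
    ‖∑' k, (iterStep a b E)^[k] φ j‖ ≤ 2 * B :=
  tsum_of_norm_bounded (hasSum_geometric_two.mul_right B)
    fun k => norm_iterate_iterStep_le hE hφ k j

theorem tsum_iterate_iterStep_eq {φ : ℤ → ℂ} {B : ℝ}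
    (hE : ∀ j, (‖a‖ + ‖b‖) * ‖E j‖ ≤ 1 / 2) (hφ : ∀ j, ‖φ j‖ ≤ B) (j : ℤ) :
    ∑' k, (iterStep a b E)^[k] φ j =
      φ j + iterStep a b E (fun i => ∑' k, (iterStep a b E)^[k] φ i) j := by
  have hs := fun i => (summable_norm_iterate_iterStep hE hφ i).of_norm
  rw [(hs j).tsum_eq_zero_add]
  congr 1
  simp only [Function.iterate_succ_apply']
  simp only [iterStep, neighborSum, ← tsum_mul_left]
  exact Summable.tsum_add (((hs _).mul_left _).mul_left _) (((hs _).mul_left _).mul_left _)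

theorem eq_zero_of_iterStep_fixed {φ : ℤ → ℂ} {B : ℝ}
    (hE : ∀ j, (‖a‖ + ‖b‖) * ‖E j‖ ≤ 1 / 2) (hφ : ∀ j, ‖φ j‖ ≤ B)
    (hfix : iterStep a b E φ = φ) : φ = 0 := by
  ext j
  have h : ∀ k : ℕ, ‖φ j‖ ≤ (1 / 2) ^ k * B := fun k => by
    simpa only [Function.iterate_fixed hfix k] using norm_iterate_iterStep_le hE hφ k j
  have hlim : Filter.Tendsto (fun k : ℕ => (1 / 2 : ℝ) ^ k * B) Filter.atTop (nhds 0) := by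
    simpa using (tendsto_pow_atTop_nhds_zero_of_lt_one (by norm_num : (0 : ℝ) ≤ 1 / 2)
      (by norm_num)).mul_const B
  exact norm_le_zero_iff.1 (ge_of_tendsto' hlim h)

/-- A bounded solution `u` of `D u = Q u` is determined by `u 0`. -/
theorem neighborSum_eq_mul_tsum {D u : ℤ → ℂ} {B C : ℝ}
    (hE : ∀ j, (‖a‖ + ‖b‖) * ‖E j‖ ≤ 1 / 2) (hE0 : E 0 = 0) (hED : ∀ j ≠ 0, E j * D j = 1)
    (hC : ∀ j, ‖qCoef a b (-j)‖ ≤ C)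
    (hu : ∀ j, ‖u j‖ ≤ B) (hDu : ∀ j, D j * u j = neighborSum a b u j) (j : ℤ) :
    neighborSum a b u j =
      u 0 * ∑' k, (iterStep a b E)^[k] (fun j => qCoef a b (-j)) j := by
  set h : ℤ → ℂ := fun j => ∑' k, (iterStep a b E)^[k] (fun j => qCoef a b (-j)) j
  have hu' : ∀ j, u j = u 0 * (Pi.single 0 1 : ℤ → ℂ) j + E j * neighborSum a b u j := by
    intro j
    by_cases hj : j = 0
    · subst hj; simp [hE0]
    · rw [Pi.single_eq_of_ne hj, ← hDu, ← mul_assoc, hED j hj]; simp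
  have hw : ∀ j, neighborSum a b u j = u 0 * qCoef a b (-j) +
      iterStep a b E (neighborSum a b u) j := by
    intro j
    rw [qCoef_neg_eq_neighborSum]
    conv_lhs => rw [neighborSum, hu' (j - 1), hu' (j + 1)]
    simp only [iterStep]
    simp only [neighborSum]
    ring
  have hzero : (fun j => neighborSum a b u j - u 0 * h j) = 0 := by
    refine eq_zero_of_iterStep_fixed (B := (‖a‖ + ‖b‖) * B + ‖u 0‖ * (2 * C)) hE ?_ ?_
    · intro j
      refine (norm_sub_le _ _).trans (add_le_add (norm_neighborSum_le hu j) ?_)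
      rw [norm_mul]
      gcongr
      exact norm_tsum_iterate_iterStep_le hE hC j
    · ext j
      have h1 := hw j
      have h2 : h j = qCoef a b (-j) + iterStep a b E h j := tsum_iterate_iterStep_eq hE hC j
      rw [h1, h2]
      simp only [iterStep]
      simp only [neighborSum]
      ring
  exact sub_eq_zero.1 (congrFun hzero j)

end Neumann

section Bloch

/-- The Bloch frequency `2π(n−j)+t`. -/
noncomputable def blochFreq (n : ℤ) (t : ℝ) (j : ℤ) : ℝ := 2 * Real.pi * ((n : ℝ) - (j : ℝ)) + t

/-- The Bloch wave `exp(i(2π(n−j)+t)x)`. -/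
noncomputable def blochWave (n : ℤ) (t : ℝ) (j : ℤ) (x : ℝ) : ℂ :=
  Complex.exp (Complex.I * blochFreq n t j * x)

theorem norm_blochWave (n : ℤ) (t : ℝ) (j : ℤ) (x : ℝ) : ‖blochWave n t j x‖ = 1 := by
  rw [blochWave, show Complex.I * (blochFreq n t j : ℂ) * x =
    ((blochFreq n t j * x : ℝ) : ℂ) * Complex.I by push_cast; ring]
  exact Complex.norm_exp_ofReal_mul_I _

theorem hasDerivAt_blochWave (n : ℤ) (t : ℝ) (j : ℤ) (x : ℝ) :
    HasDerivAt (blochWave n t j) (Complex.I * blochFreq n t j * blochWave n t j x) x := by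
  have h : HasDerivAt (fun x : ℝ => Complex.I * blochFreq n t j * (x : ℂ))
      (Complex.I * blochFreq n t j) x := by
    simpa using (Complex.ofRealCLM.hasDerivAt (x := x)).const_mul (Complex.I * blochFreq n t j)
  unfold blochWave
  simpa [mul_comm] using h.cexp

theorem continuous_blochWave (n : ℤ) (t : ℝ) (j : ℤ) : Continuous (blochWave n t j) :=
  continuous_iff_continuousAt.2 fun x => (hasDerivAt_blochWave n t j x).continuousAt

theorem blochWave_zero (n : ℤ) (t : ℝ) (j : ℤ) : blochWave n t j 0 = 1 := by
  simp [blochWave]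

theorem blochWave_one (n : ℤ) (t : ℝ) (j : ℤ) :
    blochWave n t j 1 = Complex.exp (Complex.I * t) := by
  rw [blochWave, blochFreq, show Complex.I * ((2 * Real.pi * ((n : ℝ) - (j : ℝ)) + t : ℝ) : ℂ) *
    ((1 : ℝ) : ℂ) = Complex.I * t + ((n - j : ℤ) : ℂ) * (2 * Real.pi * Complex.I) by
      push_cast; ring, Complex.exp_add, Complex.exp_int_mul_two_pi_mul_I, mul_one]

theorem exp_neg_mul_blochWave (n : ℤ) (t : ℝ) (j : ℤ) (x : ℝ) :
    Complex.exp (-(2 * Real.pi * Complex.I) * (x : ℂ)) * blochWave n t j x =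
      blochWave n t (j + 1) x := by
  rw [blochWave, blochWave, blochFreq, blochFreq, ← Complex.exp_add]
  congr 1; push_cast; ring

theorem exp_mul_blochWave (n : ℤ) (t : ℝ) (j : ℤ) (x : ℝ) :
    Complex.exp (2 * Real.pi * Complex.I * (x : ℂ)) * blochWave n t j x =
      blochWave n t (j - 1) x := by
  rw [blochWave, blochWave, blochFreq, blochFreq, ← Complex.exp_add]
  congr 1; push_cast; ring

/-- The function with Bloch–Fourier coefficients `u`. -/
noncomputable def blochSum (n : ℤ) (t : ℝ) (u : ℤ → ℂ) (x : ℝ) : ℂ :=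
  ∑' j, u j * blochWave n t j x

variable {n : ℤ} {t : ℝ} {u : ℤ → ℂ}

theorem summable_mul_blochWave (hu : Summable fun j => ‖u j‖) (x : ℝ) :
    Summable fun j => u j * blochWave n t j x :=
  .of_norm (by simpa [norm_blochWave] using hu)

theorem hasDerivAt_blochSum (hu : Summable fun j => ‖u j‖)
    (hu' : Summable fun j => ‖Complex.I * blochFreq n t j * u j‖) (x : ℝ) :
    HasDerivAt (blochSum n t u)
      (blochSum n t (fun j => Complex.I * blochFreq n t j * u j) x) x := by
  refine hasDerivAt_tsum (g := fun j x => u j * blochWave n t j x)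
    (g' := fun j x => Complex.I * blochFreq n t j * u j * blochWave n t j x)
    hu' (fun j x => ?_) (fun j x => ?_) (summable_mul_blochWave hu 0) x
  · refine ((hasDerivAt_blochWave n t j x).const_mul (u j)).congr_deriv ?_
    ring
  · rw [norm_mul, norm_blochWave, mul_one]

theorem continuous_blochSum (hu : Summable fun j => ‖u j‖) : Continuous (blochSum n t u) :=
  continuous_tsum (fun j => continuous_const.mul (continuous_blochWave n t j)) hu
    fun j x => by rw [norm_mul, norm_blochWave, mul_one]

theorem blochSum_one (n : ℤ) (t : ℝ) (u : ℤ → ℂ) :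
    blochSum n t u 1 = Complex.exp (Complex.I * t) * blochSum n t u 0 := by
  simp only [blochSum, blochWave_one, blochWave_zero, mul_one]
  rw [tsum_mul_right, mul_comm]

theorem mathieuPot_mul_blochSum (a b : ℂ) (hu : Summable fun j => ‖u j‖) (x : ℝ) :
    mathieuPot a b x * blochSum n t u x = blochSum n t (neighborSum a b u) x := by
  have h1 : Summable fun j => u (j - 1) * blochWave n t j x := by
    refine summable_mul_blochWave (u := fun j => u (j - 1)) ?_ x
    exact (Equiv.subRight (1 : ℤ)).summable_iff (f := fun j => ‖u j‖) |>.2 hu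
  have h2 : Summable fun j => u (j + 1) * blochWave n t j x := by
    refine summable_mul_blochWave (u := fun j => u (j + 1)) ?_ x
    exact (Equiv.addRight (1 : ℤ)).summable_iff (f := fun j => ‖u j‖) |>.2 hu
  have e1 : ∑' j, u (j - 1) * blochWave n t j x =
      Complex.exp (-(2 * Real.pi * Complex.I) * (x : ℂ)) * blochSum n t u x := by
    rw [blochSum, ← tsum_mul_left, ← (Equiv.addRight (1 : ℤ)).tsum_eq]
    refine tsum_congr fun j => ?_
    simp only [Equiv.coe_addRight, add_sub_cancel_right, ← exp_neg_mul_blochWave n t j x]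
    ring
  have e2 : ∑' j, u (j + 1) * blochWave n t j x =
      Complex.exp (2 * Real.pi * Complex.I * (x : ℂ)) * blochSum n t u x := by
    rw [blochSum, ← tsum_mul_left, ← (Equiv.subRight (1 : ℤ)).tsum_eq]
    refine tsum_congr fun j => ?_
    simp only [Equiv.subRight_apply, sub_add_cancel, ← exp_mul_blochWave n t j x]
    ring
  rw [mathieuPot, add_mul, mul_assoc a, mul_assoc b, ← e1, ← e2, ← tsum_mul_left, ← tsum_mul_left,
    ← (h1.mul_left a).tsum_add (h2.mul_left b)]
  refine tsum_congr fun j => ?_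
  simp only [neighborSum]
  ring

/-- The coefficient of `y` along a Bloch wave. -/
noncomputable def blochCoeff (n : ℤ) (t : ℝ) (y : ℝ → ℂ) (j : ℤ) : ℂ :=
  ∫ x in (0 : ℝ)..1, y x * (starRingEnd ℂ) (blochWave n t j x)

theorem conj_blochWave (n : ℤ) (t : ℝ) (j : ℤ) (x : ℝ) :
    (starRingEnd ℂ) (blochWave n t j x) = Complex.exp (-(Complex.I * blochFreq n t j * x)) := by
  rw [blochWave, ← Complex.exp_conj]
  simp

theorem continuous_conj_blochWave (n : ℤ) (t : ℝ) (j : ℤ) :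
    Continuous fun x => (starRingEnd ℂ) (blochWave n t j x) :=
  Complex.continuous_conj.comp (continuous_blochWave n t j)

theorem norm_blochCoeff_le {y : ℝ → ℂ} (j : ℤ) :
    ‖blochCoeff n t y j‖ ≤ ∫ x in (0 : ℝ)..1, ‖y x‖ := by
  refine (intervalIntegral.norm_integral_le_integral_norm zero_le_one).trans_eq ?_
  simp [norm_blochWave]

theorem hasDerivAt_conj_blochWave (n : ℤ) (t : ℝ) (j : ℤ) (x : ℝ) :
    HasDerivAt (fun x => (starRingEnd ℂ) (blochWave n t j x))
      (-(Complex.I * blochFreq n t j * (starRingEnd ℂ) (blochWave n t j x))) x := by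
  refine (hasDerivAt_blochWave n t j x).star.congr_deriv ?_
  rw [← starRingEnd_apply]
  simp

/-- A continuous quasi-periodic function with vanishing Bloch coefficients vanishes. -/
theorem eq_zero_of_blochCoeff_eq_zero {y : ℝ → ℂ} (hy : Continuous y)
    (hbc : y 1 = Complex.exp (Complex.I * t) * y 0) (h0 : ∀ j, blochCoeff n t y j = 0) :
    ∀ x ∈ Set.Icc (0 : ℝ) 1, y x = 0 := by
  set z : ℝ → ℂ := fun x => y x * Complex.exp (-(Complex.I * t * x)) with hz
  have hzc : Continuous z := by fun_prop
  have hz01 : z 0 = z (0 + 1) := by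
    simp only [hz, hbc, zero_add]
    rw [mul_right_comm (Complex.exp _), ← Complex.exp_add]
    simp
  let f : C(AddCircle (1 : ℝ), ℂ) :=
    ⟨AddCircle.liftIco 1 0 z, AddCircle.liftIco_continuous hz01 hzc.continuousOn⟩
  have hf : fourierCoeff (f : AddCircle (1 : ℝ) → ℂ) = 0 := by
    ext k
    change fourierCoeff (AddCircle.liftIco 1 0 z) k = 0
    rw [fourierCoeff_liftIco_eq, fourierCoeffOn_eq_integral]
    have : (∫ x in (0 : ℝ)..0 + 1, (fourier (-k)) (x : AddCircle (0 + 1 - 0 : ℝ)) • z x) =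
        blochCoeff n t y (n - k) := by
      rw [blochCoeff, zero_add]
      refine intervalIntegral.integral_congr fun x _ => ?_
      simp only [fourier_coe_apply, smul_eq_mul, hz, conj_blochWave, blochFreq]
      rw [mul_left_comm, ← Complex.exp_add]
      congr 2
      push_cast
      ring
    rw [this, h0]
    simp
  have hfz : ∀ x, f x = 0 := fun x => by
    have := has_pointwise_sum_fourier_series_of_summable (f := f)
      (by rw [hf]; exact summable_zero) x
    rw [hf] at this
    simpa using this.unique (by simp)
  have hIco : ∀ x ∈ Set.Ico (0 : ℝ) 1, y x = 0 := by
    intro x hx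
    have h1 : AddCircle.liftIco 1 0 z (x : AddCircle (1 : ℝ)) = z x :=
      AddCircle.liftIco_coe_apply (by simpa using hx)
    have h2 : z x = 0 := h1.symm.trans (hfz x)
    exact (mul_eq_zero.1 h2).resolve_right (Complex.exp_ne_zero _)
  intro x hx
  rcases hx.2.lt_or_eq with h | h
  · exact hIco x ⟨hx.1, h⟩
  · rw [h, hbc, hIco 0 (by simp), mul_zero]

/-- The Bloch coefficients of a Bloch eigenfunction solve the recurrence. -/
theorem blochCoeff_recurrence {a b lam : ℂ} {y : ℝ → ℂ} (hy : ContDiff ℝ 2 y)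
    (hode : ∀ x ∈ Set.Icc (0 : ℝ) 1,
      -(deriv (deriv y) x) + mathieuPot a b x * y x = lam * y x)
    (h0 : y 1 = Complex.exp (Complex.I * t) * y 0)
    (h1 : deriv y 1 = Complex.exp (Complex.I * t) * deriv y 0) (j : ℤ) :
    (lam - (blochFreq n t j : ℂ) ^ 2) * blochCoeff n t y j =
      neighborSum a b (blochCoeff n t y) j := by
  have hy1 : ContDiff ℝ 1 (deriv y) := (contDiff_succ_iff_deriv.1 hy).2.2
  have hyd : Differentiable ℝ y := hy.differentiable (by norm_num)
  have hyd' : Differentiable ℝ (deriv y) := hy1.differentiable (by norm_num)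
  have hc := hy.continuous
  have hc2 : Continuous (deriv (deriv y)) := hy1.continuous_deriv (by norm_num)
  set e : ℝ → ℂ := fun x => (starRingEnd ℂ) (blochWave n t j x) with he
  set ω : ℂ := (blochFreq n t j : ℂ)
  have hec : Continuous e := continuous_conj_blochWave n t j
  have hed : ∀ x, HasDerivAt e (-(Complex.I * ω * e x)) x := hasDerivAt_conj_blochWave n t j
  have hF : ∀ x, HasDerivAt (fun x => deriv y x * e x + Complex.I * ω * (y x * e x))
      (deriv (deriv y) x * e x + ω ^ 2 * (y x * e x)) x := by
    intro x
    have := ((hyd' x).hasDerivAt.mul (hed x)).add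
      (((hyd x).hasDerivAt.mul (hed x)).const_mul (Complex.I * ω))
    refine this.congr_deriv ?_
    linear_combination (-(ω ^ 2 * (y x * e x))) * Complex.I_sq
  have hint := intervalIntegral.integral_eq_sub_of_hasDerivAt (a := 0) (b := 1)
    (fun x _ => hF x) (Continuous.intervalIntegrable (by fun_prop) _ _)
  have hee : Complex.exp (Complex.I * t) * e 1 = e 0 := by
    simp only [he, blochWave_one, blochWave_zero, map_one, Complex.mul_conj]
    rw [mul_comm, Complex.normSq_eq_norm_sq, Complex.norm_exp_ofReal_mul_I]
    simp
  have hbd : deriv y 1 * e 1 + Complex.I * ω * (y 1 * e 1) -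
      (deriv y 0 * e 0 + Complex.I * ω * (y 0 * e 0)) = 0 := by
    rw [h0, h1, ← hee]; ring
  rw [hbd] at hint
  have hV : ∀ x, mathieuPot a b x * e x = a * (starRingEnd ℂ) (blochWave n t (j - 1) x) +
      b * (starRingEnd ℂ) (blochWave n t (j + 1) x) := by
    intro x
    simp only [mathieuPot, he, conj_blochWave, add_mul, mul_assoc, blochFreq]
    simp only [← mul_assoc, ← Complex.exp_add]
    congr 3 <;> (push_cast; ring)
  have hcongr : (∫ x in (0 : ℝ)..1, (deriv (deriv y) x * e x + ω ^ 2 * (y x * e x))) =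
      ∫ x in (0 : ℝ)..1, (a * (y x * (starRingEnd ℂ) (blochWave n t (j - 1) x)) +
        b * (y x * (starRingEnd ℂ) (blochWave n t (j + 1) x)) - (lam - ω ^ 2) * (y x * e x)) := by
    refine intervalIntegral.integral_congr fun x hx => ?_
    rw [Set.uIcc_of_le zero_le_one] at hx
    linear_combination (-e x) * hode x hx + y x * hV x
  have c1 := continuous_conj_blochWave n t (j - 1)
  have c2 := continuous_conj_blochWave n t (j + 1)
  rw [hcongr, intervalIntegral.integral_sub, intervalIntegral.integral_add,
    intervalIntegral.integral_const_mul, intervalIntegral.integral_const_mul,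
    intervalIntegral.integral_const_mul] at hint
  · exact (sub_eq_zero.1 hint).symm
  all_goals exact Continuous.intervalIntegrable (by fun_prop) _ _

theorem integral_blochWave_mul_conj (n : ℤ) (t : ℝ) (j k : ℤ) :
    ∫ x in (0 : ℝ)..1, blochWave n t j x * (starRingEnd ℂ) (blochWave n t k x) =
      if j = k then 1 else 0 := by
  have h : ∀ x : ℝ, blochWave n t j x * (starRingEnd ℂ) (blochWave n t k x) =
      Complex.exp (((k - j : ℤ) : ℂ) * (2 * Real.pi * Complex.I) * x) := by
    intro x
    rw [conj_blochWave, blochWave, ← Complex.exp_add]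
    congr 1
    simp only [blochFreq]
    push_cast
    ring
  simp only [h]
  split_ifs with hjk
  · simp [hjk]
  · have hc : ((k - j : ℤ) : ℂ) * (2 * Real.pi * Complex.I) ≠ 0 :=
      mul_ne_zero (Int.cast_ne_zero.2 (by omega)) Complex.two_pi_I_ne_zero
    rw [integral_exp_mul_complex hc]
    simp only [Complex.ofReal_one, Complex.ofReal_zero, mul_one, mul_zero, Complex.exp_zero,
      Complex.exp_int_mul_two_pi_mul_I, sub_self, zero_div]

theorem blochCoeff_blochSum (hu : Summable fun j => ‖u j‖) (k : ℤ) :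
    blochCoeff n t (blochSum n t u) k = u k := by
  have hF : ∀ x, HasSum (fun j => u j * (blochWave n t j x * (starRingEnd ℂ) (blochWave n t k x)))
      (blochSum n t u x * (starRingEnd ℂ) (blochWave n t k x)) := by
    intro x
    simp only [← mul_assoc]
    exact (summable_mul_blochWave hu x).hasSum.mul_right _
  have hsum := intervalIntegral.hasSum_integral_of_dominated_convergence
    (μ := MeasureTheory.volume) (a := 0) (b := 1)
    (F := fun j x => u j * (blochWave n t j x * (starRingEnd ℂ) (blochWave n t k x)))
    (fun j _ => ‖u j‖)
    (fun j => (continuous_const.mul ((continuous_blochWave n t j).mul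
      (continuous_conj_blochWave n t k))).aestronglyMeasurable)
    (fun j => .of_forall fun x _ => by simp [norm_blochWave])
    (.of_forall fun x _ => hu) intervalIntegrable_const
    (.of_forall fun x _ => hF x)
  simp only [intervalIntegral.integral_const_mul, integral_blochWave_mul_conj] at hsum
  have h2 : HasSum (fun j => u j * if j = k then 1 else 0) (u k) := by
    simpa using hasSum_ite_eq k (u k) |>.congr_fun fun j => by split_ifs with h <;> simp [h]
  exact hsum.unique h2

/-- A sufficiently summable solution of the recurrence yields a Bloch eigenfunction. -/
theorem isEigenvalueH_of_recurrence {a b lam : ℂ} (hu : Summable fun j => ‖u j‖) (h0 : u 0 ≠ 0)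
    (hu1 : Summable fun j => ‖Complex.I * blochFreq n t j * u j‖)
    (hu2 : Summable fun j => ‖Complex.I * blochFreq n t j * (Complex.I * blochFreq n t j * u j)‖)
    (hrec : ∀ j, (lam - (blochFreq n t j : ℂ) ^ 2) * u j = neighborSum a b u j) :
    IsEigenvalueH a b t lam := by
  have hd1 : deriv (blochSum n t u) = blochSum n t (fun j => Complex.I * blochFreq n t j * u j) :=
    funext fun x => (hasDerivAt_blochSum hu hu1 x).deriv
  have hd2 : deriv (deriv (blochSum n t u)) = blochSum n t
      (fun j => Complex.I * blochFreq n t j * (Complex.I * blochFreq n t j * u j)) := by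
    rw [hd1]
    exact funext fun x => (hasDerivAt_blochSum hu1 hu2 x).deriv
  refine ⟨blochSum n t u, ?_, fun hzero => h0 ?_, fun x _ => ?_, blochSum_one n t u, ?_⟩
  · refine contDiff_succ_iff_deriv (n := 1).2
      ⟨fun x => (hasDerivAt_blochSum hu hu1 x).differentiableAt, by simp, ?_⟩
    refine contDiff_one_iff_deriv.2 ⟨?_, ?_⟩
    · rw [hd1]
      exact fun x => (hasDerivAt_blochSum hu1 hu2 x).differentiableAt
    · rw [hd2]
      exact continuous_blochSum hu2
  · rw [← blochCoeff_blochSum (n := n) (t := t) hu 0, blochCoeff]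
    refine (intervalIntegral.integral_congr fun x hx => ?_).trans intervalIntegral.integral_zero
    rw [Set.uIcc_of_le zero_le_one] at hx
    simp only [hzero x hx, zero_mul]
  · rw [hd2, mathieuPot_mul_blochSum a b hu, blochSum, blochSum, blochSum, ← tsum_mul_left,
      neg_add_eq_iff_eq_add,
      ← (summable_mul_blochWave hu2 x).tsum_add ((summable_mul_blochWave hu x).mul_left lam)]
    refine tsum_congr fun j => ?_
    rw [← hrec j]
    linear_combination (-((blochFreq n t j : ℂ) ^ 2 * u j * blochWave n t j x)) * Complex.I_sq
  · rw [hd1]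
    exact blochSum_one n t _

end Bloch

section Estimates

variable {n : ℤ} {t ρ : ℝ} {lam : ℂ}

theorem diag_eq (n : ℤ) (t : ℝ) (lam : ℂ) (j : ℤ) :
    lam - (blochFreq n t j : ℂ) ^ 2 = (lam - ((2 * Real.pi * n + t : ℝ) : ℂ) ^ 2) +
      ((4 * Real.pi * j * (Real.pi * ((2 * n - j : ℤ) : ℝ) + t) : ℝ) : ℂ) := by
  rw [blochFreq]
  push_cast
  ring

theorem le_norm_diag (hlam : ‖lam - ((2 * Real.pi * n + t : ℝ) : ℂ) ^ 2‖ ≤ 1) (j : ℤ) :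
    4 * Real.pi * |(j : ℝ)| * |Real.pi * ((2 * n - j : ℤ) : ℝ) + t| - 1 ≤
      ‖lam - (blochFreq n t j : ℂ) ^ 2‖ := by
  rw [diag_eq]
  set z := lam - ((2 * Real.pi * n + t : ℝ) : ℂ) ^ 2
  set r : ℝ := 4 * Real.pi * j * (Real.pi * ((2 * n - j : ℤ) : ℝ) + t) with hr
  have h1 : ‖(r : ℂ)‖ = 4 * Real.pi * |(j : ℝ)| * |Real.pi * ((2 * n - j : ℤ) : ℝ) + t| := by
    rw [Complex.norm_real, hr, Real.norm_eq_abs, abs_mul, abs_mul, abs_mul,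
      abs_of_pos Real.pi_pos, abs_of_pos (by norm_num : (0 : ℝ) < 4)]
  rw [← h1]
  have h2 := norm_sub_norm_le (r : ℂ) (-z)
  rw [norm_neg, sub_neg_eq_add, add_comm (r : ℂ)] at h2
  linarith

theorem le_abs_pi_mul_add (ht : t ∈ Set.Icc ρ (Real.pi - ρ)) (m : ℤ) :
    ρ ≤ |Real.pi * m + t| := by
  have hpi := Real.pi_pos
  rcases le_or_gt 0 m with h | h
  · have : (0 : ℝ) ≤ m := by exact_mod_cast h
    exact le_abs.2 (.inl (by nlinarith [ht.1, mul_nonneg hpi.le this]))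
  · have : (m : ℝ) ≤ -1 := by exact_mod_cast (by omega : m ≤ -1)
    exact le_abs.2 (.inr (by nlinarith [ht.2]))

theorem pi_mul_sub_le_abs (hρ : 0 < ρ) (ht : t ∈ Set.Icc ρ (Real.pi - ρ)) (m : ℤ) :
    Real.pi * (|(m : ℝ)| - 1) ≤ |Real.pi * m + t| := by
  have h := abs_sub_abs_le_abs_sub (Real.pi * m) (-t)
  rw [abs_mul, abs_of_pos Real.pi_pos, abs_neg, sub_neg_eq_add,
    abs_of_pos (hρ.trans_le ht.1)] at h
  linarith [ht.2]

theorem le_norm_diag_of_ne_zero {N : ℕ} (hρ : ρ ∈ Set.Ioo 0 (Real.pi / 2))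
    (ht : t ∈ Set.Icc ρ (Real.pi - ρ)) (hn : (N : ℤ) < |n|)
    (hlam : ‖lam - ((2 * Real.pi * n + t : ℝ) : ℂ) ^ 2‖ ≤ 1) {j : ℤ} (hj : j ≠ 0) :
    12 * ρ * N - 1 ≤ ‖lam - (blochFreq n t j : ℂ) ^ 2‖ := by
  refine le_trans ?_ (le_norm_diag hlam j)
  have hpi := Real.pi_gt_three
  have hN : (0 : ℝ) ≤ N := N.cast_nonneg
  have hj1 : (1 : ℝ) ≤ |(j : ℝ)| := by exact_mod_cast Int.one_le_abs hj
  have key : ρ * N ≤ |(j : ℝ)| * |Real.pi * ((2 * n - j : ℤ) : ℝ) + t| := by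
    rcases le_or_gt (N : ℤ) |j| with h | h
    · have h' : (N : ℝ) ≤ |(j : ℝ)| := by exact_mod_cast h
      rw [mul_comm]
      exact mul_le_mul h' (le_abs_pi_mul_add ht _) hρ.1.le (abs_nonneg _)
    · have h' : (N : ℝ) ≤ |((2 * n - j : ℤ) : ℝ)| - 1 := by
        have : (N : ℤ) + 1 ≤ |2 * n - j| := by
          rcases abs_cases n with h1 | h1 <;> rcases abs_cases j with h2 | h2 <;>
            rcases abs_cases (2 * n - j) with h3 | h3 <;> omega
        have : (N : ℝ) + 1 ≤ |((2 * n - j : ℤ) : ℝ)| := by exact_mod_cast this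
        linarith
      have h2 : ρ * N ≤ |Real.pi * ((2 * n - j : ℤ) : ℝ) + t| :=
        le_trans (mul_le_mul (by linarith [hρ.2]) h' hN (by linarith))
          (pi_mul_sub_le_abs hρ.1 ht _)
      exact h2.trans (le_mul_of_one_le_left (abs_nonneg _) hj1)
  have h0 : 0 ≤ ρ * N := mul_nonneg hρ.1.le hN
  nlinarith

theorem summable_norm_inv_diag (hρ : 0 < ρ) (ht : t ∈ Set.Icc ρ (Real.pi - ρ))
    (hlam : ‖lam - ((2 * Real.pi * n + t : ℝ) : ℂ) ^ 2‖ ≤ 1) :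
    Summable fun j : ℤ => ‖(lam - (blochFreq n t j : ℂ) ^ 2)⁻¹‖ := by
  refine Summable.of_norm_bounded_eventually (Real.summable_one_div_int_pow.2 one_lt_two) ?_
  have hfin : {j : ℤ | |j| < 4 * |n| + 4}.Finite :=
    (Set.finite_Ioo (-(4 * |n| + 4)) (4 * |n| + 4)).subset fun j hj => abs_lt.1 hj
  filter_upwards [hfin.compl_mem_cofinite] with j hj
  have hj' : 4 * |n| + 4 ≤ |j| := not_lt.1 hj
  have hjr : 4 * |(n : ℝ)| + 4 ≤ |(j : ℝ)| := by exact_mod_cast hj'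
  have hn := abs_nonneg (n : ℝ)
  have hpi := Real.pi_gt_three
  have h1 : |(j : ℝ)| - 2 * |(n : ℝ)| ≤ |((2 * n - j : ℤ) : ℝ)| := by
    have := abs_sub_abs_le_abs_sub (j : ℝ) (2 * n)
    rw [abs_mul, abs_of_pos (by norm_num : (0 : ℝ) < 2), abs_sub_comm] at this
    push_cast
    exact this
  have h2 : |(j : ℝ)| ≤ |Real.pi * ((2 * n - j : ℤ) : ℝ) + t| := by
    refine le_trans ?_ (pi_mul_sub_le_abs hρ ht _)
    nlinarith
  have h3 := le_norm_diag hlam j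
  have h4 : (j : ℝ) ^ 2 ≤ ‖lam - (blochFreq n t j : ℂ) ^ 2‖ := by
    rw [← sq_abs]
    have h5 : |(j : ℝ)| * |(j : ℝ)| ≤
        |(j : ℝ)| * |Real.pi * ((2 * n - j : ℤ) : ℝ) + t| := by gcongr
    nlinarith
  rw [norm_norm, norm_inv, one_div]
  exact inv_anti₀ (by rw [← sq_abs]; apply pow_pos; linarith) h4

end Estimates

/-- A summable solution of the recurrence stays summable after two differentiations. -/
theorem summable_of_recurrence {a b lam : ℂ} {n : ℤ} {t : ℝ} {u : ℤ → ℂ}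
    (hu : Summable fun j => ‖u j‖)
    (hrec : ∀ j, (lam - (blochFreq n t j : ℂ) ^ 2) * u j = neighborSum a b u j) :
    (Summable fun j => ‖Complex.I * blochFreq n t j * u j‖) ∧
      Summable fun j => ‖Complex.I * blochFreq n t j * (Complex.I * blochFreq n t j * u j)‖ := by
  have hm : Summable fun j => ‖u (j - 1)‖ :=
    (Equiv.subRight (1 : ℤ)).summable_iff (f := fun j => ‖u j‖) |>.2 hu
  have hp : Summable fun j => ‖u (j + 1)‖ :=
    (Equiv.addRight (1 : ℤ)).summable_iff (f := fun j => ‖u j‖) |>.2 hu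
  have h2 : Summable fun j =>
      ‖Complex.I * blochFreq n t j * (Complex.I * blochFreq n t j * u j)‖ := by
    refine .of_nonneg_of_le (fun _ => norm_nonneg _) (fun j => ?_)
      ((hu.mul_left ‖lam‖).add ((hm.mul_left ‖a‖).add (hp.mul_left ‖b‖)))
    have : Complex.I * blochFreq n t j * (Complex.I * blochFreq n t j * u j) =
        neighborSum a b u j - lam * u j := by
      rw [← hrec j]
      linear_combination (blochFreq n t j : ℂ) ^ 2 * u j * Complex.I_sq
    rw [this, neighborSum]
    refine (norm_sub_le _ _).trans ?_
    rw [add_comm, norm_mul lam, ← norm_mul a, ← norm_mul b]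
    gcongr
    exact norm_add_le _ _
  refine ⟨.of_nonneg_of_le (fun _ => norm_nonneg _) (fun j => ?_) (hu.add h2), h2⟩
  simp only [norm_mul, Complex.norm_I, one_mul, Complex.norm_real]
  have h0 := norm_nonneg (u j)
  nlinarith [sq_nonneg (‖blochFreq n t j‖ - 1), mul_nonneg (sq_nonneg (‖blochFreq n t j‖ - 1)) h0,
    mul_nonneg (sq_nonneg ‖blochFreq n t j‖) h0]

/-- If the off-diagonal part dominates the potential, the eigenvalue condition reduces to one
scalar equation. -/
theorem isEigenvalueH_iff_eq_tsum {a b lam : ℂ} {n : ℤ} {t : ℝ}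
    (hE : ∀ j, (‖a‖ + ‖b‖) * ‖diagInv n t lam j‖ ≤ 1 / 2)
    (hD : ∀ j ≠ 0, lam - (blochFreq n t j : ℂ) ^ 2 ≠ 0)
    (hs : Summable fun j => ‖(lam - (blochFreq n t j : ℂ) ^ 2)⁻¹‖) :
    IsEigenvalueH a b t lam ↔ lam - (blochFreq n t 0 : ℂ) ^ 2 =
      ∑' k, (iterStep a b (diagInv n t lam))^[k] (fun j => qCoef a b (-j)) 0 := by
  have hC : ∀ j, ‖qCoef a b (-j)‖ ≤ (‖a‖ + ‖b‖) * 1 := fun j => by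
    rw [qCoef_neg_eq_neighborSum]
    refine norm_neighborSum_le (fun i => ?_) j
    by_cases hi : i = 0
    · subst hi; simp
    · simp [Pi.single_eq_of_ne hi]
  have hE0 : diagInv n t lam 0 = 0 := if_pos rfl
  have hEne : ∀ j ≠ 0, diagInv n t lam j = (lam - (blochFreq n t j : ℂ) ^ 2)⁻¹ :=
    fun j hj => if_neg hj
  set E := diagInv n t lam
  set h : ℤ → ℂ := fun j => ∑' k, (iterStep a b E)^[k] (fun j => qCoef a b (-j)) j
  constructor
  · rintro ⟨y, hy, hne, hode, h0, h1⟩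
    have hrec := blochCoeff_recurrence (n := n) hy hode h0 h1
    have hw := neighborSum_eq_mul_tsum (D := fun j => lam - (blochFreq n t j : ℂ) ^ 2) hE hE0
      (fun j hj => by rw [hEne j hj, inv_mul_cancel₀ (hD j hj)]) hC norm_blochCoeff_le hrec
    have hc0 : blochCoeff n t y 0 ≠ 0 := by
      intro hc0
      refine hne (eq_zero_of_blochCoeff_eq_zero (n := n) hy.continuous h0 fun j => ?_)
      by_cases hj : j = 0
      · rw [hj, hc0]
      · have := hrec j
        rw [hw j, hc0, zero_mul] at this
        exact (mul_eq_zero.1 this).resolve_left (hD j hj)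
    have := hrec 0
    rw [hw 0, mul_comm] at this
    exact mul_left_cancel₀ hc0 this
  · intro heq
    set u : ℤ → ℂ := fun j => (Pi.single 0 1 : ℤ → ℂ) j + E j * h j with hu
    have hu0 : u 0 = 1 := by simp [hu, hE0]
    have hQ : ∀ j, neighborSum a b u j = h j := by
      intro j
      have h2 : h j = qCoef a b (-j) + iterStep a b E h j := tsum_iterate_iterStep_eq hE hC j
      rw [h2, qCoef_neg_eq_neighborSum]
      simp only [iterStep]
      simp only [neighborSum, hu]
      ring
    have hrec : ∀ j, (lam - (blochFreq n t j : ℂ) ^ 2) * u j = neighborSum a b u j := by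
      intro j
      rw [hQ]
      by_cases hj : j = 0
      · rw [hj, hu0, mul_one, heq]
      · simp only [hu]
        rw [Pi.single_eq_of_ne hj, zero_add, hEne j hj, mul_inv_cancel_left₀ (hD j hj)]
    have hsum : Summable fun j => ‖u j‖ := by
      refine Summable.of_norm_bounded_eventually (hs.mul_right (2 * ((‖a‖ + ‖b‖) * 1))) ?_
      filter_upwards [(Set.finite_singleton (0 : ℤ)).compl_mem_cofinite] with j hj
      have hj : j ≠ 0 := hj
      simp only [hu]
      rw [norm_norm, Pi.single_eq_of_ne hj, zero_add, hEne j hj, norm_mul]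
      gcongr
      exact norm_tsum_iterate_iterStep_le hE hC j
    obtain ⟨hs1, hs2⟩ := summable_of_recurrence hsum hrec
    exact isEigenvalueH_of_recurrence hsum (by rw [hu0]; exact one_ne_zero) hs1 hs2 hrec

theorem eigenvalue_characterization_by_series (a b : ℂ) (ρ : ℝ)
    (hρ : ρ ∈ Set.Ioo 0 (Real.pi / 2)) :
    ∃ N : ℕ, ∀ t ∈ Set.Icc ρ (Real.pi - ρ), ∀ n : ℤ, (N : ℤ) < |n| →
      ∀ lam : ℂ, ‖lam - (((2 * Real.pi * n + t : ℝ)) : ℂ)^2‖ ≤ 1 →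
        Summable (fun p : ℕ => ‖aCoef a b n (2 * (p + 1) - 1) t lam‖) ∧
        (IsEigenvalueH a b t lam ↔
          lam - (((2 * Real.pi * n + t : ℝ)) : ℂ)^2 =
            ∑' p : ℕ, aCoef a b n (2 * (p + 1) - 1) t lam) := by
  obtain ⟨N, hN⟩ := exists_nat_ge ((2 * (‖a‖ + ‖b‖) + 2) / (12 * ρ))
  refine ⟨N, fun t ht n hn lam hlam => ?_⟩
  have hM : ∀ j ≠ 0, 2 * (‖a‖ + ‖b‖) + 1 ≤ ‖lam - (blochFreq n t j : ℂ) ^ 2‖ := by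
    intro j hj
    rw [div_le_iff₀ (mul_pos (by norm_num) hρ.1)] at hN
    linarith [le_norm_diag_of_ne_zero hρ ht hn hlam hj]
  have hab : 0 ≤ ‖a‖ + ‖b‖ := by positivity
  have hE : ∀ j, (‖a‖ + ‖b‖) * ‖diagInv n t lam j‖ ≤ 1 / 2 := by
    intro j
    by_cases hj : j = 0
    · simp [diagInv, hj]
    · have h1 := hM j hj
      rw [diagInv, if_neg hj, norm_inv, ← div_eq_mul_inv]
      change (‖a‖ + ‖b‖) / ‖lam - (blochFreq n t j : ℂ) ^ 2‖ ≤ 1 / 2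
      rw [div_le_iff₀ (by linarith)]
      linarith
  have hC : ∀ j, ‖qCoef a b (-j)‖ ≤ ‖a‖ + ‖b‖ := by
    intro j
    unfold qCoef
    split_ifs <;> simp [hab]
  have hsum := summable_norm_iterate_iterStep hE hC 0
  have hiff := isEigenvalueH_iff_eq_tsum hE
    (fun j hj => norm_pos_iff.1 (by linarith [hM j hj])) (summable_norm_inv_diag hρ.1 ht hlam)
  have hodd : ∀ p : ℕ, 2 * (p + 1) - 1 = 2 * p + 1 := fun p => by omega
  have hzero : (blochFreq n t 0 : ℝ) = 2 * Real.pi * n + t := by simp [blochFreq]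
  simp only [← aCoef_eq_iterate] at hsum hiff
  have hso : Summable fun p : ℕ => ‖aCoef a b n (2 * p + 1) t lam‖ :=
    hsum.comp_injective (i := fun p : ℕ => 2 * p + 1) fun p q h => by simpa using h
  have heven : ∀ p : ℕ, aCoef a b n (2 * p) t lam = 0 := fun p => by
    rw [aCoef_eq_iterate]
    exact iterate_iterStep_eq_zero _ _ _ _ _ (by simp)
  have htsum := tsum_even_add_odd (f := fun k => aCoef a b n k t lam)
    (by simp only [heven]; exact summable_zero) hso.of_norm
  simp only [heven, tsum_zero, zero_add] at htsum
  simp only [hodd]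
  rw [htsum, ← hzero]
  exact ⟨hso, hiff⟩
end

section
/- Let a, b be complex numbers and ρ ∈ (0, π/2). There exists a natural number N such that for every t ∈ [ρ, π − ρ] and every integer n with |n| > N, there is exactly one complex number λ with |λ − (2πn + t)²| ≤ 1 that is an eigenvalue of H_t(a,b). -/
open Real Complex Set

lemma le_two_mul_of_bootstrap {f : ℤ → ℝ} {θ : ℝ} (hb : ∃ C, ∀ k, f k ≤ C)
    (h : ∀ C, (∀ k, f k ≤ C) → ∀ k, f k ≤ θ + C / 2) (k : ℤ) : f k ≤ 2 * θ := by
  obtain ⟨C, hC⟩ := hb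
  have hbdd : BddAbove (range f) := ⟨C, by rintro _ ⟨k, rfl⟩; exact hC k⟩
  have h1 := h _ (le_ciSup hbdd)
  have h2 := ciSup_le h1
  have h3 := le_ciSup hbdd k
  linarith

/-- `(lam, c)` solves the three-term recurrence satisfied by the Fourier coefficients of an
eigenfunction. -/
def SolvesRecurrence (a b : ℂ) (μ : ℤ → ℂ) (lam : ℂ) (c : ℤ → ℂ) : Prop :=
  ∀ k, (lam - μ k) * c k = a * c (k + 1) + b * c (k - 1)

lemma norm_neighbours_le (a b u v : ℂ) {C : ℝ} (hu : ‖u‖ ≤ C) (hv : ‖v‖ ≤ C) :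
    ‖a * u + b * v‖ ≤ (‖a‖ + ‖b‖) * C := by
  calc ‖a * u + b * v‖ ≤ ‖a * u‖ + ‖b * v‖ := norm_add_le _ _
    _ = ‖a‖ * ‖u‖ + ‖b‖ * ‖v‖ := by rw [norm_mul, norm_mul]
    _ ≤ ‖a‖ * C + ‖b‖ * C := by gcongr
    _ = _ := by ring

section Recurrence

variable {a b : ℂ} {μ : ℤ → ℂ} {n : ℤ} {D : ℝ}

lemma gap_le_norm_sub (hgap : ∀ k ≠ n, D + 1 ≤ ‖μ n - μ k‖) {lam : ℂ}
    (hlam : ‖lam - μ n‖ ≤ 1) {k : ℤ} (hk : k ≠ n) : D ≤ ‖lam - μ k‖ := by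
  have h1 := hgap k hk
  have h2 : ‖μ n - μ k‖ ≤ ‖lam - μ k‖ + ‖lam - μ n‖ := by
    have := norm_sub_le (lam - μ k) (lam - μ n)
    simpa using this
  linarith

lemma gap_mul_norm_le (hgap : ∀ k ≠ n, D + 1 ≤ ‖μ n - μ k‖) {lam z w : ℂ} {B : ℝ}
    (hlam : ‖lam - μ n‖ ≤ 1) {k : ℤ} (hk : k ≠ n) (h : (lam - μ k) * z = w)
    (hw : ‖w‖ ≤ B) : D * ‖z‖ ≤ B := by
  calc D * ‖z‖ ≤ ‖lam - μ k‖ * ‖z‖ := by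
        gcongr; exact gap_le_norm_sub hgap hlam hk
    _ = ‖w‖ := by rw [← norm_mul, h]
    _ ≤ B := hw

lemma SolvesRecurrence.eq_zero (hgap : ∀ k ≠ n, D + 1 ≤ ‖μ n - μ k‖)
    (hD : 4 * (‖a‖ + ‖b‖ + 1) ^ 2 ≤ D) {lam : ℂ} (hlam : ‖lam - μ n‖ ≤ 1) {c : ℤ → ℂ}
    (hc : SolvesRecurrence a b μ lam c) (hb : ∃ C, ∀ k, ‖c k‖ ≤ C) (hn : c n = 0) (k : ℤ) :
    c k = 0 := by
  have ha := norm_nonneg a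
  have hb' := norm_nonneg b
  have key := le_two_mul_of_bootstrap (f := fun k ↦ ‖c k‖) (θ := 0) hb (by
    intro C hC k
    have hC0 : 0 ≤ C := (norm_nonneg _).trans (hC 0)
    by_cases hk : k = n
    · subst hk; simp only [hn, norm_zero]; positivity
    have h1 := gap_mul_norm_le hgap hlam hk (hc k)
      (norm_neighbours_le a b _ _ (hC (k + 1)) (hC (k - 1)))
    have h0 := norm_nonneg (c k)
    show ‖c k‖ ≤ 0 + C / 2
    by_contra! h
    nlinarith [mul_nonneg (add_nonneg ha hb') hC0,
      mul_nonneg (mul_self_nonneg (‖a‖ + ‖b‖)) h0]) k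
  simpa using key

lemma SolvesRecurrence.norm_le (hgap : ∀ k ≠ n, D + 1 ≤ ‖μ n - μ k‖)
    (hD : 4 * (‖a‖ + ‖b‖ + 1) ^ 2 ≤ D) {lam : ℂ} (hlam : ‖lam - μ n‖ ≤ 1) {c : ℤ → ℂ}
    (hc : SolvesRecurrence a b μ lam c) (hb : ∃ C, ∀ k, ‖c k‖ ≤ C) (hn : c n = 1) (k : ℤ) :
    ‖c k‖ ≤ 1 := by
  have ha := norm_nonneg a
  have hb' := norm_nonneg b
  have key := le_two_mul_of_bootstrap (f := fun k ↦ ‖c k‖ - 1) (θ := 0)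
    (hb.imp fun C hC k ↦ by linarith [hC k]) (by
    intro C hC k
    have hC0 : 0 ≤ C := by simpa [hn] using hC n
    by_cases hk : k = n
    · subst hk; simp only [hn, norm_one]; linarith
    have hC' : ∀ k, ‖c k‖ ≤ C + 1 := fun k ↦ by linarith [hC k]
    have h1 := gap_mul_norm_le hgap hlam hk (hc k)
      (norm_neighbours_le a b _ _ (hC' (k + 1)) (hC' (k - 1)))
    have h0 := norm_nonneg (c k)
    show ‖c k‖ - 1 ≤ 0 + C / 2
    by_contra! h
    nlinarith [mul_nonneg (add_nonneg ha hb') hC0,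
      mul_nonneg (mul_self_nonneg (‖a‖ + ‖b‖)) h0]) k
  simpa using key

lemma norm_sub_le_half_of_quotients (hgap : ∀ k ≠ n, D + 1 ≤ ‖μ n - μ k‖)
    (hD : 4 * (‖a‖ + ‖b‖ + 1) ^ 2 ≤ D) {lam lam' : ℂ} (hlam : ‖lam - μ n‖ ≤ 1)
    {c d : ℤ → ℂ} {z w : ℂ} {C : ℝ} (hC : ∀ k, ‖c k - d k‖ ≤ C)
    (h : lam - μ n = a * c (n + 1) + b * c (n - 1))
    (h' : lam' - μ n = a * d (n + 1) + b * d (n - 1)) {k : ℤ} (hk : k ≠ n)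
    (hz : (lam - μ k) * z = a * c (k + 1) + b * c (k - 1))
    (hw : (lam' - μ k) * w = a * d (k + 1) + b * d (k - 1)) (hw1 : ‖w‖ ≤ 1) :
    ‖z - w‖ ≤ C / 2 := by
  have hC0 : 0 ≤ C := (norm_nonneg _).trans (hC 0)
  have ha := norm_nonneg a
  have hb := norm_nonneg b
  have e1 : lam - lam' = a * (c (n + 1) - d (n + 1)) + b * (c (n - 1) - d (n - 1)) := by
    linear_combination h - h'
  have n1 : ‖lam - lam'‖ ≤ (‖a‖ + ‖b‖) * C := by
    rw [e1]; exact norm_neighbours_le _ _ _ _ (hC _) (hC _)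
  have e2 : (lam - μ k) * (z - w) = (a * (c (k + 1) - d (k + 1)) + b * (c (k - 1) - d (k - 1)))
      - (lam - lam') * w := by
    linear_combination hz - hw
  have h1 := gap_mul_norm_le hgap hlam hk e2 (B := (‖a‖ + ‖b‖) * C + (‖a‖ + ‖b‖) * C) (by
    refine (norm_sub_le _ _).trans (add_le_add (norm_neighbours_le _ _ _ _ (hC _) (hC _)) ?_)
    rw [norm_mul]
    calc _ ≤ ((‖a‖ + ‖b‖) * C) * 1 := by gcongr
      _ = _ := mul_one _)
  have h0 := norm_nonneg (z - w)
  by_contra! h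
  nlinarith [mul_nonneg (add_nonneg ha hb) hC0,
      mul_nonneg (mul_self_nonneg (‖a‖ + ‖b‖)) h0]

lemma SolvesRecurrence.unique (hgap : ∀ k ≠ n, D + 1 ≤ ‖μ n - μ k‖)
    (hD : 4 * (‖a‖ + ‖b‖ + 1) ^ 2 ≤ D) {lam lam' : ℂ} (hlam : ‖lam - μ n‖ ≤ 1)
    (hlam' : ‖lam' - μ n‖ ≤ 1) {c d : ℤ → ℂ}
    (hc : SolvesRecurrence a b μ lam c) (hcb : ∃ C, ∀ k, ‖c k‖ ≤ C) (hcn : c n = 1)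
    (hd : SolvesRecurrence a b μ lam' d) (hdb : ∃ C, ∀ k, ‖d k‖ ≤ C) (hdn : d n = 1) :
    lam = lam' := by
  have hc1 := hc.norm_le hgap hD hlam hcb hcn
  have hd1 := hd.norm_le hgap hD hlam' hdb hdn
  have en := hc n
  have en' := hd n
  rw [hcn, mul_one] at en
  rw [hdn, mul_one] at en'
  have key := le_two_mul_of_bootstrap (f := fun k ↦ ‖c k - d k‖) (θ := 0)
    ⟨1 + 1, fun k ↦ (norm_sub_le _ _).trans (add_le_add (hc1 k) (hd1 k))⟩ (by
    intro C hC k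
    have hC0 : 0 ≤ C := (norm_nonneg _).trans (hC 0)
    rw [zero_add]
    by_cases hk : k = n
    · subst hk; simp only [hcn, hdn, sub_self, norm_zero]; positivity
    exact norm_sub_le_half_of_quotients hgap hD hlam hC en en' hk (hc k) (hd k) (hd1 k))
  have e : ∀ k, c k = d k := fun k ↦ by
    have := key k
    simpa [sub_eq_zero] using this
  rw [e, e] at en
  exact sub_left_injective (en.trans en'.symm)

open BoundedContinuousFunction in
lemma exists_solvesRecurrence (hgap : ∀ k ≠ n, D + 1 ≤ ‖μ n - μ k‖)
    (hD : 4 * (‖a‖ + ‖b‖ + 1) ^ 2 ≤ D) :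
    ∃ (lam : ℂ) (c : ℤ → ℂ), ‖lam - μ n‖ ≤ 1 ∧ SolvesRecurrence a b μ lam c ∧
      (∃ C, ∀ k, ‖c k‖ ≤ C) ∧ c n = 1 := by
  have ha := norm_nonneg a
  have hb := norm_nonneg b
  set r : ℝ := 1 / (‖a‖ + ‖b‖ + 1) with hr
  have hr0 : 0 < r := by positivity
  have hrM : (‖a‖ + ‖b‖ + 1) * r = 1 := by rw [hr]; field_simp
  have hr1 : r ≤ 1 := by nlinarith
  let e : (ℤ →ᵇ ℂ) → ℤ → ℂ := fun c ↦ Function.update c n 1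
  let L : (ℤ →ᵇ ℂ) → ℂ := fun c ↦ μ n + (a * e c (n + 1) + b * e c (n - 1))
  let q : (ℤ →ᵇ ℂ) → ℤ → ℂ := fun c k ↦ (a * e c (k + 1) + b * e c (k - 1)) / (L c - μ k)
  let p : (ℤ →ᵇ ℂ) → ℤ → ℂ := fun c k ↦ if k ≠ n ∧ ‖q c k‖ ≤ r then q c k else 0
  have hp : ∀ c k, ‖p c k‖ ≤ r := by
    intro c k
    simp only [p]
    split_ifs with h
    · exact h.2
    · simpa using hr0.le
  let G : (ℤ →ᵇ ℂ) → (ℤ →ᵇ ℂ) := fun c ↦ ofNormedAddCommGroupDiscrete (p c) r (hp c)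
  have hG : ∀ c k, G c k = p c k := fun _ _ ↦ rfl
  let s : Set (ℤ →ᵇ ℂ) := Metric.closedBall 0 r
  have hs : ∀ c ∈ s, ∀ k, ‖c k‖ ≤ r := fun c hc k ↦
    (c.norm_coe_le_norm k).trans (by simpa [s] using hc)
  have he1 : ∀ c ∈ s, ∀ k, ‖e c k‖ ≤ 1 := by
    intro c hc k
    by_cases hk : k = n
    · subst hk; simp [e]
    · simpa [e, hk] using (hs c hc k).trans hr1
  have hen : ∀ c ∈ s, ∀ k ≠ n, ‖e c k‖ ≤ r := by
    intro c hc k hk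
    simpa [e, hk] using hs c hc k
  have hL : ∀ c ∈ s, ‖L c - μ n‖ ≤ 1 := by
    intro c hc
    simp only [L, add_sub_cancel_left]
    refine (norm_neighbours_le _ _ _ _ (hen c hc _ (by simp)) (hen c hc _ (by simp))).trans ?_
    nlinarith
  have hDpos : 0 < D := by nlinarith
  have hq : ∀ c ∈ s, ∀ k ≠ n, (L c - μ k) * q c k = a * e c (k + 1) + b * e c (k - 1) := by
    intro c hc k hk
    have h1 := gap_le_norm_sub hgap (hL c hc) hk
    have : L c - μ k ≠ 0 := by
      rw [← norm_pos_iff]; linarith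
    simp only [q]
    field_simp
  have hqr : ∀ c ∈ s, ∀ k ≠ n, ‖q c k‖ ≤ r := by
    intro c hc k hk
    have h1 := gap_mul_norm_le hgap (hL c hc) hk (hq c hc k hk)
      (norm_neighbours_le a b _ _ (he1 c hc _) (he1 c hc _))
    have h0 := norm_nonneg (q c k)
    have h2 : (‖a‖ + ‖b‖ + 1) * ((‖a‖ + ‖b‖ + 1) * ‖q c k‖) ≤ (‖a‖ + ‖b‖ + 1) * 1 := by
      nlinarith [mul_nonneg (sq_nonneg (‖a‖ + ‖b‖ + 1)) h0]
    rw [hr, le_div_iff₀' (by positivity)]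
    exact le_of_mul_le_mul_left h2 (by positivity)
  have hGq : ∀ c ∈ s, ∀ k ≠ n, G c k = q c k := by
    intro c hc k hk
    rw [hG]
    simp only [p]
    rw [if_pos ⟨hk, hqr c hc k hk⟩]
  have hmaps : MapsTo G s s := by
    intro c _
    simp only [s, Metric.mem_closedBall, dist_zero_right]
    rw [BoundedContinuousFunction.norm_le hr0.le]
    exact hp c
  have hcontr : ContractingWith (1 / 2) (hmaps.restrict G s s) := by
    refine ⟨by rw [← NNReal.coe_lt_coe]; norm_num, LipschitzWith.of_dist_le_mul ?_⟩
    rintro ⟨c, hc⟩ ⟨d, hd⟩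
    change dist (G c) (G d) ≤ _ * dist c d
    rw [BoundedContinuousFunction.dist_le (by positivity)]
    intro k
    rw [dist_eq_norm]
    by_cases hk : k = n
    · have : ∀ c, G c k = 0 := fun c ↦ by rw [hG]; simp [p, hk]
      rw [this, this, sub_self, norm_zero]; positivity
    rw [hGq c hc k hk, hGq d hd k hk]
    have := norm_sub_le_half_of_quotients hgap hD (hL c hc) (c := e c) (d := e d)
      (C := dist c d) (lam' := L d) (z := q c k) (w := q d k) (by
        intro j
        by_cases hj : j = n
        · subst hj; simp [e]
        · simpa [e, hj, ← dist_eq_norm] using c.dist_coe_le_dist (g := d) j)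
        (by simp [L]) (by simp [L]) hk (hq c hc k hk) (hq d hd k hk)
        ((hqr d hd k hk).trans hr1)
    refine this.trans (le_of_eq ?_)
    push_cast
    ring
  obtain ⟨c, hcs, hfix, -⟩ := hcontr.exists_fixedPoint' Metric.isClosed_closedBall.isComplete
    hmaps (x := 0) (by simp [s, hr0.le]) (edist_ne_top _ _)
  refine ⟨L c, e c, hL c hcs, ?_, ⟨1, he1 c hcs⟩, by simp [e]⟩
  intro k
  by_cases hk : k = n
  · subst hk; simp [L, e]
  · rw [← hq c hcs k hk, ← hGq c hcs k hk, hfix]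
    simp [e, hk]

end Recurrence

lemma hasDerivAt_exp_I_mul (w x : ℝ) :
    HasDerivAt (fun x : ℝ ↦ Complex.exp (I * w * x)) (I * w * Complex.exp (I * w * x)) x := by
  have h : HasDerivAt (fun x : ℝ ↦ I * w * (x : ℂ)) (I * w * 1) x :=
    (Complex.ofRealCLM.hasDerivAt (x := x)).const_mul (I * (w : ℂ))
  exact h.cexp.congr_deriv (by ring)

lemma norm_exp_I_mul (w x : ℝ) : ‖Complex.exp (I * w * x)‖ = 1 := by
  rw [show I * (w : ℂ) * (x : ℂ) = ((w * x : ℝ) : ℂ) * I by push_cast; ring]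
  exact Complex.norm_exp_ofReal_mul_I _

lemma hasDerivAt_tsum_mul_exp {w : ℤ → ℝ} {c : ℤ → ℂ} (hc : Summable fun k ↦ ‖c k‖)
    (hwc : Summable fun k ↦ ‖I * w k * c k‖) (x : ℝ) :
    HasDerivAt (fun x : ℝ ↦ ∑' k, c k * Complex.exp (I * w k * x))
      (∑' k, (I * w k * c k) * Complex.exp (I * w k * x)) x := by
  refine hasDerivAt_tsum (g := fun k (x : ℝ) ↦ c k * Complex.exp (I * w k * x))
    (g' := fun k (x : ℝ) ↦ (I * w k * c k) * Complex.exp (I * w k * x))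
    (y₀ := 0) hwc (fun k x ↦ ?_) (fun k x ↦ ?_) ?_ x
  · exact ((hasDerivAt_exp_I_mul (w k) x).const_mul (c k)).congr_deriv (by ring)
  · rw [norm_mul, norm_exp_I_mul, mul_one]
  · simpa using hc.of_norm

lemma continuous_tsum_mul_exp {w : ℤ → ℝ} {c : ℤ → ℂ} (hc : Summable fun k ↦ ‖c k‖) :
    Continuous (fun x : ℝ ↦ ∑' k, c k * Complex.exp (I * w k * x)) :=
  continuous_tsum (fun k ↦ by fun_prop) hc fun k x ↦ by
    rw [norm_mul, norm_exp_I_mul, mul_one]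

lemma exp_I_mul_shift (t : ℝ) (k : ℤ) (x : ℝ) :
    Complex.exp (2 * Real.pi * I * x) * Complex.exp (I * (2 * Real.pi * k + t : ℝ) * x) =
      Complex.exp (I * (2 * Real.pi * (k + 1 : ℤ) + t : ℝ) * x) := by
  rw [← Complex.exp_add]
  congr 1
  push_cast
  ring

lemma exp_I_mul_shift_neg (t : ℝ) (k : ℤ) (x : ℝ) :
    Complex.exp (-(2 * Real.pi * I) * x) * Complex.exp (I * (2 * Real.pi * k + t : ℝ) * x) =
      Complex.exp (I * (2 * Real.pi * (k - 1 : ℤ) + t : ℝ) * x) := by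
  rw [← Complex.exp_add]
  congr 1
  push_cast
  ring

lemma exp_I_mul_one (t : ℝ) (k : ℤ) :
    Complex.exp (I * (2 * Real.pi * k + t : ℝ) * (1 : ℝ)) = Complex.exp (I * t) := by
  rw [show I * ((2 * Real.pi * k + t : ℝ) : ℂ) * ((1 : ℝ) : ℂ)
    = I * t + k * (2 * Real.pi * I) by push_cast; ring, Complex.exp_add,
    Complex.exp_int_mul_two_pi_mul_I, mul_one]

/-- The square of the `k`-th quasiperiodic frequency. -/
noncomputable def freqSq (t : ℝ) (k : ℤ) : ℂ := ((2 * Real.pi * k + t : ℝ) : ℂ) ^ 2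

lemma integral_exp_int (m : ℤ) :
    ∫ x in (0 : ℝ)..1, Complex.exp (2 * Real.pi * I * m * x) = if m = 0 then 1 else 0 := by
  split_ifs with h
  · simp [h]
  · have h0 : 2 * Real.pi * I * (m : ℂ) ≠ 0 := by simp [h, Real.pi_ne_zero]
    rw [integral_exp_mul_complex h0]
    have : Complex.exp (2 * Real.pi * I * m * (1 : ℝ)) = 1 := by
      rw [show 2 * Real.pi * I * (m : ℂ) * (1 : ℝ) = m * (2 * Real.pi * I) by push_cast; ring]
      exact Complex.exp_int_mul_two_pi_mul_I m
    rw [this]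
    simp

lemma eq_zero_of_tsum_mul_exp_eq_zero {t : ℝ} {c : ℤ → ℂ} (hc : Summable fun k ↦ ‖c k‖)
    (h : ∀ x ∈ Icc (0 : ℝ) 1,
      ∑' k, c k * Complex.exp (I * (2 * Real.pi * k + t : ℝ) * x) = 0) (n : ℤ) : c n = 0 := by
  have hs : ∀ x : ℝ, Summable fun k : ℤ ↦
      c k * Complex.exp (I * (2 * Real.pi * k + t : ℝ) * x) := fun x ↦
    Summable.of_norm (by simpa only [norm_mul, norm_exp_I_mul, mul_one] using hc)
  have key := intervalIntegral.hasSum_integral_of_dominated_convergence (a := 0) (b := 1)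
    (μ := MeasureTheory.volume)
    (F := fun (k : ℤ) (x : ℝ) ↦ c k * Complex.exp (2 * Real.pi * I * (k - n : ℤ) * x))
    (f := fun _ ↦ 0) (fun k _ ↦ ‖c k‖)
    (fun k ↦ (by fun_prop : Continuous _).aestronglyMeasurable)
    (fun k ↦ Filter.Eventually.of_forall fun x _ ↦ by
      rw [norm_mul, show 2 * Real.pi * I * (k - n : ℤ) * (x : ℂ)
        = I * (2 * Real.pi * (k - n : ℤ) : ℝ) * x by push_cast; ring, norm_exp_I_mul, mul_one])
    (Filter.Eventually.of_forall fun x _ ↦ hc)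
    (by simp)
    (Filter.Eventually.of_forall fun x hx ↦ by
      rw [uIoc_of_le zero_le_one] at hx
      have h1 := (hs x).hasSum
      rw [h x ⟨hx.1.le, hx.2⟩] at h1
      have h2 := h1.mul_right (Complex.exp (-(I * (2 * Real.pi * n + t : ℝ) * x)))
      rw [zero_mul] at h2
      refine h2.congr_fun fun k ↦ ?_
      rw [mul_assoc (c k), ← Complex.exp_add]
      congr 2
      push_cast
      ring)
  simp only [intervalIntegral.integral_const_mul, integral_exp_int,
    intervalIntegral.integral_zero, sub_eq_zero] at key
  have h2 : HasSum (fun k : ℤ ↦ c k * if k = n then 1 else 0) (c n) := by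
    convert hasSum_ite_eq n (c n) using 2 with k
    split_ifs with hk <;> simp [hk]
  exact h2.unique key

lemma summable_of_solvesRecurrence {a b : ℂ} {t : ℝ} (ht : |t| ≤ Real.pi) {lam : ℂ} {c : ℤ → ℂ}
    (hc : SolvesRecurrence a b (freqSq t) lam c) (hb : ∃ C, ∀ k, ‖c k‖ ≤ C) :
    (Summable fun k ↦ ‖c k‖) ∧ Summable fun k ↦ ‖freqSq t k * c k‖ := by
  obtain ⟨C, hC⟩ := hb
  have e : ∀ k, freqSq t k * c k = lam * c k - (a * c (k + 1) + b * c (k - 1)) := fun k ↦ by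
    linear_combination -hc k
  have h1 : ∀ k, ‖freqSq t k * c k‖ ≤ ‖lam‖ * C + (‖a‖ + ‖b‖) * C := fun k ↦ by
    rw [e]
    refine (norm_sub_le _ _).trans (add_le_add ?_ (norm_neighbours_le _ _ _ _ (hC _) (hC _)))
    rw [norm_mul]
    gcongr
    exact hC k
  have h2 : ∀ k : ℤ, (k : ℝ) ^ 2 ≤ ‖freqSq t k‖ := fun k ↦ by
    rw [freqSq, norm_pow, Complex.norm_real, Real.norm_eq_abs, sq_abs, sq_le_sq]
    have hk : |(k : ℝ)| ≤ 2 * Real.pi * |(k : ℝ)| - Real.pi ∨ k = 0 := by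
      by_cases h : k = 0
      · exact Or.inr h
      · left
        have : (1 : ℝ) ≤ |(k : ℝ)| := by exact_mod_cast Int.one_le_abs h
        nlinarith [Real.pi_gt_three]
    rcases hk with hk | hk
    · have h3 := abs_sub_abs_le_abs_sub (2 * Real.pi * (k : ℝ)) (-t)
      rw [abs_mul, abs_of_pos Real.two_pi_pos, abs_neg, sub_neg_eq_add] at h3
      linarith
    · simp [hk]
  have s1 : Summable fun k ↦ ‖c k‖ := by
    have s := (Real.summable_one_div_int_pow (p := 2)).2 one_lt_two
    refine Summable.of_norm_bounded_eventually
      (s.mul_left (‖lam‖ * C + (‖a‖ + ‖b‖) * C)) ?_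
    filter_upwards [(Set.finite_singleton (0 : ℤ)).compl_mem_cofinite] with k hk
    have hk0 : (0 : ℝ) < (k : ℝ) ^ 2 := by
      have : (k : ℝ) ≠ 0 := by exact_mod_cast hk
      positivity
    rw [norm_norm, mul_one_div, le_div_iff₀' hk0]
    refine le_trans ?_ (h1 k)
    rw [norm_mul]
    gcongr
    exact h2 k
  refine ⟨s1, ?_⟩
  have s2 := (Equiv.addRight (1 : ℤ)).summable_iff.2 s1
  have s3 := (Equiv.subRight (1 : ℤ)).summable_iff.2 s1
  refine Summable.of_nonneg_of_le (fun _ ↦ norm_nonneg _) (fun k ↦ ?_)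
    ((s1.mul_left ‖lam‖).add ((s2.mul_left ‖a‖).add (s3.mul_left ‖b‖)))
  rw [e]
  refine (norm_sub_le _ _).trans (add_le_add (norm_mul _ _).le ((norm_add_le _ _).trans ?_))
  exact add_le_add (norm_mul _ _).le (norm_mul _ _).le

lemma isEigenvalueH_of_solvesRecurrence {a b : ℂ} {t : ℝ} (ht : |t| ≤ Real.pi) {lam : ℂ}
    {c : ℤ → ℂ} (hc : SolvesRecurrence a b (freqSq t) lam c) (hb : ∃ C, ∀ k, ‖c k‖ ≤ C)
    {n : ℤ} (hn : c n ≠ 0) : IsEigenvalueH a b t lam := by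
  obtain ⟨s0, s2⟩ := summable_of_solvesRecurrence ht hc hb
  set w : ℤ → ℝ := fun k ↦ 2 * Real.pi * k + t with hw
  have s2' : Summable fun k ↦ ‖I * w k * (I * w k * c k)‖ := by
    refine s2.congr fun k ↦ ?_
    rw [show I * (w k : ℂ) * (I * w k * c k) = -(freqSq t k * c k) by
      simp only [freqSq, hw]
      linear_combination (((w k : ℝ) : ℂ) ^ 2 * c k) * Complex.I_sq, norm_neg]
  have s1 : Summable fun k ↦ ‖I * w k * c k‖ := by
    refine Summable.of_nonneg_of_le (fun _ ↦ norm_nonneg _) (fun k ↦ ?_) (s0.add s2')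
    simp only [norm_mul, Complex.norm_I, one_mul]
    nlinarith [mul_nonneg (sq_nonneg (‖(w k : ℂ)‖ - 1)) (norm_nonneg (c k)),
      mul_nonneg (norm_nonneg (w k : ℂ)) (norm_nonneg (c k)),
      mul_nonneg (sq_nonneg (‖(w k : ℂ)‖)) (norm_nonneg (c k)), norm_nonneg (c k)]
  have d1 := hasDerivAt_tsum_mul_exp s0 s1
  have d2 := hasDerivAt_tsum_mul_exp s1 s2'
  have e1 := funext fun x ↦ (d1 x).deriv
  have e2 := funext fun x ↦ (d2 x).deriv
  refine ⟨fun x : ℝ ↦ ∑' k, c k * Complex.exp (I * w k * x), ?_, ?_, ?_, ?_, ?_⟩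
  · rw [show (2 : WithTop ℕ∞) = 1 + 1 by norm_num, contDiff_succ_iff_deriv]
    refine ⟨fun x ↦ (d1 x).differentiableAt, by simp, ?_⟩
    rw [e1, contDiff_one_iff_deriv, e2]
    exact ⟨fun x ↦ (d2 x).differentiableAt, continuous_tsum_mul_exp s2'⟩
  · exact fun h ↦ hn (eq_zero_of_tsum_mul_exp_eq_zero s0 h n)
  · intro x _
    rw [e1, e2]
    have hs : ∀ {d : ℤ → ℂ}, (Summable fun k ↦ ‖d k‖) →
        Summable fun k ↦ d k * Complex.exp (I * w k * x) := fun hd ↦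
      Summable.of_norm (by simpa only [norm_mul, norm_exp_I_mul, mul_one] using hd)
    have H0 := (hs s0).hasSum
    have H2 := (hs s2').hasSum
    have Hm : HasSum (fun k ↦ c (k + 1) * Complex.exp (I * w k * x))
        (Complex.exp (-(2 * Real.pi * I) * x) * ∑' k, c k * Complex.exp (I * w k * x)) := by
      have := (Equiv.addRight (1 : ℤ)).hasSum_iff.2
        (H0.mul_left (Complex.exp (-(2 * Real.pi * I) * x)))
      refine this.congr_fun fun k ↦ ?_
      have := exp_I_mul_shift_neg t (k + 1) x
      rw [add_sub_cancel_right] at this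
      simp only [Function.comp, Equiv.coe_addRight, hw]
      rw [← this]
      ring
    have Hp : HasSum (fun k ↦ c (k - 1) * Complex.exp (I * w k * x))
        (Complex.exp (2 * Real.pi * I * x) * ∑' k, c k * Complex.exp (I * w k * x)) := by
      have := (Equiv.subRight (1 : ℤ)).hasSum_iff.2
        (H0.mul_left (Complex.exp (2 * Real.pi * I * x)))
      refine this.congr_fun fun k ↦ ?_
      have := exp_I_mul_shift t (k - 1) x
      rw [sub_add_cancel] at this
      simp only [Function.comp, Equiv.subRight_apply, hw]
      rw [← this]
      ring
    have HL := H2.neg.add ((Hm.mul_left a).add (Hp.mul_left b))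
    have HR := H0.mul_left lam
    have hfun : (fun k ↦ -((I * w k * (I * w k * c k)) * Complex.exp (I * w k * x)) +
        (a * (c (k + 1) * Complex.exp (I * w k * x)) +
          b * (c (k - 1) * Complex.exp (I * w k * x)))) =
        fun k ↦ lam * (c k * Complex.exp (I * w k * x)) := by
      funext k
      have := hc k
      simp only [freqSq] at this
      simp only [hw]
      linear_combination (-Complex.exp (I * (2 * Real.pi * k + t : ℝ) * x)) * this
        - (((2 * Real.pi * k + t : ℝ) : ℂ) ^ 2 * c k *
          Complex.exp (I * (2 * Real.pi * k + t : ℝ) * x)) * Complex.I_sq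
    rw [hfun] at HL
    rw [← HL.unique HR, mathieuPot]
    ring
  · simp only [hw]
    rw [← tsum_mul_left]
    refine tsum_congr fun k ↦ ?_
    rw [exp_I_mul_one]
    simp [mul_comm]
  · rw [e1]
    simp only [hw]
    rw [← tsum_mul_left]
    refine tsum_congr fun k ↦ ?_
    rw [exp_I_mul_one]
    simp [mul_comm]

/-- The `k`-th quasiperiodic Fourier coefficient of `y` on `[0,1]`. -/
noncomputable def quasiCoeff (t : ℝ) (y : ℝ → ℂ) (k : ℤ) : ℂ :=
  ∫ x in (0 : ℝ)..1, y x * Complex.exp (-(I * (2 * Real.pi * k + t : ℝ) * x))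

lemma norm_quasiCoeff_le (t : ℝ) {y : ℝ → ℂ} (hy : Continuous y) :
    ∃ C, ∀ k, ‖quasiCoeff t y k‖ ≤ C := by
  obtain ⟨C, hC⟩ := isCompact_Icc.exists_bound_of_continuousOn (s := Icc (0 : ℝ) 1)
    hy.continuousOn
  refine ⟨C * |1 - 0|, fun k ↦ intervalIntegral.norm_integral_le_of_norm_le_const fun x hx ↦ ?_⟩
  rw [uIoc_of_le zero_le_one] at hx
  rw [norm_mul, show -(I * ((2 * Real.pi * k + t : ℝ) : ℂ) * (x : ℂ))
    = I * (-(2 * Real.pi * k + t) : ℝ) * x by push_cast; ring, norm_exp_I_mul, mul_one]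
  exact hC x ⟨hx.1.le, hx.2⟩

lemma eq_zero_of_quasiCoeff_eq_zero {t : ℝ} {y : ℝ → ℂ} (hy : Continuous y)
    (hbc : y 1 = Complex.exp (I * t) * y 0) (h : ∀ k, quasiCoeff t y k = 0) :
    ∀ x ∈ Icc (0 : ℝ) 1, y x = 0 := by
  set g : ℝ → ℂ := fun x ↦ y x * Complex.exp (-(I * t * x)) with hg
  have hgc : Continuous g := by fun_prop
  have g01 : g 0 = g 1 := by
    simp only [hg, hbc]
    have : Complex.exp (I * t) * Complex.exp (-(I * t)) = 1 := by
      rw [← Complex.exp_add]; simp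
    simp only [Complex.ofReal_zero, Complex.ofReal_one, mul_zero, mul_one, neg_zero,
      Complex.exp_zero]
    linear_combination -y 0 * this
  let f : C(AddCircle (1 : ℝ), ℂ) := ⟨AddCircle.liftIco 1 0 g,
    AddCircle.liftIco_zero_continuous g01 hgc.continuousOn⟩
  have hf : fourierCoeff (f : AddCircle (1 : ℝ) → ℂ) = 0 := by
    funext k
    change fourierCoeff (AddCircle.liftIco 1 0 g) k = 0
    rw [fourierCoeff_liftIco_eq, fourierCoeffOn_eq_integral]
    have := h k
    rw [quasiCoeff] at this
    simp only [zero_add, sub_zero, div_one, one_smul]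
    rw [← this]
    refine intervalIntegral.integral_congr fun x _ ↦ ?_
    simp only [fourier_coe_apply, smul_eq_mul, hg]
    rw [mul_left_comm, ← Complex.exp_add]
    congr 2
    push_cast
    ring
  have hf0 : ∀ x, f x = 0 := fun x ↦ by
    have := has_pointwise_sum_fourier_series_of_summable (f := f)
      (by rw [hf]; exact summable_zero) x
    simp only [hf, Pi.zero_apply, zero_smul] at this
    exact this.unique hasSum_zero
  have h1 : ∀ x ∈ Ico (0 : ℝ) 1, y x = 0 := fun x hx ↦ by
    have := hf0 (x : AddCircle (1 : ℝ))
    change AddCircle.liftIco 1 0 g _ = 0 at this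
    rw [AddCircle.liftIco_zero_coe_apply hx] at this
    simpa [hg] using this
  intro x hx
  rcases hx.2.lt_or_eq with hlt | rfl
  · exact h1 x ⟨hx.1, hlt⟩
  · rw [hbc, h1 0 (by simp), mul_zero]

lemma solvesRecurrence_quasiCoeff {a b : ℂ} {t : ℝ} {lam : ℂ} {y : ℝ → ℂ} (hy : ContDiff ℝ 2 y)
    (hode : ∀ x ∈ Icc (0 : ℝ) 1, -(deriv (deriv y) x) + mathieuPot a b x * y x = lam * y x)
    (h0 : y 1 = Complex.exp (I * t) * y 0)
    (h1 : deriv y 1 = Complex.exp (I * t) * deriv y 0) :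
    SolvesRecurrence a b (freqSq t) lam (quasiCoeff t y) := by
  intro k
  have hy0 : Continuous y := hy.continuous
  rw [show (2 : WithTop ℕ∞) = 1 + 1 by norm_num, contDiff_succ_iff_deriv] at hy
  obtain ⟨hd, -, hy1⟩ := hy
  rw [contDiff_one_iff_deriv] at hy1
  obtain ⟨hd1, hc2⟩ := hy1
  set w : ℝ := 2 * Real.pi * k + t with hw
  have hE : ∀ x : ℝ, HasDerivAt (fun x : ℝ ↦ Complex.exp (-(I * w * x)))
      (-(I * w) * Complex.exp (-(I * w * x))) x := fun x ↦ by
    have := hasDerivAt_exp_I_mul (-w) x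
    simpa using this
  have hF : ∀ x : ℝ, HasDerivAt
      (fun x : ℝ ↦ (deriv y x + I * w * y x) * Complex.exp (-(I * w * x)))
      ((deriv (deriv y) x + w ^ 2 * y x) * Complex.exp (-(I * w * x))) x := fun x ↦ by
    have := ((hd1 x).hasDerivAt.add ((hd x).hasDerivAt.const_mul (I * (w : ℂ)))).mul (hE x)
    refine this.congr_deriv ?_
    simp only [Pi.add_apply]
    linear_combination -(w ^ 2 * y x * Complex.exp (-(I * w * x))) * Complex.I_sq
  have hI := intervalIntegral.integral_eq_sub_of_hasDerivAt (a := 0) (b := 1)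
    (fun x _ ↦ hF x) (by
      have : Continuous fun x : ℝ ↦
          (deriv (deriv y) x + w ^ 2 * y x) * Complex.exp (-(I * w * x)) := by fun_prop
      exact this.intervalIntegrable _ _)
  have hE1 : Complex.exp (-(I * w * (1 : ℝ))) = Complex.exp (-(I * t)) := by
    rw [Complex.exp_neg, Complex.exp_neg, hw, exp_I_mul_one]
  have hbd : (deriv y 1 + I * w * y 1) * Complex.exp (-(I * w * (1 : ℝ)))
      - (deriv y 0 + I * w * y 0) * Complex.exp (-(I * w * (0 : ℝ))) = 0 := by
    rw [hE1, h0, h1]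
    have : Complex.exp (I * t) * Complex.exp (-(I * t)) = 1 := by
      rw [← Complex.exp_add]; simp
    simp only [Complex.ofReal_zero, mul_zero, neg_zero, Complex.exp_zero]
    linear_combination (deriv y 0 + I * w * y 0) * this
  rw [hbd] at hI
  have hcont : ∀ j : ℤ, IntervalIntegrable
      (fun x : ℝ ↦ y x * Complex.exp (-(I * (2 * Real.pi * j + t : ℝ) * x)))
      MeasureTheory.volume 0 1 := fun j ↦
    (by fun_prop : Continuous _).intervalIntegrable _ _
  have hJ : (freqSq t k - lam) * quasiCoeff t y k
      + (a * quasiCoeff t y (k + 1) + b * quasiCoeff t y (k - 1)) = 0 := by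
    rw [← hI]
    simp only [quasiCoeff]
    rw [← intervalIntegral.integral_const_mul, ← intervalIntegral.integral_const_mul,
      ← intervalIntegral.integral_const_mul,
      ← intervalIntegral.integral_add ((hcont _).const_mul _) ((hcont _).const_mul _),
      ← intervalIntegral.integral_add ((hcont _).const_mul _)
        (((hcont _).const_mul _).add ((hcont _).const_mul _))]
    refine intervalIntegral.integral_congr fun x hx ↦ ?_
    rw [uIcc_of_le zero_le_one] at hx
    have hx' := hode x hx
    rw [mathieuPot] at hx'
    have ep : Complex.exp (-(I * (2 * Real.pi * (k + 1 : ℤ) + t : ℝ) * x)) =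
        Complex.exp (-(2 * Real.pi * I) * x) * Complex.exp (-(I * w * x)) := by
      rw [← Complex.exp_add, hw]; congr 1; push_cast; ring
    have em : Complex.exp (-(I * (2 * Real.pi * (k - 1 : ℤ) + t : ℝ) * x)) =
        Complex.exp (2 * Real.pi * I * x) * Complex.exp (-(I * w * x)) := by
      rw [← Complex.exp_add, hw]; congr 1; push_cast; ring
    simp only [ep, em, freqSq, ← hw]
    linear_combination Complex.exp (-(I * w * x)) * hx'
  linear_combination -hJ

lemma IsEigenvalueH.exists_solvesRecurrence {a b : ℂ} {t : ℝ} {lam : ℂ} {n : ℤ} {D : ℝ}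
    (hgap : ∀ k ≠ n, D + 1 ≤ ‖freqSq t n - freqSq t k‖)
    (hD : 4 * (‖a‖ + ‖b‖ + 1) ^ 2 ≤ D) (hlam : ‖lam - freqSq t n‖ ≤ 1)
    (h : IsEigenvalueH a b t lam) :
    ∃ c, SolvesRecurrence a b (freqSq t) lam c ∧ (∃ C, ∀ k, ‖c k‖ ≤ C) ∧ c n = 1 := by
  obtain ⟨y, hy, hne, hode, h0, h1⟩ := h
  have hrec := solvesRecurrence_quasiCoeff hy hode h0 h1
  obtain ⟨C, hC⟩ := norm_quasiCoeff_le t hy.continuous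
  set d := quasiCoeff t y with hd
  have hdn : d n ≠ 0 := fun hz ↦
    hne (eq_zero_of_quasiCoeff_eq_zero hy.continuous h0
      (hrec.eq_zero hgap hD hlam ⟨C, hC⟩ hz))
  refine ⟨fun k ↦ d k / d n, fun k ↦ ?_, ⟨C / ‖d n‖, fun k ↦ ?_⟩, div_self hdn⟩
  · have := hrec k
    field_simp
    linear_combination this
  · rw [norm_div]
    gcongr
    exact hC k

lemma mul_abs_le_norm_freqSq_sub {ρ t : ℝ} (hρ : ρ ∈ Ioo 0 (Real.pi / 2))
    (ht : t ∈ Icc ρ (Real.pi - ρ)) {n k : ℤ} (hk : k ≠ n) :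
    ρ * |(n : ℝ)| ≤ ‖freqSq t n - freqSq t k‖ := by
  obtain ⟨hρ0, hρ1⟩ := hρ
  obtain ⟨ht0, ht1⟩ := ht
  have hπ := Real.pi_gt_three
  have e : freqSq t n - freqSq t k
      = ((2 * Real.pi * ((n - k : ℤ) : ℝ) * (2 * Real.pi * ((n + k : ℤ) : ℝ) + 2 * t) : ℝ) : ℂ) := by
    simp only [freqSq]; push_cast; ring
  rw [e, Complex.norm_real, Real.norm_eq_abs, abs_mul, abs_mul, abs_of_pos Real.two_pi_pos]
  have hp : (1 : ℝ) ≤ |((n - k : ℤ) : ℝ)| := by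
    exact_mod_cast Int.one_le_abs (sub_ne_zero.2 hk.symm)
  have hq : 2 * ρ ≤ |2 * Real.pi * ((n + k : ℤ) : ℝ) + 2 * t| ∧
      2 * ρ * |((n + k : ℤ) : ℝ)| ≤ |2 * Real.pi * ((n + k : ℤ) : ℝ) + 2 * t| := by
    rcases le_or_gt 0 (n + k) with h | h
    · have h' : (0 : ℝ) ≤ ((n + k : ℤ) : ℝ) := by exact_mod_cast h
      rw [abs_of_nonneg h', abs_of_nonneg (by nlinarith)]
      constructor <;> nlinarith
    · have h' : ((n + k : ℤ) : ℝ) ≤ -1 := by exact_mod_cast Int.le_sub_one_of_lt h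
      rw [abs_of_neg (by linarith : ((n + k : ℤ) : ℝ) < 0), abs_of_neg (by nlinarith)]
      constructor <;> nlinarith
  have hsum : 2 * |(n : ℝ)| ≤ |((n - k : ℤ) : ℝ)| + |((n + k : ℤ) : ℝ)| := by
    have := abs_add_le ((n - k : ℤ) : ℝ) ((n + k : ℤ) : ℝ)
    rw [show ((n - k : ℤ) : ℝ) + ((n + k : ℤ) : ℝ) = 2 * n by push_cast; ring, abs_mul] at this
    simpa using this
  set P := |((n - k : ℤ) : ℝ)|
  set Q := |2 * Real.pi * ((n + k : ℤ) : ℝ) + 2 * t|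
  set m := |((n + k : ℤ) : ℝ)|
  have hm : 0 ≤ m := abs_nonneg _
  have h1 : ρ * P ≤ P * Q := by nlinarith
  have h2 : ρ * m ≤ P * Q := by nlinarith
  have h3 : 0 ≤ P * Q := by nlinarith
  nlinarith

theorem unique_eigenvalue_in_disk (a b : ℂ) (ρ : ℝ)
    (hρ : ρ ∈ Set.Ioo 0 (Real.pi / 2)) :
    ∃ N : ℕ, ∀ t ∈ Set.Icc ρ (Real.pi - ρ), ∀ n : ℤ, (N : ℤ) < |n| →
      ∃! lam : ℂ, ‖lam - (((2 * Real.pi * n + t : ℝ)) : ℂ)^2‖ ≤ 1 ∧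
        IsEigenvalueH a b t lam := by
  set D : ℝ := 4 * (‖a‖ + ‖b‖ + 1) ^ 2 with hD
  obtain ⟨N, hN⟩ := exists_nat_ge ((D + 1) / ρ)
  refine ⟨N, fun t ht n hn ↦ ?_⟩
  have hρ0 := hρ.1
  have htπ : |t| ≤ Real.pi := abs_le.2 ⟨by linarith [ht.1, Real.pi_pos], by linarith [ht.2]⟩
  have hn' : (N : ℝ) < |(n : ℝ)| := by exact_mod_cast hn
  have hgap : ∀ k ≠ n, D + 1 ≤ ‖freqSq t n - freqSq t k‖ := fun k hk ↦ by
    refine le_trans ?_ (mul_abs_le_norm_freqSq_sub hρ ht hk)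
    rw [← div_le_iff₀' hρ0]
    linarith
  obtain ⟨lam, c, hlam, hc, hcb, hcn⟩ := exists_solvesRecurrence hgap hD.ge
  refine ⟨lam, ⟨hlam, isEigenvalueH_of_solvesRecurrence htπ hc hcb (n := n) (by simp [hcn])⟩, ?_⟩
  rintro lam' ⟨hlam', hev⟩
  obtain ⟨d, hd, hdb, hdn⟩ := hev.exists_solvesRecurrence hgap hD.ge hlam'
  exact hd.unique hgap hD.ge hlam' hlam hdb hdn hc hcb hcn
end
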